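/- arXiv:2506.17426 — 2 statements merged into one kernel-verified Lean document; each statement's English description precedes it below -/
import Mathlib

section
/- Let Ω = Ω_θ ⊂ ℝ² be a sector with opening angle θ ∈ (0,π) or θ ∈ (π,2π), and let φ ∈ C_0^∞(ℝ²) be real-valued with φ(0,0) = 0. Then the positive and negative eigenvalues of A_Ω[φ] satisfy λ_k^{(±)}(A_Ω[φ]) = O(k^{−1}) as k → ∞. -/
open MeasureTheory Filter Complex
open scoped ENNReal InnerProductSpace RealInnerProductSpace

noncomputable section

/-- `λ_{k+1}^{(+)}(A)` via the Courant–Fischer min-max principle: for a compact self-adjoint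
operator this gives the `(k+1)`-st positive eigenvalue in non-increasing order counting
multiplicity (and `0` once the positive eigenvalues are exhausted). -/
def eigPlus {H : Type*} [NormedAddCommGroup H] [InnerProductSpace ℂ H]
    (A : H →L[ℂ] H) (k : ℕ) : ℝ :=
  ⨅ V : {V : Submodule ℂ H // Module.rank ℂ V ≤ (k : Cardinal)},
    ⨆ u : {u : H // u ∈ (V : Submodule ℂ H)ᗮ ∧ ‖u‖ = 1},
      (⟪A u.1, u.1⟫_ℂ).re

/-- `λ_{k+1}^{(-)}(A)`, the `(k+1)`-st negative eigenvalue sequence member (absolute value). -/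
def eigMinus {H : Type*} [NormedAddCommGroup H] [InnerProductSpace ℂ H]
    (A : H →L[ℂ] H) (k : ℕ) : ℝ :=
  eigPlus (-A) k

/-- the argument of a complex number, taken in `[0, 2π)` -/
def arg2pi (z : ℂ) : ℝ := if 0 ≤ z.arg then z.arg else z.arg + 2 * Real.pi

/-- the open sector `Ω_θ = {(x,ξ) : 0 < arg (x + iξ) < θ}` in the phase plane -/
def sector (θ : ℝ) : Set (ℝ × ℝ) :=
  {p | 0 < arg2pi (p.1 + p.2 * Complex.I) ∧ arg2pi (p.1 + p.2 * Complex.I) < θ}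

abbrev L2R := MeasureTheory.Lp ℂ 2 (volume : Measure ℝ)

/-- the Weyl quantization integral formula in dimension one -/
def weylIntegral (a : ℝ × ℝ → ℂ) (u : ℝ → ℂ) (x : ℝ) : ℂ :=
  (2 * Real.pi : ℝ)⁻¹ *
    ∫ ξ : ℝ, ∫ y : ℝ,
      Complex.exp (Complex.I * ((x - y) * ξ : ℝ)) * a ((x + y) / 2, ξ) * u y

/-- `T` is the Weyl pseudodifferential operator `Op^w(a)` on `L²(ℝ)` -/
def IsWeylOp (a : ℝ × ℝ → ℂ) (T : L2R →L[ℂ] L2R) : Prop :=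
  ∀ u : SchwartzMap ℝ ℂ, ∀ f : L2R, (⇑f =ᵐ[volume] ⇑u) →
    ⇑(T f) =ᵐ[volume] weylIntegral a ⇑u

/-- the symbol `1_Ω φ` of the operator `A_Ω[φ]` -/
def symbAOm (Ω : Set (ℝ × ℝ)) (φ : ℝ × ℝ → ℝ) : ℝ × ℝ → ℂ :=
  Set.indicator Ω fun τ => (φ τ : ℂ)

theorem exists_submodule_of_sum_sq_le {H : Type*} [NormedAddCommGroup H] [InnerProductSpace ℂ H]
    (q : H → ℂ) (V : Submodule ℂ H) (N n : ℕ) (hV : Module.rank ℂ V ≤ (N : Cardinal)) (D ε : ℝ)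
    (hε : 0 < ε) (hDε : D < (n + 1) * ε ^ 2)
    (hD : ∀ (m : ℕ) (v : Fin m → H), Orthonormal ℂ v → (∀ i, v i ∈ Vᗮ) →
      ∑ i, ‖q (v i)‖ ^ 2 ≤ D) :
    ∃ W : Submodule ℂ H, Module.rank ℂ W ≤ ((N + n : ℕ) : Cardinal) ∧
      ∀ u ∈ Wᗮ, ‖u‖ = 1 → ‖q u‖ ≤ ε := by
  classical
  let P : ℕ → Prop := fun m => ∃ v : Fin m → H, Orthonormal ℂ v ∧ (∀ i, v i ∈ Vᗮ) ∧
    ∀ i, ε < ‖q (v i)‖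
  have h0 : P 0 := ⟨Fin.elim0, ⟨fun i => i.elim0, fun i => i.elim0⟩, fun i => i.elim0,
    fun i => i.elim0⟩
  have hlast : ¬ P (n + 1) := by
    rintro ⟨v, hv, hvV, hq⟩
    have h1 : ∑ _i : Fin (n + 1), ε ^ 2 ≤ ∑ i, ‖q (v i)‖ ^ 2 :=
      Finset.sum_le_sum fun i _ => pow_le_pow_left₀ hε.le (hq i).le 2
    have h2 := hD _ v hv hvV
    simp at h1
    linarith
  obtain ⟨m, hmn, hm, hm'⟩ : ∃ m ≤ n, P m ∧ ¬ P (m + 1) := by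
    by_contra! hcon
    have : ∀ m ≤ n + 1, P m := by
      intro m
      induction m with
      | zero => exact fun _ => h0
      | succ m ih => exact fun h => hcon m (by omega) (ih (by omega))
    exact hlast (this _ le_rfl)
  obtain ⟨v, hv, hvV, hq⟩ := hm
  refine ⟨V ⊔ Submodule.span ℂ (Set.range v), ?_, ?_⟩
  · refine (Submodule.rank_add_le_rank_add_rank _ _).trans ?_
    push_cast
    refine add_le_add hV ((rank_span_le _).trans ?_)
    have h := Cardinal.mk_range_le_lift (f := v)
    simp only [Cardinal.lift_uzero, Cardinal.mk_fin, Cardinal.lift_natCast] at h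
    exact h.trans (by exact_mod_cast hmn)
  · intro u hu hu1
    by_contra! hlt
    rw [← Submodule.inf_orthogonal] at hu
    have hu2 := (Submodule.mem_orthogonal _ _).1 hu.2
    refine hm' ⟨Matrix.vecCons u v, orthonormal_vecCons_iff.2 ⟨hu1, fun i => ?_, hv⟩, ?_, ?_⟩
    · rw [← inner_conj_symm, hu2 _ (Submodule.subset_span ⟨i, rfl⟩), map_zero]
    · intro i
      refine Fin.cases ?_ (fun j => ?_) i
      · exact hu.1
      · exact hvV j
    · intro i
      refine Fin.cases ?_ (fun j => ?_) i
      · exact hlt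
      · exact hq j

theorem eigPlus_le {H : Type*} [NormedAddCommGroup H] [InnerProductSpace ℂ H]
    (A : H →L[ℂ] H) (k : ℕ) (W : Submodule ℂ H) (hW : Module.rank ℂ W ≤ (k : Cardinal)) (ε : ℝ)
    (hε : 0 ≤ ε) (h : ∀ u ∈ Wᗮ, ‖u‖ = 1 → ‖⟪A u, u⟫_ℂ‖ ≤ ε) : eigPlus A k ≤ ε := by
  have habs : ∀ u : H, ‖u‖ = 1 → |(⟪A u, u⟫_ℂ).re| ≤ ‖A‖ := fun u hu => by
    refine (Complex.abs_re_le_norm _).trans ((norm_inner_le_norm _ _).trans ?_)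
    simpa [hu] using A.le_opNorm u
  refine (ciInf_le ?_ ⟨W, hW⟩).trans ?_
  · refine ⟨-‖A‖, ?_⟩
    rintro _ ⟨V, rfl⟩
    dsimp only
    rcases isEmpty_or_nonempty {u : H // u ∈ (V : Submodule ℂ H)ᗮ ∧ ‖u‖ = 1} with h | ⟨⟨u⟩⟩
    · rw [Real.iSup_of_isEmpty]
      simp
    · refine (abs_le.1 (habs u.1 u.2.2)).1.trans
        (le_ciSup (f := fun u : {u : H // u ∈ (V : Submodule ℂ H)ᗮ ∧ ‖u‖ = 1} =>
          (⟪A u.1, u.1⟫_ℂ).re) ⟨‖A‖, ?_⟩ u)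
      rintro _ ⟨w, rfl⟩
      exact (abs_le.1 (habs w.1 w.2.2)).2
  · exact Real.iSup_le (fun u => (Complex.re_le_norm _).trans (h u.1 u.2.1 u.2.2)) hε

theorem eigPlus_le_div {H : Type*} [NormedAddCommGroup H] [InnerProductSpace ℂ H]
    (A : H →L[ℂ] H) (c : ℕ) (D : ℝ) (hD : 0 ≤ D)
    (h : ∀ n : ℕ, 1 ≤ n → ∃ V : Submodule ℂ H, Module.rank ℂ V ≤ ((c * n : ℕ) : Cardinal) ∧
      ∀ (m : ℕ) (v : Fin m → H), Orthonormal ℂ v → (∀ i, v i ∈ Vᗮ) →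
        ∑ i, ‖⟪A (v i), v i⟫_ℂ‖ ^ 2 ≤ D / n) (k : ℕ) :
    eigPlus A k ≤ (2 * (c + 1) * (√(D + 1) + ‖A‖)) / (k + 1) := by
  have hA : ∀ u : H, ‖u‖ = 1 → ‖⟪A u, u⟫_ℂ‖ ≤ ‖A‖ := fun u hu => by
    refine (norm_inner_le_norm _ _).trans ?_
    simpa [hu] using A.le_opNorm u
  have hs : 0 < √(D + 1) := by positivity
  have hk : (0 : ℝ) < k + 1 := by positivity
  by_cases hkc : k < c + 1
  · refine eigPlus_le A k ⊥ (by simp) _ (by positivity) fun u _ hu => (hA u hu).trans ?_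
    rw [le_div_iff₀ hk]
    have h1 : (k : ℝ) + 1 ≤ c + 1 := by exact_mod_cast hkc
    calc ‖A‖ * (k + 1) ≤ ‖A‖ * (c + 1) := by gcongr
      _ ≤ 2 * (c + 1) * (√(D + 1) + ‖A‖) := by
        nlinarith [norm_nonneg A, mul_nonneg (norm_nonneg A) (Nat.cast_nonneg (α := ℝ) c),
          mul_nonneg hs.le (Nat.cast_nonneg (α := ℝ) c)]
  · push Not at hkc
    set n := k / (c + 1) with hn
    have hn1 : 1 ≤ n := (Nat.one_le_div_iff (by omega)).2 hkc
    have hnk : n * (c + 1) ≤ k := Nat.div_mul_le_self _ _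
    have hkn : k + 1 ≤ (n + 1) * (c + 1) := by
      have := Nat.lt_div_mul_add (a := k) (b := c + 1) (by omega)
      rw [← hn] at this
      nlinarith
    have hn0 : (0 : ℝ) < n := by exact_mod_cast hn1
    obtain ⟨V, hV, hVD⟩ := h n hn1
    obtain ⟨W, hW, hWq⟩ := exists_submodule_of_sum_sq_le (fun u => ⟪A u, u⟫_ℂ) V (c * n) n hV
      (D / n) (√(D + 1) / n) (by positivity) (by
        rw [div_pow, Real.sq_sqrt (by positivity), div_lt_iff₀ hn0]
        field_simp
        nlinarith) hVD
    refine (eigPlus_le A k W (hW.trans (by exact_mod_cast (by nlinarith))) _ (by positivity)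
      hWq).trans ?_
    rw [div_le_div_iff₀ hn0 hk]
    have h2 : (k : ℝ) + 1 ≤ 2 * (c + 1) * n := by
      have h3 : (1 : ℝ) ≤ n := by exact_mod_cast hn1
      have h4 : (k : ℝ) + 1 ≤ (n + 1) * (c + 1) := by exact_mod_cast hkn
      nlinarith [(Nat.cast_nonneg c : (0 : ℝ) ≤ c)]
    calc √(D + 1) * (k + 1) ≤ √(D + 1) * (2 * (c + 1) * n) := by gcongr
      _ ≤ _ := by
        have : 0 ≤ 2 * ((c : ℝ) + 1) * ‖A‖ * n := by positivity
        nlinarith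

theorem memLp_tensor (f g : L2R) :
    MemLp (fun z : ℝ × ℝ => f z.1 * g z.2) 2 (volume : Measure (ℝ × ℝ)) := by
  have hf := Lp.memLp f
  have hg := Lp.memLp g
  have hm : AEStronglyMeasurable (fun z : ℝ × ℝ => f z.1 * g z.2) (volume : Measure (ℝ × ℝ)) :=
    hf.1.comp_fst.mul hg.1.comp_snd
  rw [memLp_two_iff_integrable_sq_norm hm]
  have h := ((memLp_two_iff_integrable_sq_norm hf.1).1 hf).mul_prod
    ((memLp_two_iff_integrable_sq_norm hg.1).1 hg)
  refine h.congr (Eventually.of_forall fun z => ?_)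
  simp [mul_pow]

/-- The function `(x, y) ↦ f x * g y` as an element of `L²(ℝ²)`. -/
def tensor (f g : L2R) : Lp ℂ 2 (volume : Measure (ℝ × ℝ)) := (memLp_tensor f g).toLp

theorem coeFn_tensor (f g : L2R) :
    ⇑(tensor f g) =ᵐ[volume] fun z : ℝ × ℝ => f z.1 * g z.2 :=
  (memLp_tensor f g).coeFn_toLp

theorem inner_tensor (f g f' g' : L2R) :
    ⟪tensor f g, tensor f' g'⟫_ℂ = ⟪f, f'⟫_ℂ * ⟪g, g'⟫_ℂ := by
  rw [L2.inner_def, L2.inner_def, L2.inner_def, ← integral_prod_mul]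
  refine integral_congr_ae ?_
  filter_upwards [coeFn_tensor f g, coeFn_tensor f' g'] with z h1 h2
  rw [h1, h2]
  simp only [RCLike.inner_apply, map_mul]
  ring

theorem inner_star_star (f g : L2R) : ⟪star f, star g⟫_ℂ = ⟪g, f⟫_ℂ := by
  rw [L2.inner_def, L2.inner_def]
  refine integral_congr_ae ?_
  filter_upwards [Lp.coeFn_star f, Lp.coeFn_star g] with z h1 h2
  rw [h1, h2]
  simp [RCLike.inner_apply, mul_comm]

theorem inner_tensor_star (f g : L2R) :
    ⟪tensor f (star f), tensor g (star g)⟫_ℂ = ((‖⟪f, g⟫_ℂ‖ ^ 2 : ℝ) : ℂ) := by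
  rw [inner_tensor, inner_star_star, ← inner_conj_symm g f, RCLike.mul_conj]
  simp

theorem continuous_tensor_star : Continuous fun f : L2R => tensor f (star f) := by
  rw [continuous_iff_continuousAt]
  intro g
  rw [ContinuousAt, tendsto_iff_norm_sub_tendsto_zero]
  have hs : ∀ f : L2R, ‖⟪f, f⟫_ℂ‖ = ‖f‖ ^ 2 := fun f => by
    rw [inner_self_eq_norm_sq_to_K]
    simp
  have hn : ∀ f : L2R, ‖tensor f (star f)‖ ^ 2 = ‖f‖ ^ 4 := fun f => by
    rw [← @inner_self_eq_norm_sq ℂ, inner_tensor_star]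
    simp only [RCLike.re_to_complex, Complex.ofReal_re]
    rw [hs]
    ring
  have h : ∀ f : L2R, ‖tensor f (star f) - tensor g (star g)‖ =
      √(‖f‖ ^ 4 - 2 * ‖⟪f, g⟫_ℂ‖ ^ 2 + ‖g‖ ^ 4) := fun f => by
    rw [← Real.sqrt_sq (norm_nonneg (tensor f (star f) - tensor g (star g)))]
    rw [@norm_sub_sq ℂ, hn, hn, inner_tensor_star, RCLike.re_to_complex, Complex.ofReal_re]
  simp only [h]
  have hc : Continuous fun f : L2R => √(‖f‖ ^ 4 - 2 * ‖⟪f, g⟫_ℂ‖ ^ 2 + ‖g‖ ^ 4) := by fun_prop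
  have := hc.tendsto g
  convert this using 2
  rw [hs]
  ring_nf
  simp

open scoped FourierTransform in
theorem exists_submodule_sum_sq_le_of_kernel (T : L2R →L[ℂ] L2R)
    (K : Lp ℂ 2 (volume : Measure (ℝ × ℝ)))
    (hK : ∀ f : L2R, ⟪f, T f⟫_ℂ = ⟪tensor (𝓕 f) (star (𝓕 f)), K⟫_ℂ)
    {ι : Type} (s : Finset ι) (N : ℕ) (hs : s.card ≤ N) (f g : ι → L2R) (D : ℝ)
    (hD : ‖K - ∑ i ∈ s, tensor (f i) (g i)‖ ^ 2 ≤ D) :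
    ∃ V : Submodule ℂ L2R, Module.rank ℂ V ≤ (N : Cardinal) ∧
      ∀ (m : ℕ) (v : Fin m → L2R), Orthonormal ℂ v → (∀ i, v i ∈ Vᗮ) →
        ∑ i, ‖⟪T (v i), v i⟫_ℂ‖ ^ 2 ≤ D := by
  classical
  refine ⟨Submodule.span ℂ (s.image fun i => 𝓕⁻ (f i) : Finset L2R), ?_, ?_⟩
  · refine (rank_span_finset_le _).trans ?_
    exact_mod_cast Finset.card_image_le.trans hs
  · intro m v hv hvV
    set E := K - ∑ i ∈ s, tensor (f i) (g i) with hE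
    have horth : Orthonormal ℂ fun i => tensor (𝓕 (v i)) (star (𝓕 (v i))) := by
      rw [orthonormal_iff_ite] at hv ⊢
      intro i j
      rw [inner_tensor_star, Lp.inner_fourier_eq, hv i j]
      split_ifs <;> simp
    have hq : ∀ i, ‖⟪T (v i), v i⟫_ℂ‖ = ‖⟪tensor (𝓕 (v i)) (star (𝓕 (v i))), E⟫_ℂ‖ := by
      intro i
      rw [norm_inner_symm, hK, hE, inner_sub_right, inner_sum]
      rw [Finset.sum_eq_zero, sub_zero]
      intro j hj
      rw [inner_tensor]
      have h1 : ⟪𝓕⁻ (f j), v i⟫_ℂ = 0 :=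
        (Submodule.mem_orthogonal _ _).1 (hvV i) _
          (Submodule.subset_span (Finset.mem_coe.2 (Finset.mem_image_of_mem _ hj)))
      rw [← Lp.inner_fourier_eq, FourierTransform.fourier_fourierInv_eq, inner_eq_zero_symm] at h1
      rw [h1, zero_mul]
    simp only [hq]
    exact (horth.sum_inner_products_le (x := E)).trans hD

theorem memLp_and_sq_norm_le (G : ℝ × ℝ → ℂ)
    (hG : AEStronglyMeasurable G (volume : Measure (ℝ × ℝ))) (b : ℝ → ℝ) (hb : Integrable b)
    (hb0 : ∀ x, 0 ≤ b x) (h : ∀ᵐ x : ℝ, ∫⁻ y : ℝ, ‖G (x, y)‖ₑ ^ 2 ≤ ENNReal.ofReal (b x)) :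
    MemLp G 2 (volume : Measure (ℝ × ℝ)) ∧
      ∀ F : Lp ℂ 2 (volume : Measure (ℝ × ℝ)), ⇑F =ᵐ[volume] G → ‖F‖ ^ 2 ≤ ∫ x, b x := by
  have h1 : eLpNorm G 2 volume ^ 2 ≤ ENNReal.ofReal (∫ x, b x) := by
    have h2 := eLpNorm_nnreal_pow_eq_lintegral (f := G) (μ := (volume : Measure (ℝ × ℝ)))
      (p := 2) two_ne_zero
    simp only [NNReal.coe_ofNat, ENNReal.coe_ofNat, ENNReal.rpow_ofNat] at h2
    rw [h2, ofReal_integral_eq_lintegral_ofReal hb (Eventually.of_forall hb0)]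
    exact (lintegral_prod_le _).trans (lintegral_mono_ae h)
  refine ⟨⟨hG, ?_⟩, fun F hF => ?_⟩
  · by_contra hcon
    rw [not_lt, top_le_iff] at hcon
    rw [hcon] at h1
    simp at h1
  · rw [Lp.norm_def, eLpNorm_congr_ae hF, ← ENNReal.toReal_pow]
    refine (ENNReal.toReal_mono ENNReal.ofReal_ne_top h1).trans ?_
    rw [ENNReal.toReal_ofReal (integral_nonneg hb0)]

theorem integrable_one_add_abs_inv_sq : Integrable fun x : ℝ => ((1 + |x|) ^ 2)⁻¹ := by
  have h := integrable_one_add_norm (E := ℝ) (μ := volume) (r := 2) (by simp)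
  refine h.congr (Eventually.of_forall fun x => ?_)
  dsimp only
  rw [Real.rpow_neg (by positivity), Real.norm_eq_abs]
  norm_num

/-- An integrable majorant behaving like `|z|^{-1/2}` near zero and like `z⁻²` at infinity. -/
def majorant (z : ℝ) : ℝ :=
  Set.indicator (Metric.ball (0 : ℝ) 2) (fun z => (√|z|)⁻¹) z + 4 * ((1 + |z|) ^ 2)⁻¹

theorem majorant_nonneg (z : ℝ) : 0 ≤ majorant z :=
  add_nonneg (Set.indicator_nonneg (fun _ _ => by positivity) _) (by positivity)

theorem integrable_majorant : Integrable majorant := by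
  refine Integrable.add ?_ (integrable_one_add_abs_inv_sq.const_mul 4)
  rw [integrable_indicator_iff measurableSet_ball]
  refine integrableOn_ball_of_norm_le_rpow (E := ℝ) (C := 1) (α := 1 / 2) (by simp)
    (by norm_num) (Eventually.of_forall fun z => ?_)
    (Measurable.aestronglyMeasurable (by fun_prop))
  rw [Real.rpow_neg (norm_nonneg _), ← Real.sqrt_eq_rpow, one_mul, Real.norm_eq_abs z,
    Real.norm_of_nonneg (by positivity)]

theorem inv_sqrt_le_majorant {z : ℝ} (hz : |z| ≤ 1) : (√|z|)⁻¹ ≤ majorant z := by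
  rw [majorant, Set.indicator_of_mem]
  · have : 0 ≤ 4 * ((1 + |z|) ^ 2)⁻¹ := by positivity
    linarith
  · simp
    linarith

theorem inv_sq_le_majorant {z : ℝ} (hz : 1 ≤ |z|) : (z ^ 2)⁻¹ ≤ majorant z := by
  have h1 : (z ^ 2)⁻¹ ≤ 4 * ((1 + |z|) ^ 2)⁻¹ := by
    rw [← sq_abs, ← div_eq_mul_inv, inv_eq_one_div, div_le_div_iff₀ (by positivity)
      (by positivity)]
    nlinarith
  have h2 : 0 ≤ Set.indicator (Metric.ball (0 : ℝ) 2) (fun z => (√|z|)⁻¹) z :=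
    Set.indicator_nonneg (fun _ _ => by positivity) _
  rw [majorant]
  linarith

/-- The number of cells into which `[m, m + 1)` is divided. -/
def cellCount (n : ℕ) (m : ℤ) : ℕ :=
  ⌈√√(n / (1 + |(m : ℝ)|)) ^ 3⌉₊ + ⌈(n : ℝ) / (1 + |(m : ℝ)|) ^ 2⌉₊

theorem cellCount_pos {n : ℕ} (hn : 1 ≤ n) (m : ℤ) : 1 ≤ cellCount n m := by
  have hn' : (0 : ℝ) < n := by exact_mod_cast hn
  have : 0 < ⌈(n : ℝ) / (1 + |(m : ℝ)|) ^ 2⌉₊ := Nat.ceil_pos.2 (by positivity)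
  unfold cellCount
  omega

theorem inv_cellCount_le {n : ℕ} (hn : 1 ≤ n) (m : ℤ) :
    (cellCount n m : ℝ)⁻¹ ≤ (1 + |(m : ℝ)|) ^ 2 / n := by
  have hn' : (0 : ℝ) < n := by exact_mod_cast hn
  rw [← inv_div]
  refine inv_anti₀ (by positivity) ?_
  unfold cellCount
  push_cast
  have := Nat.le_ceil ((n : ℝ) / (1 + |(m : ℝ)|) ^ 2)
  have h2 : (0 : ℝ) ≤ ⌈√√((n : ℝ) / (1 + |(m : ℝ)|)) ^ 3⌉₊ := Nat.cast_nonneg _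
  linarith

theorem inv_cellCount_sq_le {n : ℕ} (hn : 1 ≤ n) (m : ℤ) :
    (cellCount n m : ℝ)⁻¹ ^ 2 ≤ ((1 + |(m : ℝ)|) / n) * √((1 + |(m : ℝ)|) / n) := by
  have hn' : (0 : ℝ) < n := by exact_mod_cast hn
  set X := (n : ℝ) / (1 + |(m : ℝ)|) with hX
  have hX0 : 0 < X := by positivity
  have h1 : (1 + |(m : ℝ)|) / n = X⁻¹ := by rw [hX, inv_div]
  rw [h1, Real.sqrt_inv, ← mul_inv, inv_pow]
  refine inv_anti₀ (by positivity) ?_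
  have h2 : √√X ^ 3 ≤ (cellCount n m : ℝ) := by
    unfold cellCount
    push_cast
    have := Nat.le_ceil (√√X ^ 3)
    have h2 : (0 : ℝ) ≤ ⌈(n : ℝ) / (1 + |(m : ℝ)|) ^ 2⌉₊ := Nat.cast_nonneg _
    linarith
  calc X * √X = (√√X ^ 3) ^ 2 := by
        rw [← pow_mul, show 3 * 2 = 2 * 3 from rfl, pow_mul, Real.sq_sqrt (Real.sqrt_nonneg _)]
        nth_rw 1 [← Real.sq_sqrt hX0.le]
        ring
    _ ≤ _ := by gcongr

theorem sum_sqrt_sqrt_inv_le (n : ℕ) :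
    ∑ i ∈ Finset.range n, (√√((i : ℝ) + 1))⁻¹ ^ 3 ≤ 4 * √√(n : ℝ) := by
  induction n with
  | zero => simp
  | succ n ih =>
    rw [Finset.sum_range_succ]
    refine (add_le_add_left ih _).trans ?_
    push_cast
    set a := √√(n : ℝ)
    set b := √√((n : ℝ) + 1) with hb
    have hb0 : 0 < b := by positivity
    have ha : a ^ 4 = n := by
      rw [show 4 = 2 * 2 from rfl, pow_mul, Real.sq_sqrt (Real.sqrt_nonneg _),
        Real.sq_sqrt (by positivity)]
    have hb4 : b ^ 4 = n + 1 := by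
      rw [show 4 = 2 * 2 from rfl, pow_mul, Real.sq_sqrt (Real.sqrt_nonneg _),
        Real.sq_sqrt (by positivity)]
    have ha0 : 0 ≤ a := Real.sqrt_nonneg _
    have hab : a ≤ b := Real.sqrt_le_sqrt (Real.sqrt_le_sqrt (by linarith))
    have key : 1 ≤ 4 * (b - a) * b ^ 3 := by
      have h1 : (1 : ℝ) = (b - a) * (b ^ 3 + b ^ 2 * a + b * a ^ 2 + a ^ 3) := by
        linear_combination ha - hb4
      have h2 : b ^ 2 * a ≤ b ^ 3 := by nlinarith [sq_nonneg b]
      have h3 : b * a ^ 2 ≤ b ^ 3 := by nlinarith [mul_nonneg ha0 hb0.le, sq_nonneg b]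
      have h4 : a ^ 3 ≤ b ^ 3 := by gcongr
      rw [h1]
      nlinarith [sub_nonneg.2 hab]
    have : b⁻¹ ^ 3 ≤ 4 * (b - a) := by
      rw [inv_pow, inv_eq_one_div, div_le_iff₀ (by positivity)]
      exact key
    linarith

theorem sum_inv_sq_le_two (n : ℕ) :
    ∑ i ∈ Finset.range n, (((i : ℝ) + 1) ^ 2)⁻¹ ≤ 2 := by
  suffices h : ∑ i ∈ Finset.range n, (((i : ℝ) + 1) ^ 2)⁻¹ ≤ 2 - (n : ℝ)⁻¹ by
    have : 0 ≤ (n : ℝ)⁻¹ := by positivity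
    linarith
  induction n with
  | zero => norm_num
  | succ n ih =>
    rcases Nat.eq_zero_or_pos n with rfl | hn
    · norm_num
    · rw [Finset.sum_range_succ]
      refine (add_le_add_left ih _).trans ?_
      push_cast
      have hn : (0 : ℝ) < n := by exact_mod_cast hn
      have h1 : (n : ℝ)⁻¹ - ((n : ℝ) + 1)⁻¹ = ((n : ℝ) * (n + 1))⁻¹ := by
        field_simp
        ring
      have h2 : (((n : ℝ) + 1) ^ 2)⁻¹ ≤ ((n : ℝ) * (n + 1))⁻¹ :=
        inv_anti₀ (by positivity) (by nlinarith)
      linarith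

theorem sum_Ico_neg_eq_sum_range (f : ℤ → ℕ) (N : ℕ) :
    ∑ m ∈ Finset.Ico (-(N : ℤ)) N, f m = ∑ i ∈ Finset.range N, (f i + f (-((i : ℤ) + 1))) := by
  induction N with
  | zero => simp
  | succ N ih =>
    have h : Finset.Ico (-((N + 1 : ℕ) : ℤ)) ((N + 1 : ℕ) : ℤ) =
        insert (N : ℤ) (insert (-((N : ℤ) + 1)) (Finset.Ico (-(N : ℤ)) N)) := by
      ext m
      simp only [Finset.mem_Ico, Finset.mem_insert]
      omega
    rw [h, Finset.sum_insert (by simp; omega), Finset.sum_insert (by simp), ih,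
      Finset.sum_range_succ]
    ring

theorem sum_cellCount_le (n : ℕ) :
    ∑ m ∈ Finset.Ico (-(n : ℤ)) n, cellCount n m ≤ 16 * n := by
  have hcell : ∀ (i : ℕ) (m : ℤ), (i : ℝ) ≤ |(m : ℝ)| → (cellCount n m : ℝ) ≤
      √√(n : ℝ) ^ 3 * (√√((i : ℝ) + 1))⁻¹ ^ 3 + n * (((i : ℝ) + 1) ^ 2)⁻¹ + 2 := by
    intro i m him
    unfold cellCount
    push_cast
    have h1 : √√((n : ℝ) / (1 + |(m : ℝ)|)) ^ 3 ≤
        √√(n : ℝ) ^ 3 * (√√((i : ℝ) + 1))⁻¹ ^ 3 := by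
      rw [← mul_pow, ← div_eq_mul_inv, ← Real.sqrt_div (Real.sqrt_nonneg _),
        ← Real.sqrt_div (Nat.cast_nonneg _)]
      rw [add_comm (i : ℝ)]
      gcongr
    have h2 : (n : ℝ) / (1 + |(m : ℝ)|) ^ 2 ≤ n * (((i : ℝ) + 1) ^ 2)⁻¹ := by
      rw [← div_eq_mul_inv, add_comm (i : ℝ)]
      gcongr
    have h3 := (Nat.ceil_lt_add_one
      (show 0 ≤ √√((n : ℝ) / (1 + |(m : ℝ)|)) ^ 3 by positivity)).le
    have h4 := (Nat.ceil_lt_add_one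
      (show 0 ≤ (n : ℝ) / (1 + |(m : ℝ)|) ^ 2 by positivity)).le
    linarith
  rw [sum_Ico_neg_eq_sum_range]
  have h : ((∑ i ∈ Finset.range n,
      (cellCount n i + cellCount n (-((i : ℤ) + 1))) : ℕ) : ℝ) ≤ 16 * n := by
    push_cast
    calc ∑ i ∈ Finset.range n, ((cellCount n i : ℝ) + cellCount n (-((i : ℤ) + 1)))
        ≤ ∑ i ∈ Finset.range n, 2 * (√√(n : ℝ) ^ 3 * (√√((i : ℝ) + 1))⁻¹ ^ 3 +
          n * (((i : ℝ) + 1) ^ 2)⁻¹ + 2) := by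
          refine Finset.sum_le_sum fun i _ => ?_
          have h1 := hcell i i (by simp)
          have h2 := hcell i (-((i : ℤ) + 1)) (by
            push_cast
            rw [abs_neg]
            exact (by linarith : (i : ℝ) ≤ i + 1).trans (le_abs_self _))
          linarith
      _ = 2 * (√√(n : ℝ) ^ 3 * ∑ i ∈ Finset.range n, (√√((i : ℝ) + 1))⁻¹ ^ 3 +
          n * ∑ i ∈ Finset.range n, (((i : ℝ) + 1) ^ 2)⁻¹ + 2 * n) := by
          rw [← Finset.mul_sum, Finset.sum_add_distrib, Finset.sum_add_distrib,
            ← Finset.mul_sum, ← Finset.mul_sum]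
          simp [mul_comm]
      _ ≤ 2 * (√√(n : ℝ) ^ 3 * (4 * √√(n : ℝ)) + n * 2 + 2 * n) := by
          gcongr
          · exact sum_sqrt_sqrt_inv_le n
          · exact sum_inv_sq_le_two n
      _ = 16 * n := by
          have : √√(n : ℝ) ^ 4 = n := by
            rw [show 4 = 2 * 2 from rfl, pow_mul, Real.sq_sqrt (Real.sqrt_nonneg _),
              Real.sq_sqrt (by positivity)]
          linear_combination 8 * this
  exact_mod_cast h

theorem lintegral_enorm_sq_le_of_strips (F : ℝ → ℂ) (x r₁ r₂ a b : ℝ) (hr₁ : 0 ≤ r₁)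
    (hr₂ : 0 ≤ r₂) (ha : 0 ≤ a) (hb : 0 ≤ b)
    (h : ∀ y, ‖F y‖ ^ 2 ≤ (if |x + y| ≤ r₁ then a else 0) + (if |x + y| ≤ r₂ then b else 0)) :
    ∫⁻ y : ℝ, ‖F y‖ₑ ^ 2 ≤ ENNReal.ofReal (2 * r₁ * a + 2 * r₂ * b) := by
  have hset : ∀ r, {y : ℝ | |x + y| ≤ r} = Set.Icc (-x - r) (-x + r) := fun r => by
    ext y
    simp only [Set.mem_ofPred_eq, Set.mem_Icc, abs_le]
    constructor <;> rintro ⟨h1, h2⟩ <;> constructor <;> linarith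
  have hvol : ∀ r c : ℝ, 0 ≤ c → ∫⁻ y : ℝ, ENNReal.ofReal (if |x + y| ≤ r then c else 0) =
      ENNReal.ofReal (2 * r * c) := fun r c hc => by
    have : ∀ y : ℝ, ENNReal.ofReal (if |x + y| ≤ r then c else 0) =
        Set.indicator (Set.Icc (-x - r) (-x + r)) (fun _ => ENNReal.ofReal c) y := fun y => by
      rw [← hset, Set.indicator_apply]
      simp only [Set.mem_ofPred_eq]
      split_ifs <;> simp
    simp only [this]
    rw [lintegral_indicator measurableSet_Icc, lintegral_const, Measure.restrict_apply_univ,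
      Real.volume_Icc, ← ENNReal.ofReal_mul hc]
    congr 1
    ring
  have hmeas : Measurable fun y : ℝ => ENNReal.ofReal (if |x + y| ≤ r₁ then a else 0) := by
    refine ENNReal.measurable_ofReal.comp (Measurable.ite ?_ measurable_const measurable_const)
    rw [hset]
    exact measurableSet_Icc
  calc ∫⁻ y : ℝ, ‖F y‖ₑ ^ 2
      ≤ ∫⁻ y : ℝ, (ENNReal.ofReal (if |x + y| ≤ r₁ then a else 0) +
          ENNReal.ofReal (if |x + y| ≤ r₂ then b else 0)) := by
        refine lintegral_mono fun y => ?_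
        rw [← ENNReal.ofReal_add (by split_ifs <;> simp [ha]) (by split_ifs <;> simp [hb]),
          ← ofReal_norm, ← ENNReal.ofReal_pow (norm_nonneg _)]
        exact ENNReal.ofReal_le_ofReal (h y)
    _ = _ := by
        rw [lintegral_add_left hmeas, hvol _ _ ha, hvol _ _ hb,
          ← ENNReal.ofReal_add (by positivity) (by positivity)]

/-- A kernel supported in a strip around the antidiagonal `x + y = 0`, decaying like `|x|⁻¹`,
and Lipschitz in `x` up to a jump of size `|x|⁻²` across the antidiagonal. -/
structure IsJumpKernel (K : ℝ → ℝ → ℂ) (C R : ℝ) : Prop where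
  measurable : Measurable (Function.uncurry K)
  const_nonneg : 0 ≤ C
  radius_nonneg : 0 ≤ R
  eq_zero : ∀ x y, R < |x + y| → K x y = 0
  norm_le : ∀ x y, ‖K x y‖ ≤ C / (1 + |x|)
  norm_sub_le : ∀ x x' y h, h ≤ 1 → |x - x'| ≤ h →
    ‖K x y - K x' y‖ ≤ C * h / (1 + |x|) + (if |x + y| ≤ h then C / (1 + |x|) ^ 2 else 0)

namespace IsJumpKernel

variable {K : ℝ → ℝ → ℂ} {C R : ℝ}

theorem lintegral_le (hK : IsJumpKernel K C R) (x : ℝ) :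
    ∫⁻ y : ℝ, ‖K x y‖ₑ ^ 2 ≤ ENNReal.ofReal (2 * R * (C / (1 + |x|)) ^ 2) := by
  have hR := hK.radius_nonneg
  refine (lintegral_enorm_sq_le_of_strips (K x) x R 0 ((C / (1 + |x|)) ^ 2) 0 hR le_rfl
    (by positivity) le_rfl fun y => ?_).trans (by simp)
  by_cases h : |x + y| ≤ R
  · rw [if_pos h]
    have := pow_le_pow_left₀ (norm_nonneg _) (hK.norm_le x y) 2
    simpa
  · rw [hK.eq_zero x y (not_le.1 h)]
    simp [h]

theorem lintegral_sub_le (hK : IsJumpKernel K C R) (x x' h : ℝ) (hh : h ≤ 1)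
    (hx : |x - x'| ≤ h) :
    ∫⁻ y : ℝ, ‖K x y - K x' y‖ₑ ^ 2 ≤ ENNReal.ofReal
      (2 * (R + 1) * (2 * (C * h / (1 + |x|)) ^ 2) + 2 * h * (2 * (C / (1 + |x|) ^ 2) ^ 2)) := by
  have hR := hK.radius_nonneg
  have hC := hK.const_nonneg
  have h0 : 0 ≤ h := (abs_nonneg _).trans hx
  refine lintegral_enorm_sq_le_of_strips (fun y => K x y - K x' y) x (R + 1) h _ _
    (by positivity) h0 (by positivity) (by positivity) fun y => ?_
  by_cases hxy : |x + y| ≤ R + 1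
  · rw [if_pos hxy]
    have h1 := pow_le_pow_left₀ (norm_nonneg _) (hK.norm_sub_le x x' y h hh hx) 2
    refine h1.trans ?_
    split_ifs
    · nlinarith [sq_nonneg (C * h / (1 + |x|) - C / (1 + |x|) ^ 2)]
    · nlinarith [sq_nonneg (C * h / (1 + |x|))]
  · push Not at hxy
    have h1 : R < |x' + y| := by
      have := abs_sub_abs_le_abs_sub (x + y) (x' + y)
      rw [add_sub_add_right_eq_sub] at this
      linarith
    rw [hK.eq_zero x y (by linarith), hK.eq_zero x' y h1]
    rw [sub_zero, norm_zero, zero_pow two_ne_zero]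
    refine add_nonneg ?_ ?_
    · split_ifs <;> positivity
    · split_ifs <;> positivity

variable {ph : ℝ → ℂ}

theorem aestronglyMeasurable_mul (hK : IsJumpKernel K C R) (hph : Continuous ph) :
    AEStronglyMeasurable (fun z : ℝ × ℝ => ph z.1 * (starRingEnd ℂ (ph z.2) * K z.1 z.2))
      (volume : Measure (ℝ × ℝ)) := by
  have h1 : Measurable fun z : ℝ × ℝ => K z.1 z.2 := hK.measurable
  have h2 : Measurable fun z : ℝ × ℝ => ph z.1 := by fun_prop
  have h3 : Measurable fun z : ℝ × ℝ => starRingEnd ℂ (ph z.2) :=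
    (RCLike.continuous_conj.comp (hph.comp continuous_snd)).measurable
  exact (h2.mul (h3.mul h1)).aestronglyMeasurable

theorem memLp (hK : IsJumpKernel K C R) (hph : Continuous ph) (hph1 : ∀ x, ‖ph x‖ = 1) :
    MemLp (fun z : ℝ × ℝ => ph z.1 * (starRingEnd ℂ (ph z.2) * K z.1 z.2)) 2
      (volume : Measure (ℝ × ℝ)) := by
  have hR := hK.radius_nonneg
  refine (memLp_and_sq_norm_le _ (hK.aestronglyMeasurable_mul hph)
    (fun x => 2 * R * C ^ 2 * ((1 + |x|) ^ 2)⁻¹) (integrable_one_add_abs_inv_sq.const_mul _)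
    (fun x => by positivity) (Eventually.of_forall fun x => ?_)).1
  have h : ∀ y, ‖ph x * (starRingEnd ℂ (ph y) * K x y)‖ₑ = ‖K x y‖ₑ := fun y => by
    rw [← ofReal_norm, ← ofReal_norm]
    simp [hph1]
  simp only [h]
  refine (hK.lintegral_le x).trans (le_of_eq ?_)
  congr 1
  field_simp

/-- The restriction of `ph` to the `j`-th cell of `[m, m + 1)`. -/
def cellFun (ph : ℝ → ℂ) (n : ℕ) (i : Σ _ : ℤ, ℤ) (x : ℝ) : ℂ :=
  if ⌊x⌋ = i.1 ∧ ⌊(cellCount n i.1 : ℝ) * x⌋ = i.2 then ph x else 0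

theorem memLp_cellFun (hph : Continuous ph) (hph1 : ∀ x, ‖ph x‖ = 1) (n : ℕ)
    (i : Σ _ : ℤ, ℤ) : MemLp (cellFun ph n i) 2 (volume : Measure ℝ) := by
  have hm : Measurable (cellFun ph n i) := by
    refine Measurable.ite ?_ hph.measurable measurable_const
    refine MeasurableSet.inter ?_ ?_
    · exact Int.measurable_floor (measurableSet_singleton i.1)
    · exact (Int.measurable_floor.comp (measurable_const.mul measurable_id))
        (measurableSet_singleton i.2)
  refine MemLp.mono' (g := Set.indicator (Set.Icc (i.1 : ℝ) (i.1 + 1)) fun _ => (1 : ℝ))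
    (memLp_indicator_const 2 measurableSet_Icc 1 (Or.inr measure_Icc_lt_top.ne))
    hm.aestronglyMeasurable (Eventually.of_forall fun x => ?_)
  unfold cellFun
  split_ifs with h
  · rw [Set.indicator_of_mem, hph1]
    rw [← h.1]
    exact ⟨Int.floor_le x, (Int.lt_floor_add_one x).le⟩
  · rw [norm_zero]
    exact Set.indicator_nonneg (fun _ _ => zero_le_one) _

theorem memLp_slice (hK : IsJumpKernel K C R) (hph : Continuous ph) (hph1 : ∀ x, ‖ph x‖ = 1)
    (q : ℝ) : MemLp (fun y => starRingEnd ℂ (ph y) * K q y) 2 (volume : Measure ℝ) := by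
  have hm : Measurable fun y => starRingEnd ℂ (ph y) * K q y :=
    (RCLike.continuous_conj.comp hph).measurable.mul
      (hK.measurable.comp (measurable_const.prodMk measurable_id))
  refine MemLp.mono' (g := Set.indicator (Set.Icc (-q - R) (-q + R)) fun _ => C / (1 + |q|))
    (memLp_indicator_const 2 measurableSet_Icc _ (Or.inr measure_Icc_lt_top.ne))
    hm.aestronglyMeasurable (Eventually.of_forall fun y => ?_)
  rw [norm_mul, RCLike.norm_conj, hph1, one_mul]
  by_cases h : |q + y| ≤ R
  · rw [Set.indicator_of_mem]
    · exact hK.norm_le q y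
    · rw [abs_le] at h
      constructor <;> linarith
  · rw [hK.eq_zero q y (not_le.1 h), norm_zero]
    exact Set.indicator_nonneg (fun _ _ => div_nonneg hK.const_nonneg (by positivity)) _

/-- The index set of the cells that subdivide `[-n, n)`. -/
def cells (n : ℕ) : Finset (Σ _ : ℤ, ℤ) :=
  (Finset.Ico (-(n : ℤ)) n).sigma fun m =>
    Finset.Ico (m * cellCount n m) ((m + 1) * cellCount n m)

theorem card_cells_le (n : ℕ) : (cells n).card ≤ 16 * n := by
  refine le_trans (le_of_eq ?_) (sum_cellCount_le n)
  rw [cells, Finset.card_sigma]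
  refine Finset.sum_congr rfl fun m _ => ?_
  rw [Int.card_Ico, add_mul, add_sub_cancel_left, one_mul, Int.toNat_natCast]

theorem sum_cells (ph : ℝ → ℂ) {n : ℕ} (hn : 1 ≤ n) (G : ℝ → ℂ) (x : ℝ) :
    ∑ i ∈ cells n, cellFun ph n i x * G (i.2 / cellCount n i.1) =
      if ⌊x⌋ ∈ Finset.Ico (-(n : ℤ)) n then
        ph x * G (⌊(cellCount n ⌊x⌋ : ℝ) * x⌋ / cellCount n ⌊x⌋) else 0 := by
  split_ifs with hx
  · rw [Finset.sum_eq_single (⟨⌊x⌋, ⌊(cellCount n ⌊x⌋ : ℝ) * x⌋⟩ : Σ _ : ℤ, ℤ)]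
    · simp [cellFun]
    · rintro ⟨m, j⟩ _ hne
      rw [cellFun, if_neg, zero_mul]
      rintro ⟨h1, h2⟩
      dsimp only at h1 h2
      subst h1
      subst h2
      exact hne rfl
    · intro hnot
      refine absurd ?_ hnot
      rw [cells, Finset.mem_sigma]
      refine ⟨hx, ?_⟩
      have hN : (0 : ℝ) < cellCount n ⌊x⌋ := by exact_mod_cast cellCount_pos hn ⌊x⌋
      rw [Finset.mem_Ico]
      constructor
      · rw [Int.le_floor]
        push_cast
        rw [mul_comm]
        exact mul_le_mul_of_nonneg_left (Int.floor_le x) hN.le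
      · rw [Int.floor_lt]
        push_cast
        rw [mul_comm]
        exact mul_lt_mul_of_pos_right (Int.lt_floor_add_one x) hN
  · refine Finset.sum_eq_zero fun i hi => ?_
    rw [cellFun, if_neg, zero_mul]
    rintro ⟨h1, -⟩
    rw [cells, Finset.mem_sigma, ← h1] at hi
    exact hx hi.1

theorem lintegral_error_le (hK : IsJumpKernel K C R) {n : ℕ} (hn : 1 ≤ n) (x : ℝ) (hx : x ≠ 0) :
    ∫⁻ y : ℝ, ‖K x y - (if ⌊x⌋ ∈ Finset.Ico (-(n : ℤ)) n then
        K (⌊(cellCount n ⌊x⌋ : ℝ) * x⌋ / cellCount n ⌊x⌋) y else 0)‖ₑ ^ 2 ≤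
      ENNReal.ofReal (16 * (R + 2) * C ^ 2 *
        (((n : ℝ) ^ 2)⁻¹ * majorant (x / n) + (n : ℝ)⁻¹ * ((1 + |x|) ^ 2)⁻¹)) := by
  have hR := hK.radius_nonneg
  have hn0 : (0 : ℝ) < n := by exact_mod_cast hn
  have hx0 : 0 < |x| := abs_pos.2 hx
  have hmaj := majorant_nonneg (x / n)
  have hM : |x / n| = |x| / n := by rw [abs_div, abs_of_pos hn0]
  split_ifs with hm
  · rw [Finset.mem_Ico] at hm
    set m := ⌊x⌋ with hmx
    set N := cellCount n m with hN
    have hN1 : (1 : ℝ) ≤ N := by exact_mod_cast cellCount_pos hn m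
    have hN0 : (0 : ℝ) < N := by linarith
    have hmle : (m : ℝ) ≤ x := Int.floor_le x
    have hltm : x < m + 1 := Int.lt_floor_add_one x
    have hxn : |x| ≤ n := by
      have h1 : (-(n : ℝ)) ≤ m := by exact_mod_cast hm.1
      have h2 : (m : ℝ) + 1 ≤ n := by exact_mod_cast hm.2
      rw [abs_le]
      constructor <;> linarith
    have habs : 1 + |(m : ℝ)| ≤ 2 * (1 + |x|) := by
      have : |(m : ℝ)| ≤ |x| + 1 := by
        have h1 := abs_sub_abs_le_abs_sub (m : ℝ) x
        have h2 : |(m : ℝ) - x| ≤ 1 := by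
          rw [abs_le]
          constructor <;> linarith
        linarith
      linarith
    have hq : |x - (⌊(N : ℝ) * x⌋ : ℝ) / N| ≤ (N : ℝ)⁻¹ := by
      have h1 := Int.floor_le ((N : ℝ) * x)
      have h2 := Int.lt_floor_add_one ((N : ℝ) * x)
      have h3 : x - (⌊(N : ℝ) * x⌋ : ℝ) / N = (N * x - ⌊(N : ℝ) * x⌋) * (N : ℝ)⁻¹ := by
        field_simp
      rw [h3, abs_mul, abs_of_pos (inv_pos.2 hN0)]
      refine mul_le_of_le_one_left (inv_pos.2 hN0).le ?_
      rw [abs_le]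
      constructor <;> linarith
    refine (hK.lintegral_sub_le x _ _ (inv_le_one_of_one_le₀ hN1) hq).trans
      (ENNReal.ofReal_le_ofReal ?_)
    have hsmooth : ((N : ℝ)⁻¹ / (1 + |x|)) ^ 2 ≤ 4 * (((n : ℝ) ^ 2)⁻¹ * majorant (x / n)) := by
      set Y := 2 * (1 + |x|) / n with hY
      have hY0 : 0 < Y := by positivity
      have hXY : (1 + |(m : ℝ)|) / n ≤ Y := by
        rw [hY]
        gcongr
      have h1 : (N : ℝ)⁻¹ ^ 2 ≤ Y * √Y := (inv_cellCount_sq_le hn m).trans (by gcongr)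
      have h2 : Y * √Y = Y ^ 2 * (√Y)⁻¹ := by
        have h3 : 0 < √Y := by positivity
        rw [← div_eq_mul_inv, eq_div_iff h3.ne', mul_assoc, Real.mul_self_sqrt hY0.le]
        ring
      have h3 : (√Y)⁻¹ ≤ majorant (x / n) := by
        refine le_trans ?_ (inv_sqrt_le_majorant (by rw [hM, div_le_one hn0]; exact hxn))
        refine inv_anti₀ (Real.sqrt_pos.2 (by rw [hM]; positivity)) (Real.sqrt_le_sqrt ?_)
        rw [hM, hY]
        gcongr
        linarith
      rw [h2] at h1
      rw [div_pow, div_le_iff₀ (by positivity)]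
      calc (N : ℝ)⁻¹ ^ 2 ≤ Y ^ 2 * (√Y)⁻¹ := h1
        _ ≤ Y ^ 2 * majorant (x / n) := by gcongr
        _ = _ := by
          rw [hY]
          field_simp
          ring
    have hjump : (N : ℝ)⁻¹ * (1 / (1 + |x|) ^ 2) ^ 2 ≤ 4 * ((n : ℝ)⁻¹ * ((1 + |x|) ^ 2)⁻¹) := by
      have h1 : (N : ℝ)⁻¹ ≤ (2 * (1 + |x|)) ^ 2 / n := (inv_cellCount_le hn m).trans (by gcongr)
      calc (N : ℝ)⁻¹ * (1 / (1 + |x|) ^ 2) ^ 2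
          ≤ (2 * (1 + |x|)) ^ 2 / n * (1 / (1 + |x|) ^ 2) ^ 2 := by gcongr
        _ = _ := by
          field_simp
          ring
    calc 2 * (R + 1) * (2 * (C * (N : ℝ)⁻¹ / (1 + |x|)) ^ 2) +
          2 * (N : ℝ)⁻¹ * (2 * (C / (1 + |x|) ^ 2) ^ 2)
        = 4 * (R + 1) * C ^ 2 * ((N : ℝ)⁻¹ / (1 + |x|)) ^ 2 +
          4 * C ^ 2 * ((N : ℝ)⁻¹ * (1 / (1 + |x|) ^ 2) ^ 2) := by ring
      _ ≤ 4 * (R + 1) * C ^ 2 * (4 * (((n : ℝ) ^ 2)⁻¹ * majorant (x / n))) +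
          4 * C ^ 2 * (4 * ((n : ℝ)⁻¹ * ((1 + |x|) ^ 2)⁻¹)) := by gcongr
      _ ≤ 4 * (R + 2) * C ^ 2 * (4 * (((n : ℝ) ^ 2)⁻¹ * majorant (x / n))) +
          4 * (R + 2) * C ^ 2 * (4 * ((n : ℝ)⁻¹ * ((1 + |x|) ^ 2)⁻¹)) := by
          gcongr
          · norm_num
          · nlinarith
      _ = _ := by ring
  · simp only [sub_zero]
    refine (hK.lintegral_le x).trans (ENNReal.ofReal_le_ofReal ?_)
    have hnx : (n : ℝ) ≤ |x| := by
      by_contra! hlt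
      rw [abs_lt] at hlt
      refine hm (Finset.mem_Ico.2 ⟨?_, ?_⟩)
      · rw [Int.le_floor]
        push_cast
        exact hlt.1.le
      · rw [Int.floor_lt]
        exact_mod_cast hlt.2
    have h1 : (1 / (1 + |x|)) ^ 2 ≤ ((n : ℝ) ^ 2)⁻¹ * majorant (x / n) := by
      have h2 := inv_sq_le_majorant (z := x / n) (by rw [hM, one_le_div hn0]; exact hnx)
      calc (1 / (1 + |x|)) ^ 2 ≤ (|x| ^ 2)⁻¹ := by
            rw [div_pow, one_pow, one_div]
            exact inv_anti₀ (by positivity) (by gcongr; linarith)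
        _ = ((n : ℝ) ^ 2)⁻¹ * ((x / n) ^ 2)⁻¹ := by
            rw [sq_abs]
            field_simp
        _ ≤ _ := by gcongr
    calc 2 * R * (C / (1 + |x|)) ^ 2 = 2 * R * C ^ 2 * (1 / (1 + |x|)) ^ 2 := by ring
      _ ≤ 16 * (R + 2) * C ^ 2 * (((n : ℝ) ^ 2)⁻¹ * majorant (x / n)) := by
          gcongr <;> linarith
      _ ≤ _ := by
          gcongr
          have : 0 ≤ (n : ℝ)⁻¹ * ((1 + |x|) ^ 2)⁻¹ := by positivity
          linarith

theorem exists_finite_rank_approx (hK : IsJumpKernel K C R) (hph : Continuous ph)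
    (hph1 : ∀ x, ‖ph x‖ = 1) : ∃ D : ℝ, 0 ≤ D ∧ ∀ n : ℕ, 1 ≤ n →
      ∃ f g : (Σ _ : ℤ, ℤ) → L2R,
        ‖(hK.memLp hph hph1).toLp - ∑ i ∈ cells n, tensor (f i) (g i)‖ ^ 2 ≤ D / n := by
  have hR := hK.radius_nonneg
  refine ⟨16 * (R + 2) * C ^ 2 * ((∫ z, majorant z) + ∫ x : ℝ, ((1 + |x|) ^ 2)⁻¹),
    mul_nonneg (by positivity) (add_nonneg (integral_nonneg majorant_nonneg)
      (integral_nonneg fun x => by positivity)), fun n hn => ?_⟩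
  have hn0 : (0 : ℝ) < n := by exact_mod_cast hn
  refine ⟨fun i => (memLp_cellFun hph hph1 n i).toLp,
    fun i => (hK.memLp_slice hph hph1 (i.2 / cellCount n i.1)).toLp, ?_⟩
  set F := (hK.memLp hph hph1).toLp - ∑ i ∈ cells n,
    tensor ((memLp_cellFun hph hph1 n i).toLp)
      ((hK.memLp_slice hph hph1 (i.2 / cellCount n i.1)).toLp) with hF
  have htensor : ∀ i : Σ _ : ℤ, ℤ, ⇑(tensor ((memLp_cellFun hph hph1 n i).toLp)
      ((hK.memLp_slice hph hph1 (i.2 / cellCount n i.1)).toLp)) =ᵐ[volume]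
      fun z : ℝ × ℝ => cellFun ph n i z.1 *
        (starRingEnd ℂ (ph z.2) * K (i.2 / cellCount n i.1) z.2) := fun i => by
    refine (coeFn_tensor _ _).trans ?_
    have h1 := (memLp_cellFun hph hph1 n i).coeFn_toLp
    have h2 := (hK.memLp_slice hph hph1 (i.2 / cellCount n i.1)).coeFn_toLp
    filter_upwards [Measure.quasiMeasurePreserving_fst.ae_eq_comp h1,
      Measure.quasiMeasurePreserving_snd.ae_eq_comp h2] with z hz1 hz2
    exact congrArg₂ (· * ·) hz1 hz2
  have hFG : ⇑F =ᵐ[volume] fun z : ℝ × ℝ => ph z.1 * (starRingEnd ℂ (ph z.2) *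
      (K z.1 z.2 - (if ⌊z.1⌋ ∈ Finset.Ico (-(n : ℤ)) n then
        K (⌊(cellCount n ⌊z.1⌋ : ℝ) * z.1⌋ / cellCount n ⌊z.1⌋) z.2 else 0))) := by
    have hsum := Lp.coeFn_fun_finsetSum (E := ℂ) (p := 2) (μ := (volume : Measure (ℝ × ℝ)))
      (cells n) fun i => tensor ((memLp_cellFun hph hph1 n i).toLp)
        ((hK.memLp_slice hph hph1 (i.2 / cellCount n i.1)).toLp)
    have hall := (ae_ball_iff (cells n).countable_toSet).2 fun i _ => htensor i
    filter_upwards [Lp.coeFn_sub (hK.memLp hph hph1).toLp (∑ i ∈ cells n,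
        tensor ((memLp_cellFun hph hph1 n i).toLp)
          ((hK.memLp_slice hph hph1 (i.2 / cellCount n i.1)).toLp)), hsum,
      (hK.memLp hph hph1).coeFn_toLp, hall] with z h1 h2 h3 h4
    rw [hF, h1, Pi.sub_apply, h2, h3, Finset.sum_congr rfl h4]
    rw [sum_cells ph hn (fun q => starRingEnd ℂ (ph z.2) * K q z.2) z.1]
    split_ifs <;> ring
  have hmeas := (Lp.aestronglyMeasurable F).congr hFG
  have hmaj : Integrable fun x : ℝ => majorant (x / n) :=
    integrable_majorant.comp_div hn0.ne'
  refine ((memLp_and_sq_norm_le _ hmeas (fun x => 16 * (R + 2) * C ^ 2 *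
    (((n : ℝ) ^ 2)⁻¹ * majorant (x / n) + (n : ℝ)⁻¹ * ((1 + |x|) ^ 2)⁻¹)) ?_ ?_ ?_).2 F
      hFG).trans ?_
  · exact ((hmaj.const_mul _).add (integrable_one_add_abs_inv_sq.const_mul _)).const_mul _
  · intro x
    have := majorant_nonneg (x / n)
    positivity
  · have hne : ∀ᵐ x : ℝ, x ≠ 0 := Measure.ae_ne volume 0
    filter_upwards [hne] with x hx
    refine le_trans (le_of_eq ?_) (hK.lintegral_error_le hn x hx)
    refine lintegral_congr fun y => ?_
    rw [← ofReal_norm, ← ofReal_norm, norm_mul, norm_mul, hph1, RCLike.norm_conj, hph1, one_mul,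
      one_mul]
  · rw [integral_const_mul, integral_add (hmaj.const_mul _)
      (integrable_one_add_abs_inv_sq.const_mul _), integral_const_mul, integral_const_mul,
      Measure.integral_comp_div majorant (n : ℝ), abs_of_pos hn0, smul_eq_mul]
    refine le_of_eq ?_
    field_simp

end IsJumpKernel

/-- The character `s ↦ e^{-2πis}`. -/
def osc (s : ℝ) : ℂ := Complex.exp (I * ((-(2 * Real.pi * s) : ℝ) : ℂ))

theorem norm_osc (s : ℝ) : ‖osc s‖ = 1 := by
  rw [osc, mul_comm, Complex.norm_exp_ofReal_mul_I]

theorem osc_add (s t : ℝ) : osc (s + t) = osc s * osc t := by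
  rw [osc, osc, osc, ← Complex.exp_add]
  congr 1
  push_cast
  ring

theorem norm_one_sub_osc_le (s : ℝ) : ‖1 - osc s‖ ≤ 2 * Real.pi * |s| := by
  rw [norm_sub_rev]
  refine Real.norm_exp_I_mul_ofReal_sub_one_le.trans_eq ?_
  rw [Real.norm_eq_abs, abs_neg, abs_mul, abs_of_pos Real.two_pi_pos]

theorem hasDerivAt_osc_mul (t r : ℝ) :
    HasDerivAt (fun r : ℝ => osc (r * t)) (osc (r * t) * (-(2 * Real.pi * t * I))) r := by
  have h1 : HasDerivAt (fun r : ℝ => -(2 * Real.pi * (r * t))) (-(2 * Real.pi * (1 * t))) r :=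
    (((hasDerivAt_id r).mul_const t).const_mul (2 * Real.pi)).neg
  have h2 := ((h1.ofReal_comp).const_mul I).cexp
  refine h2.congr_deriv ?_
  rw [osc]
  push_cast
  ring

@[fun_prop]
theorem continuous_osc : Continuous osc := by
  unfold osc
  fun_prop

section Oscillatory

variable {f f' : ℝ → ℂ} {a b : ℝ}

theorem two_pi_mul_integral_osc (hf : ∀ r, HasDerivAt f (f' r) r) (hf' : Continuous f')
    (a b t : ℝ) :
    (2 * Real.pi * t * I : ℂ) * ∫ r in a..b, f r * osc (r * t) =
      f a * osc (a * t) - f b * osc (b * t) + ∫ r in a..b, f' r * osc (r * t) := by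
  have hfc : Continuous f := continuous_iff_continuousAt.2 fun r => (hf r).continuousAt
  have h := intervalIntegral.integral_eq_sub_of_hasDerivAt (a := a) (b := b)
    (f := fun r => f r * osc (r * t))
    (f' := fun r => f' r * osc (r * t) + f r * (osc (r * t) * (-(2 * Real.pi * t * I))))
    (fun r _ => (hf r).mul (hasDerivAt_osc_mul t r))
    (Continuous.intervalIntegrable (by fun_prop) _ _)
  rw [intervalIntegral.integral_add (Continuous.intervalIntegrable (by fun_prop) _ _)
    (Continuous.intervalIntegrable (by fun_prop) _ _)] at h
  have h2 : ∫ r in a..b, f r * (osc (r * t) * (-(2 * Real.pi * t * I))) =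
      -((2 * Real.pi * t * I : ℂ) * ∫ r in a..b, f r * osc (r * t)) := by
    rw [← intervalIntegral.integral_const_mul, ← intervalIntegral.integral_neg]
    exact intervalIntegral.integral_congr fun r _ => by ring
  rw [h2] at h
  linear_combination -h

theorem norm_two_pi_mul (t : ℝ) (z : ℂ) :
    |t| * ‖z‖ ≤ ‖(2 * Real.pi * t * I : ℂ) * z‖ := by
  have : ‖(2 * Real.pi * t * I : ℂ)‖ = 2 * Real.pi * |t| := by
    simp [abs_of_pos Real.pi_pos]
  rw [norm_mul, this]
  have := Real.two_le_pi
  gcongr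
  nlinarith [abs_nonneg t]

theorem norm_integral_osc_le_length (hab : a ≤ b) {M : ℝ}
    (hM : ∀ r ∈ Set.Icc a b, ‖f r‖ ≤ M) (t : ℝ) :
    ‖∫ r in a..b, f r * osc (r * t)‖ ≤ M * (b - a) := by
  have h := intervalIntegral.norm_integral_le_of_norm_le_const (a := a) (b := b) (C := M)
    (f := fun r => f r * osc (r * t)) fun r hr => by
      rw [Set.uIoc_of_le hab] at hr
      rw [norm_mul, norm_osc, mul_one]
      exact hM r ⟨hr.1.le, hr.2⟩
  rwa [abs_of_nonneg (sub_nonneg.2 hab)] at h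

theorem norm_integral_osc_le (hf : ∀ r, HasDerivAt f (f' r) r) (hf' : Continuous f')
    (hab : a ≤ b) {M : ℝ} (hM : ∀ r ∈ Set.Icc a b, ‖f r‖ ≤ M)
    (hM' : ∀ r ∈ Set.Icc a b, ‖f' r‖ ≤ M) (t : ℝ) :
    ‖∫ r in a..b, f r * osc (r * t)‖ ≤ M * (2 + 2 * (b - a)) / (1 + |t|) := by
  have h1 := norm_integral_osc_le_length hab hM t
  have h2 := norm_integral_osc_le_length hab hM' t
  have h3 := norm_two_pi_mul t (∫ r in a..b, f r * osc (r * t))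
  rw [two_pi_mul_integral_osc hf hf'] at h3
  have h4 := (h3.trans (norm_add_le _ _)).trans (add_le_add_left (norm_sub_le _ _) _)
  rw [norm_mul, norm_mul, norm_osc, norm_osc] at h4
  have ha := hM a ⟨le_rfl, hab⟩
  have hb := hM b ⟨hab, le_rfl⟩
  rw [le_div_iff₀ (by positivity)]
  nlinarith

theorem norm_integral_osc_le_sq {f'' : ℝ → ℂ} (hf : ∀ r, HasDerivAt f (f' r) r)
    (hf' : ∀ r, HasDerivAt f' (f'' r) r) (hf'' : Continuous f'')
    (hab : a ≤ b) {M : ℝ} (hM : ∀ r ∈ Set.Icc a b, ‖f r‖ ≤ M)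
    (hM' : ∀ r ∈ Set.Icc a b, ‖f' r‖ ≤ M) (hM'' : ∀ r ∈ Set.Icc a b, ‖f'' r‖ ≤ M)
    (ha : f a = 0) (hb : f b = 0) (t : ℝ) :
    ‖∫ r in a..b, f r * osc (r * t)‖ ≤ 2 * (M * (2 + 2 * (b - a))) / (1 + |t|) ^ 2 := by
  have hc' : Continuous f' := continuous_iff_continuousAt.2 fun r => (hf' r).continuousAt
  have h1 := norm_integral_osc_le hf hc' hab hM hM' t
  have h2 := norm_integral_osc_le hf' hf'' hab hM' hM'' t
  have h3 := norm_two_pi_mul t (∫ r in a..b, f r * osc (r * t))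
  rw [two_pi_mul_integral_osc hf hc', ha, hb, zero_mul, zero_mul, sub_zero, zero_add] at h3
  have h4 := add_le_add h1 (h3.trans h2)
  have h0 : 0 < 1 + |t| := by positivity
  rw [pow_two, ← div_div, le_div_iff₀ h0]
  calc _ = ‖∫ r in a..b, f r * osc (r * t)‖ + |t| * ‖∫ r in a..b, f r * osc (r * t)‖ := by ring
    _ ≤ _ := h4
    _ = _ := by ring

end Oscillatory

/-- The partial Fourier integral `∫_a^b g(r, ξ) e^{-2πirt} dr`. -/
def oscInt (g : ℝ × ℝ → ℂ) (a b ξ t : ℝ) : ℂ := ∫ r in a..b, g (r, ξ) * osc (r * t)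

theorem continuous_oscInt {g : ℝ × ℝ → ℂ} (hg : Continuous g) (a b : ℝ) :
    Continuous fun z : ℝ × ℝ => oscInt g a b z.1 z.2 := by
  unfold oscInt
  refine intervalIntegral.continuous_parametric_intervalIntegral_of_continuous' ?_ a b
  unfold Function.uncurry
  fun_prop

section SmoothSymbol

variable {g : ℝ × ℝ → ℂ}

theorem exists_bound_and_lipschitz (hg : ContDiff ℝ (⊤ : ℕ∞) g) (hs : HasCompactSupport g) :
    ∃ L : ℝ, 0 ≤ L ∧ (∀ p, ‖g p‖ ≤ L) ∧ ∀ r ξ ξ', ‖g (r, ξ) - g (r, ξ')‖ ≤ L * |ξ - ξ'| := by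
  obtain ⟨B, hB⟩ := hs.exists_bound_of_continuous hg.continuous
  obtain ⟨L, hL⟩ := hg.lipschitzWith_of_hasCompactSupport hs (by simp)
  refine ⟨max B L, le_max_of_le_right L.2, fun p => (hB p).trans (le_max_left _ _),
    fun r ξ ξ' => ?_⟩
  have := hL.norm_sub_le (r, ξ) (r, ξ')
  refine this.trans ?_
  rw [Prod.mk_sub_mk, sub_self, Prod.norm_mk, norm_zero, max_eq_right (norm_nonneg _),
    Real.norm_eq_abs]
  gcongr
  exact le_max_right _ _

/-- The derivative of `g` in its first variable. -/
def dfst (g : ℝ × ℝ → ℂ) (p : ℝ × ℝ) : ℂ := fderiv ℝ g p (1, 0)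

theorem contDiff_dfst (hg : ContDiff ℝ (⊤ : ℕ∞) g) : ContDiff ℝ (⊤ : ℕ∞) (dfst g) :=
  (hg.fderiv_right (by simp)).clm_apply contDiff_const

theorem hasCompactSupport_dfst (hs : HasCompactSupport g) : HasCompactSupport (dfst g) :=
  hs.fderiv_apply (𝕜 := ℝ) (1, 0)

theorem hasDerivAt_fst (hg : ContDiff ℝ (⊤ : ℕ∞) g) (ξ r : ℝ) :
    HasDerivAt (fun r => g (r, ξ)) (dfst g (r, ξ)) r :=
  ((hg.differentiable (by simp)) (r, ξ)).hasFDerivAt.comp_hasDerivAt r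
    ((hasDerivAt_id r).prodMk (hasDerivAt_const r ξ))

theorem exists_oscInt_bounds (hg : ContDiff ℝ (⊤ : ℕ∞) g) (hs : HasCompactSupport g)
    {a b : ℝ} (hab : a ≤ b) :
    ∃ C : ℝ, 0 ≤ C ∧ (∀ ξ t, ‖oscInt g a b ξ t‖ ≤ C / (1 + |t|)) ∧
      ∀ ξ ξ' t t', ‖oscInt g a b ξ t - oscInt g a b ξ' t'‖ ≤
        C * (|ξ - ξ'| + |t - t'|) / (1 + |t|) := by
  obtain ⟨L₀, hL₀, hb₀, hl₀⟩ := exists_bound_and_lipschitz hg hs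
  obtain ⟨L₁, hL₁, hb₁, hl₁⟩ :=
    exists_bound_and_lipschitz (contDiff_dfst hg) (hasCompactSupport_dfst hs)
  set L := max L₀ L₁
  have hL : 0 ≤ L := le_max_of_le_left hL₀
  have h0 : L₀ ≤ L := le_max_left _ _
  have h1 : L₁ ≤ L := le_max_right _ _
  set ρ := max |a| |b|
  have hρ : 0 ≤ ρ := le_max_of_le_left (abs_nonneg _)
  have hg1 := (contDiff_dfst hg).continuous
  have hg0 := hg.continuous
  have hπ := Real.pi_pos
  have hl : 0 ≤ b - a := sub_nonneg.2 hab
  set E := 2 + 2 * (b - a)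
  have hE : 0 ≤ E := by positivity
  have hC1 : 0 ≤ L * E * (2 * Real.pi * (ρ + 1)) := by positivity
  refine ⟨L * E + L * E * (2 * Real.pi * (ρ + 1)), by positivity, fun ξ t => ?_,
    fun ξ ξ' t t' => ?_⟩
  · refine (norm_integral_osc_le (hasDerivAt_fst hg ξ) (by fun_prop) hab
      (fun r _ => (hb₀ _).trans h0) (fun r _ => (hb₁ _).trans h1) t).trans ?_
    gcongr
    linarith
  · have hd : oscInt g a b ξ t - oscInt g a b ξ' t' =
        (∫ r in a..b, (g (r, ξ) - g (r, ξ')) * osc (r * t)) +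
          ∫ r in a..b, (g (r, ξ') * (1 - osc (r * (t' - t)))) * osc (r * t) := by
      rw [oscInt, oscInt, ← intervalIntegral.integral_sub, ← intervalIntegral.integral_add]
      · congr 1
        ext r
        have : osc (r * t') = osc (r * (t' - t)) * osc (r * t) := by
          rw [← osc_add]
          congr 1
          ring
        rw [this]
        ring
      all_goals exact Continuous.intervalIntegrable (by fun_prop) _ _
    have e1 := norm_integral_osc_le (f := fun r => g (r, ξ) - g (r, ξ'))
      (fun r => (hasDerivAt_fst hg ξ r).sub (hasDerivAt_fst hg ξ' r)) (by fun_prop) hab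
      (M := L * |ξ - ξ'|)
      (fun r _ => (hl₀ r ξ ξ').trans (by gcongr)) (fun r _ => (hl₁ r ξ ξ').trans (by gcongr)) t
    have hr : ∀ r ∈ Set.Icc a b, ‖1 - osc (r * (t' - t))‖ ≤ 2 * Real.pi * (ρ * |t - t'|) := by
      intro r hr
      refine (norm_one_sub_osc_le _).trans ?_
      rw [abs_mul, abs_sub_comm t' t]
      gcongr
      exact abs_le_max_abs_abs hr.1 hr.2
    have e2 := norm_integral_osc_le (f := fun r => g (r, ξ') * (1 - osc (r * (t' - t))))
      (fun r => (hasDerivAt_fst hg ξ' r).mul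
        ((hasDerivAt_const r (1 : ℂ)).sub (hasDerivAt_osc_mul (t' - t) r))) (by fun_prop) hab
      (M := L * (2 * Real.pi * (ρ + 1)) * |t - t'|)
      (fun r h => by
        rw [norm_mul]
        have := mul_le_mul ((hb₀ (r, ξ')).trans h0) (hr r h) (norm_nonneg _) hL
        refine this.trans ?_
        have : 0 ≤ L * (2 * Real.pi) * |t - t'| := by positivity
        linarith)
      (fun r h => by
        refine (norm_add_le _ _).trans ?_
        rw [norm_mul, norm_mul]
        have k1 := mul_le_mul ((hb₁ (r, ξ')).trans h1) (hr r h) (norm_nonneg _) hL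
        have k2 : ‖(0 : ℂ) - osc (r * (t' - t)) * (-(2 * Real.pi * (t' - t : ℝ) * I))‖ =
            2 * Real.pi * |t - t'| := by
          rw [zero_sub, norm_neg, norm_mul, norm_osc, norm_neg, norm_mul, norm_mul, norm_mul,
            norm_I, Complex.norm_real, Complex.norm_real, Real.norm_eq_abs, Real.norm_eq_abs,
            abs_of_pos hπ, abs_sub_comm t' t]
          simp
        rw [k2]
        have k3 := mul_le_mul_of_nonneg_right ((hb₀ (r, ξ')).trans h0)
          (by positivity : 0 ≤ 2 * Real.pi * |t - t'|)
        linarith) t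
    rw [hd]
    refine (norm_add_le _ _).trans ((add_le_add e1 e2).trans ?_)
    rw [← add_div]
    gcongr
    have p1 : 0 ≤ L * E * |t - t'| := by positivity
    have p2 : 0 ≤ L * E * (2 * Real.pi * (ρ + 1)) * |ξ - ξ'| := by positivity
    linarith

theorem exists_oscInt_bound_sq (hg : ContDiff ℝ (⊤ : ℕ∞) g) (hs : HasCompactSupport g)
    {a b : ℝ} (hab : a ≤ b) (ξ : ℝ) (ha : g (a, ξ) = 0) (hb : g (b, ξ) = 0) :
    ∃ C : ℝ, 0 ≤ C ∧ ∀ t, ‖oscInt g a b ξ t‖ ≤ C / (1 + |t|) ^ 2 := by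
  have hg1 := contDiff_dfst hg
  have hs1 := hasCompactSupport_dfst hs
  have hg2 := contDiff_dfst hg1
  obtain ⟨L₀, hL₀, hb₀, -⟩ := exists_bound_and_lipschitz hg hs
  obtain ⟨L₁, hL₁, hb₁, -⟩ := exists_bound_and_lipschitz hg1 hs1
  obtain ⟨L₂, hL₂, hb₂, -⟩ := exists_bound_and_lipschitz hg2 (hasCompactSupport_dfst hs1)
  have hl : 0 ≤ b - a := sub_nonneg.2 hab
  have hc := hg2.continuous
  refine ⟨_, ?_, fun t => norm_integral_osc_le_sq (M := L₀ + L₁ + L₂)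
    (hasDerivAt_fst hg ξ) (hasDerivAt_fst hg1 ξ) (by fun_prop) hab
    (fun r _ => (hb₀ _).trans (by linarith)) (fun r _ => (hb₁ _).trans (by linarith))
    (fun r _ => (hb₂ _).trans (by linarith)) ha hb t⟩
  positivity

/-- The kernel assembled from half-line Fourier integrals of `g`. -/
def jumpKernel (g : ℝ × ℝ → ℂ) (c : ℂ) (R x y : ℝ) : ℂ :=
  c * oscInt g (-R) 0 (Real.pi * (x + y)) (x - y) +
    if 0 < x + y then oscInt g 0 R (Real.pi * (x + y)) (x - y) else 0

theorem exists_isJumpKernel (hg : ContDiff ℝ (⊤ : ℕ∞) g) (hs : HasCompactSupport g)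
    (h00 : g (0, 0) = 0) {c : ℂ} (hc : ‖c‖ ≤ 1) {R : ℝ} (hR : 0 ≤ R)
    (hgr : g (R, 0) = 0) (hgξ : ∀ r ξ, R < |ξ| → g (r, ξ) = 0) :
    ∃ C, IsJumpKernel (jumpKernel g c R) C R := by
  obtain ⟨C₁, hC₁, hm, hml⟩ := exists_oscInt_bounds hg hs (neg_nonpos.2 hR)
  obtain ⟨C₂, hC₂, hp, hpl⟩ := exists_oscInt_bounds hg hs hR
  obtain ⟨C₃, hC₃, hp0⟩ := exists_oscInt_bound_sq hg hs hR 0 h00 hgr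
  have hπ := Real.pi_pos
  have hzero : ∀ x y, R < |x + y| → jumpKernel g c R x y = 0 := by
    intro x y hxy
    have : R < |Real.pi * (x + y)| := by
      rw [abs_mul, abs_of_pos hπ]
      nlinarith [Real.two_le_pi, abs_nonneg (x + y)]
    simp [jumpKernel, oscInt, hgξ _ _ this]
  have hdec : ∀ x y, |x + y| ≤ R + 1 → (1 + |x - y|)⁻¹ ≤ (2 + R) * (1 + |x|)⁻¹ := by
    intro x y hxy
    have h1 : 2 * |x| ≤ |x - y| + |x + y| := by
      have := abs_add_le (x - y) (x + y)
      rw [show x - y + (x + y) = 2 * x by ring, abs_mul, abs_two] at this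
      exact this
    rw [← div_eq_mul_inv, le_div_iff₀ (by positivity), inv_mul_le_iff₀ (by positivity)]
    nlinarith [abs_nonneg (x - y), abs_nonneg x]
  set C := (C₁ + C₂) * (Real.pi + 1) * (2 + R) + C₃ * (2 + R) ^ 2
  have hC : 0 ≤ C := by positivity
  have hCle : (C₁ + C₂) * (Real.pi + 1) * (2 + R) ≤ C := by
    have : 0 ≤ C₃ * (2 + R) ^ 2 := by positivity
    linarith
  refine ⟨C, ?_, hC, hR, hzero, fun x y => ?_, fun x x' y h hh hx => ?_⟩
  · have h1 := (continuous_oscInt hg.continuous (-R) 0).comp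
      (by fun_prop : Continuous fun z : ℝ × ℝ => (Real.pi * (z.1 + z.2), z.1 - z.2))
    have h2 := (continuous_oscInt hg.continuous 0 R).comp
      (by fun_prop : Continuous fun z : ℝ × ℝ => (Real.pi * (z.1 + z.2), z.1 - z.2))
    refine (measurable_const.mul h1.measurable).add (Measurable.ite ?_ h2.measurable
      measurable_const)
    exact measurableSet_lt measurable_const (by fun_prop)
  · by_cases hxy : |x + y| ≤ R
    · have h1 : ‖jumpKernel g c R x y‖ ≤ (C₁ + C₂) * (1 + |x - y|)⁻¹ := by
        refine (norm_add_le _ _).trans ?_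
        rw [norm_mul, add_mul, ← div_eq_mul_inv, ← div_eq_mul_inv]
        refine add_le_add ?_ ?_
        · exact (mul_le_of_le_one_left (norm_nonneg _) hc).trans (hm _ _)
        · split_ifs
          · exact hp _ _
          · rw [norm_zero]
            positivity
      refine h1.trans ((mul_le_mul_of_nonneg_left (hdec x y (by linarith))
        (by positivity)).trans ?_)
      rw [← mul_assoc, ← div_eq_mul_inv]
      gcongr
      refine le_trans ?_ hCle
      have : 0 ≤ (C₁ + C₂) * (2 + R) * Real.pi := by positivity
      linarith
    · rw [hzero x y (not_le.1 hxy), norm_zero]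
      positivity
  · have h0 : 0 ≤ h := (abs_nonneg _).trans hx
    have hξ : |Real.pi * (x + y) - Real.pi * (x' + y)| ≤ Real.pi * h := by
      rw [← mul_sub, add_sub_add_right_eq_sub, abs_mul, abs_of_pos hπ]
      gcongr
    have ht : |x - y - (x' - y)| ≤ h := by rwa [sub_sub_sub_cancel_right]
    by_cases hxy : |x + y| ≤ R + 1
    swap
    · push Not at hxy
      have h1 : R < |x' + y| := by
        have := abs_sub_abs_le_abs_sub (x + y) (x' + y)
        rw [add_sub_add_right_eq_sub] at this
        linarith
      rw [hzero x y (by linarith), hzero x' y h1, sub_zero, norm_zero]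
      refine add_nonneg (by positivity) ?_
      split_ifs <;> positivity
    have hlip : ∀ {C' : ℝ} {H : ℝ → ℝ → ℂ}, 0 ≤ C' →
        (∀ ξ ξ' t t', ‖H ξ t - H ξ' t'‖ ≤ C' * (|ξ - ξ'| + |t - t'|) / (1 + |t|)) →
        ∀ ξ ξ' t', |ξ - ξ'| ≤ Real.pi * h → |x - y - t'| ≤ h →
        ‖H ξ (x - y) - H ξ' t'‖ ≤ C' * (Real.pi + 1) * h * (1 + |x - y|)⁻¹ := by
      intro C' H hC' hH ξ ξ' t' h1 h2
      refine (hH _ _ _ _).trans ?_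
      rw [div_eq_mul_inv]
      refine mul_le_mul_of_nonneg_right ?_ (by positivity)
      rw [mul_assoc]
      exact mul_le_mul_of_nonneg_left (by linarith) hC'
    have hminus : ‖c * oscInt g (-R) 0 (Real.pi * (x + y)) (x - y) -
        c * oscInt g (-R) 0 (Real.pi * (x' + y)) (x' - y)‖ ≤
        C₁ * (Real.pi + 1) * h * (1 + |x - y|)⁻¹ := by
      rw [← mul_sub, norm_mul]
      exact (mul_le_of_le_one_left (norm_nonneg _) hc).trans (hlip hC₁ hml _ _ _ hξ ht)
    have hq : 0 ≤ C₂ * (Real.pi + 1) * h * (1 + |x - y|)⁻¹ := by positivity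
    have hsq : C₃ / (1 + |x - y|) ^ 2 ≤ C / (1 + |x|) ^ 2 := by
      have h1 := pow_le_pow_left₀ (by positivity) (hdec x y hxy) 2
      rw [mul_pow] at h1
      rw [div_eq_mul_inv, div_eq_mul_inv, ← inv_pow, ← inv_pow]
      refine (mul_le_mul_of_nonneg_left h1 hC₃).trans ?_
      rw [← mul_assoc]
      gcongr
      have : 0 ≤ (C₁ + C₂) * (Real.pi + 1) * (2 + R) := by positivity
      linarith
    have hplus : ‖(if 0 < x + y then oscInt g 0 R (Real.pi * (x + y)) (x - y) else 0) -
        (if 0 < x' + y then oscInt g 0 R (Real.pi * (x' + y)) (x' - y) else 0)‖ ≤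
        C₂ * (Real.pi + 1) * h * (1 + |x - y|)⁻¹ +
          (if |x + y| ≤ h then C / (1 + |x|) ^ 2 else 0) := by
      have hnn : (0 : ℝ) ≤ if |x + y| ≤ h then C / (1 + |x|) ^ 2 else 0 := by
        split_ifs <;> positivity
      have hx' := abs_le.1 hx
      by_cases s : 0 < x + y <;> by_cases s' : 0 < x' + y
      · rw [if_pos s, if_pos s']
        linarith [hlip hC₂ hpl _ _ _ hξ ht]
      · have hS : |x + y| ≤ h := by
          rw [abs_le]
          constructor <;> linarith
        rw [if_pos s, if_neg s', sub_zero, if_pos hS]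
        have h1 := hlip hC₂ hpl (Real.pi * (x + y)) 0 (x - y)
          (by rw [sub_zero, abs_mul, abs_of_pos hπ]; gcongr) (by simpa using h0)
        have h2 := norm_le_norm_sub_add (oscInt g 0 R (Real.pi * (x + y)) (x - y))
          (oscInt g 0 R 0 (x - y))
        linarith [hp0 (x - y)]
      · have hS : |x + y| ≤ h := by
          rw [abs_le]
          constructor <;> linarith
        have hS' : |x' + y| ≤ h := by
          rw [abs_le]
          constructor <;> linarith
        rw [if_neg s, if_pos s', zero_sub, norm_neg, if_pos hS]
        have h1 := hlip hC₂ hpl 0 (Real.pi * (x' + y)) (x' - y)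
          (by rw [zero_sub, abs_neg, abs_mul, abs_of_pos hπ]; gcongr) ht
        rw [norm_sub_rev] at h1
        have h2 := norm_le_norm_sub_add (oscInt g 0 R (Real.pi * (x' + y)) (x' - y))
          (oscInt g 0 R 0 (x - y))
        linarith [hp0 (x - y)]
      · rw [if_neg s, if_neg s', sub_zero, norm_zero]
        linarith
    have key : (C₁ + C₂) * (Real.pi + 1) * h * (1 + |x - y|)⁻¹ ≤ C * h / (1 + |x|) := by
      refine (mul_le_mul_of_nonneg_left (hdec x y hxy) (by positivity)).trans ?_
      rw [← mul_assoc, ← div_eq_mul_inv, mul_right_comm]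
      exact div_le_div_of_nonneg_right (mul_le_mul_of_nonneg_right hCle h0) (by positivity)
    rw [jumpKernel, jumpKernel, add_sub_add_comm]
    refine (norm_add_le _ _).trans ((add_le_add hminus hplus).trans ?_)
    linarith

end SmoothSymbol

theorem conj_osc (s : ℝ) : starRingEnd ℂ (osc s) = osc (-s) := by
  rw [osc, osc, ← Complex.exp_conj, map_mul, conj_I, Complex.conj_ofReal]
  congr 1
  push_cast
  ring

section WeylForm

open scoped SchwartzMap FourierTransform

theorem fourier_apply_eq_integral_osc (u : 𝓢(ℝ, ℂ)) (w : ℝ) :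
    𝓕 u w = ∫ x, osc (x * w) * u x := by
  rw [SchwartzMap.fourier_coe, Real.fourier_real_eq_integral_exp_smul]
  refine integral_congr_ae (Eventually.of_forall fun x => ?_)
  dsimp only
  rw [osc, smul_eq_mul, mul_comm I]
  congr 4
  ring

theorem apply_eq_integral_osc_fourier (u : 𝓢(ℝ, ℂ)) (y : ℝ) :
    u y = ∫ η, osc (-(y * η)) * 𝓕 u η := by
  have h : 𝓕⁻ (𝓕 u) = u := by simp
  conv_lhs => rw [← h]
  rw [SchwartzMap.fourierInv_coe, Real.fourierInv_eq']
  refine integral_congr_ae (Eventually.of_forall fun x => ?_)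
  dsimp only
  rw [osc, smul_eq_mul, mul_comm I]
  congr 4
  simp only [RCLike.inner_apply, conj_trivial]
  ring

theorem exists_norm_le (u : 𝓢(ℝ, ℂ)) : ∃ M, ∀ x, ‖u x‖ ≤ M := by
  obtain ⟨C, -, hC⟩ := u.decay 0 0
  exact ⟨C, fun x => by simpa using hC x⟩

theorem weylIntegral_eq (a : ℝ × ℝ → ℂ) (u : ℝ → ℂ) (x : ℝ) :
    weylIntegral a u x =
      ∫ s : ℝ, ∫ p : ℝ, osc ((p - x) * s) * a (p, Real.pi * s) * u (2 * p - x) := by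
  have h1 : ∀ ξ : ℝ, ∫ y : ℝ, Complex.exp (I * ((x - y) * ξ : ℝ)) * a ((x + y) / 2, ξ) * u y =
      2 * ∫ p : ℝ, Complex.exp (I * ((x - (2 * p - x)) * ξ : ℝ)) * a (p, ξ) * u (2 * p - x) := by
    intro ξ
    have h2 := Measure.integral_comp_mul_left (fun y : ℝ =>
      Complex.exp (I * ((x - (y - x)) * ξ : ℝ)) * a ((x + (y - x)) / 2, ξ) * u (y - x)) 2
    rw [integral_sub_right_eq_self (fun y : ℝ =>
      Complex.exp (I * ((x - y) * ξ : ℝ)) * a ((x + y) / 2, ξ) * u y) x] at h2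
    have h3 : ∀ p : ℝ, (x + (2 * p - x)) / 2 = p := fun p => by ring
    simp only [h3] at h2
    rw [h2, abs_of_pos (by positivity), Complex.real_smul]
    push_cast
    ring
  have h2 := Measure.integral_comp_mul_left (fun ξ : ℝ =>
    ∫ p : ℝ, Complex.exp (I * ((x - (2 * p - x)) * ξ : ℝ)) * a (p, ξ) * u (2 * p - x)) Real.pi
  have hπ := Real.pi_pos
  rw [abs_of_pos (by positivity), Complex.real_smul] at h2
  have h3 : ∫ s : ℝ, ∫ p : ℝ, osc ((p - x) * s) * a (p, Real.pi * s) * u (2 * p - x) =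
      ∫ s : ℝ, ∫ p : ℝ, Complex.exp (I * ((x - (2 * p - x)) * (Real.pi * s) : ℝ)) *
        a (p, Real.pi * s) * u (2 * p - x) := by
    congr 1
    funext s
    congr 1
    funext p
    rw [osc]
    congr 5
    ring
  rw [h3, h2, weylIntegral]
  simp only [h1]
  rw [integral_const_mul, ← mul_assoc]
  congr 1
  push_cast
  field_simp

variable {B : ℝ × ℝ → ℂ}

theorem integral_conj_mul_weyl (hB : Integrable B) (u : 𝓢(ℝ, ℂ)) :
    ∫ x : ℝ, (∫ s : ℝ, ∫ p : ℝ, osc ((p - x) * s) * B (s, p) * u (2 * p - x)) *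
        starRingEnd ℂ (u x) =
      ∫ z : ℝ × ℝ, B z *
        ∫ x : ℝ, osc ((z.2 - x) * z.1) * u (2 * z.2 - x) * starRingEnd ℂ (u x) := by
  obtain ⟨M, hM⟩ := exists_norm_le u
  have hu := u.continuous
  have hc : Continuous fun x => starRingEnd ℂ (u x) := RCLike.continuous_conj.comp hu
  have hui : Integrable fun x => starRingEnd ℂ (u x) := by
    rw [← integrable_norm_iff hc.aestronglyMeasurable]
    simpa using u.integrable.norm
  have hbd : ∀ x : ℝ, ∀ z : ℝ × ℝ, ‖osc ((z.2 - x) * z.1) * u (2 * z.2 - x)‖ ≤ M := by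
    intro x z
    rw [norm_mul, norm_osc, one_mul]
    exact hM _
  have hInt : Integrable (Function.uncurry fun (x : ℝ) (z : ℝ × ℝ) =>
      (starRingEnd ℂ (u x) * B z) * (osc ((z.2 - x) * z.1) * u (2 * z.2 - x)))
      ((volume : Measure ℝ).prod (volume : Measure (ℝ × ℝ))) :=
    (hui.mul_prod hB).mul_bdd (c := M) (Continuous.aestronglyMeasurable (by fun_prop))
      (Eventually.of_forall fun w => hbd w.1 w.2)
  have h1 : ∀ x, (∫ s : ℝ, ∫ p : ℝ, osc ((p - x) * s) * B (s, p) * u (2 * p - x)) *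
      starRingEnd ℂ (u x) = ∫ z : ℝ × ℝ,
        (starRingEnd ℂ (u x) * B z) * (osc ((z.2 - x) * z.1) * u (2 * z.2 - x)) := by
    intro x
    have h2 : Integrable (fun z : ℝ × ℝ => B z * (osc ((z.2 - x) * z.1) * u (2 * z.2 - x))) :=
      hB.mul_bdd (c := M) (Continuous.aestronglyMeasurable (by fun_prop))
        (Eventually.of_forall fun z => hbd x z)
    simp only [mul_assoc]
    rw [integral_const_mul, mul_comm, Measure.volume_eq_prod, integral_prod _ h2]
    congr 1
    congr 1
    funext s
    congr 1
    funext p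
    ring
  simp only [h1]
  rw [integral_integral_swap hInt]
  congr 1
  funext z
  rw [← integral_const_mul]
  congr 1
  funext x
  ring

theorem integral_osc_mul_conj (u : 𝓢(ℝ, ℂ)) (s p : ℝ) :
    ∫ x : ℝ, osc ((p - x) * s) * u (2 * p - x) * starRingEnd ℂ (u x) =
      ∫ η : ℝ, 𝓕 u η * (osc (p * (s - 2 * η)) * starRingEnd ℂ (𝓕 u (s - η))) := by
  have hu := u.continuous
  have hv := (𝓕 u).continuous
  have hc : Continuous fun x => starRingEnd ℂ (u x) := RCLike.continuous_conj.comp hu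
  have hui : Integrable fun x => starRingEnd ℂ (u x) := by
    rw [← integrable_norm_iff hc.aestronglyMeasurable]
    simpa using u.integrable.norm
  have hInt : Integrable (Function.uncurry fun x η : ℝ =>
      (starRingEnd ℂ (u x) * 𝓕 u η) * (osc ((p - x) * s) * osc (-((2 * p - x) * η))))
      ((volume : Measure ℝ).prod (volume : Measure ℝ)) :=
    (hui.mul_prod (𝓕 u).integrable).mul_bdd (c := 1)
      (Continuous.aestronglyMeasurable (by fun_prop))
      (Eventually.of_forall fun w => by rw [norm_mul, norm_osc, norm_osc, one_mul])
  have h1 : ∀ x, osc ((p - x) * s) * u (2 * p - x) * starRingEnd ℂ (u x) = ∫ η : ℝ,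
      (starRingEnd ℂ (u x) * 𝓕 u η) * (osc ((p - x) * s) * osc (-((2 * p - x) * η))) := by
    intro x
    rw [apply_eq_integral_osc_fourier u (2 * p - x), mul_right_comm, ← integral_const_mul]
    congr 1
    funext η
    ring
  simp only [h1]
  rw [integral_integral_swap hInt]
  congr 1
  funext η
  rw [fourier_apply_eq_integral_osc u (s - η), ← integral_conj, ← integral_const_mul,
    ← integral_const_mul]
  congr 1
  funext x
  rw [map_mul, conj_osc]
  have : osc ((p - x) * s) * osc (-((2 * p - x) * η)) =
      osc (p * (s - 2 * η)) * osc (-(x * (s - η))) := by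
    rw [← osc_add, ← osc_add]
    congr 1
    ring
  rw [this]
  ring

theorem integral_mul_integral_osc (hB : Integrable B) (u : 𝓢(ℝ, ℂ)) :
    ∫ z : ℝ × ℝ, B z * ∫ η : ℝ,
        𝓕 u η * (osc (z.2 * (z.1 - 2 * η)) * starRingEnd ℂ (𝓕 u (z.1 - η))) =
      ∫ η : ℝ, ∫ ζ : ℝ, (∫ p : ℝ, B (ζ + η, p) * osc (p * (ζ - η))) *
        starRingEnd ℂ (𝓕 u ζ) * 𝓕 u η := by
  obtain ⟨M, hM⟩ := exists_norm_le (𝓕 u)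
  have hv := (𝓕 u).continuous
  have hc : Continuous fun x => starRingEnd ℂ (𝓕 u x) := RCLike.continuous_conj.comp hv
  have hcc : Continuous fun w : (ℝ × ℝ) × ℝ =>
      osc (w.1.2 * (w.1.1 - 2 * w.2)) * starRingEnd ℂ (𝓕 u (w.1.1 - w.2)) :=
    (by fun_prop : Continuous fun w : (ℝ × ℝ) × ℝ => osc (w.1.2 * (w.1.1 - 2 * w.2))).mul
      (hc.comp (by fun_prop))
  have hbd : ∀ w : (ℝ × ℝ) × ℝ,
      ‖osc (w.1.2 * (w.1.1 - 2 * w.2)) * starRingEnd ℂ (𝓕 u (w.1.1 - w.2))‖ ≤ M := by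
    intro w
    rw [norm_mul, norm_osc, one_mul, RCLike.norm_conj]
    exact hM _
  have hInt : Integrable (Function.uncurry fun (z : ℝ × ℝ) (η : ℝ) => (B z * 𝓕 u η) *
      (osc (z.2 * (z.1 - 2 * η)) * starRingEnd ℂ (𝓕 u (z.1 - η))))
      ((volume : Measure (ℝ × ℝ)).prod (volume : Measure ℝ)) :=
    (hB.mul_prod (𝓕 u).integrable).mul_bdd (c := M) hcc.aestronglyMeasurable
      (Eventually.of_forall hbd)
  simp only [← integral_const_mul, ← mul_assoc (B _) (𝓕 u _)]
  rw [integral_integral_swap hInt]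
  congr 1
  funext η
  have h2 : Integrable (fun z : ℝ × ℝ => (B z * 𝓕 u η) *
      (osc (z.2 * (z.1 - 2 * η)) * starRingEnd ℂ (𝓕 u (z.1 - η)))) :=
    (hB.mul_const _).mul_bdd (c := M)
      (hcc.comp (by fun_prop : Continuous fun z : ℝ × ℝ => (z, η))).aestronglyMeasurable
      (Eventually.of_forall fun z => hbd (z, η))
  rw [Measure.volume_eq_prod, integral_prod _ h2,
    ← integral_add_right_eq_self (fun s : ℝ => ∫ p : ℝ, (B (s, p) * 𝓕 u η) *
      (osc (p * (s - 2 * η)) * starRingEnd ℂ (𝓕 u (s - η)))) η]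
  congr 1
  funext ζ
  rw [← integral_mul_const, ← integral_mul_const]
  congr 1
  funext p
  rw [add_sub_cancel_right, show ζ + η - 2 * η = ζ - η by ring]
  ring

theorem integral_weylIntegral_mul_conj {a : ℝ × ℝ → ℂ}
    (ha : Integrable fun z : ℝ × ℝ => a (z.2, Real.pi * z.1)) (u : 𝓢(ℝ, ℂ)) :
    ∫ x : ℝ, weylIntegral a u x * starRingEnd ℂ (u x) =
      ∫ η : ℝ, ∫ ζ : ℝ, (∫ p : ℝ, a (p, Real.pi * (ζ + η)) * osc (p * (ζ - η))) *
        starRingEnd ℂ (𝓕 u ζ) * 𝓕 u η := by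
  simp only [weylIntegral_eq]
  rw [integral_conj_mul_weyl ha]
  simp only [integral_osc_mul_conj]
  exact integral_mul_integral_osc ha u

theorem inner_eq_inner_tensor_of_kernel {a : ℝ × ℝ → ℂ} {T : L2R →L[ℂ] L2R}
    (hT : IsWeylOp a T) (ha : Integrable fun z : ℝ × ℝ => a (z.2, Real.pi * z.1))
    (K : Lp ℂ 2 (volume : Measure (ℝ × ℝ))) (k : ℝ × ℝ → ℂ) (hk : ⇑K =ᵐ[volume] k)
    (hak : ∀ ζ η : ℝ, ζ + η ≠ 0 →
      ∫ p : ℝ, a (p, Real.pi * (ζ + η)) * osc (p * (ζ - η)) = k (ζ, η)) (f : L2R) :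
    ⟪f, T f⟫_ℂ = ⟪tensor (𝓕 f) (star (𝓕 f)), K⟫_ℂ := by
  have hcont : Continuous fun f : L2R => 𝓕 f := ContinuousFourier.continuous_fourier
  have hdense : DenseRange fun u : 𝓢(ℝ, ℂ) => u.toLp 2 (volume : Measure ℝ) :=
    SchwartzMap.denseRange_toLpCLM (p := 2) (by simp)
  refine hdense.induction_on (p := fun f : L2R => ⟪f, T f⟫_ℂ = ⟪tensor (𝓕 f) (star (𝓕 f)), K⟫_ℂ)
    f (isClosed_eq (by fun_prop)
      ((continuous_tensor_star.comp hcont).inner continuous_const)) fun u => ?_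
  have hu := u.coeFn_toLp 2 (volume : Measure ℝ)
  have hv := (𝓕 u).coeFn_toLp 2 (volume : Measure ℝ)
  rw [SchwartzMap.toLp_fourier_eq, L2.inner_def]
  set v : L2R := (𝓕 u).toLp 2 volume
  have h1 : ∫ x, ⟪(u.toLp 2 volume : L2R) x, T (u.toLp 2 volume) x⟫_ℂ =
      ∫ x : ℝ, weylIntegral a u x * starRingEnd ℂ (u x) := by
    refine integral_congr_ae ?_
    filter_upwards [hu, hT u _ hu] with x e1 e2
    rw [e1, e2, RCLike.inner_apply]
  have hprod : ⇑(tensor v (star v)) =ᵐ[volume] fun z : ℝ × ℝ =>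
      𝓕 u z.1 * starRingEnd ℂ (𝓕 u z.2) := by
    have e1 : ∀ᵐ z : ℝ × ℝ, v z.1 = 𝓕 u z.1 :=
      Measure.quasiMeasurePreserving_fst.ae hv
    have e2 : ∀ᵐ z : ℝ × ℝ, v z.2 = 𝓕 u z.2 :=
      Measure.quasiMeasurePreserving_snd.ae hv
    have e3 : ∀ᵐ z : ℝ × ℝ, (star v : L2R) z.2 = star (v z.2) :=
      Measure.quasiMeasurePreserving_snd.ae (Lp.coeFn_star v)
    filter_upwards [coeFn_tensor v (star v), e1, e2, e3] with z e0 e1 e2 e3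
    rw [e0, e1, e3, e2]
    rfl
  have h2 : (fun z => ⟪tensor v (star v) z, K z⟫_ℂ) =ᵐ[volume] fun z : ℝ × ℝ =>
      k z * starRingEnd ℂ (𝓕 u z.1) * 𝓕 u z.2 := by
    filter_upwards [hprod, hk] with z e1 e2
    rw [e1, e2, RCLike.inner_apply, map_mul, Complex.conj_conj, mul_assoc]
  have hi := (L2.integrable_inner (𝕜 := ℂ) (tensor v (star v)) K).congr h2
  rw [h1, L2.inner_def, integral_congr_ae h2, integral_weylIntegral_mul_conj ha,
    Measure.volume_eq_prod, integral_prod_symm _ hi]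
  congr 1
  funext η
  refine integral_congr_ae ?_
  have : ∀ᵐ ζ : ℝ, ζ ≠ -η := by simp [ae_iff, measure_singleton]
  filter_upwards [this] with ζ hζ
  rw [hak ζ η fun h => hζ (eq_neg_of_add_eq_zero_left h)]

end WeylForm

section Sector

theorem exists_polar (x y : ℝ) (hy : y ≠ 0) :
    ∃ ρ, 0 < ρ ∧ 0 ≤ arg2pi (x + y * I) ∧ arg2pi (x + y * I) < 2 * Real.pi ∧
      x = ρ * Real.cos (arg2pi (x + y * I)) ∧ y = ρ * Real.sin (arg2pi (x + y * I)) := by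
  set z : ℂ := x + y * I
  have hre : z.re = x := by simp [z]
  have him : z.im = y := by simp [z]
  have hz : z ≠ 0 := fun h => hy (by rw [← him, h, zero_im])
  have h1 := Complex.neg_pi_lt_arg z
  have h2 := Complex.arg_le_pi z
  have hπ := Real.pi_pos
  have hc := Complex.norm_mul_cos_arg z
  have hs := Complex.norm_mul_sin_arg z
  rw [hre] at hc
  rw [him] at hs
  refine ⟨‖z‖, norm_pos_iff.2 hz, ?_⟩
  unfold arg2pi
  split_ifs with h
  · exact ⟨h, by linarith, hc.symm, hs.symm⟩
  · rw [Real.cos_add_two_pi, Real.sin_add_two_pi]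
    exact ⟨by linarith, by linarith, hc.symm, hs.symm⟩

variable {θ : ℝ}

theorem exists_shear_polar (hs : Real.sin θ ≠ 0) (r ξ : ℝ) (hξ : ξ ≠ 0) :
    ∃ ρ α : ℝ, 0 < ρ ∧ 0 ≤ α ∧ α < 2 * Real.pi ∧ ξ = ρ * Real.sin α ∧
      r * Real.sin θ = ρ * Real.sin (θ - α) ∧
      ((r + Real.cos θ / Real.sin θ * ξ, ξ) ∈ sector θ ↔ 0 < α ∧ α < θ) := by
  obtain ⟨ρ, hρ, h0, h2, hx, hy⟩ := exists_polar (r + Real.cos θ / Real.sin θ * ξ) ξ hξ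
  refine ⟨ρ, _, hρ, h0, h2, hy, ?_, Iff.rfl⟩
  set α := arg2pi _
  have e : (r + Real.cos θ / Real.sin θ * ξ) * Real.sin θ =
      r * Real.sin θ + Real.cos θ * ξ := by
    field_simp
  rw [Real.sin_sub]
  rw [hx] at e
  linear_combination -e - Real.cos θ * hy

theorem mem_sector_iff_of_lt_pi (h0 : 0 < θ) (hπ : θ < Real.pi) (r ξ : ℝ) (hξ : ξ ≠ 0) :
    (r + Real.cos θ / Real.sin θ * ξ, ξ) ∈ sector θ ↔ 0 < ξ ∧ 0 < r := by
  have hs : 0 < Real.sin θ := Real.sin_pos_of_pos_of_lt_pi h0 hπ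
  obtain ⟨ρ, α, hρ, hα0, hα, e1, e2, e3⟩ := exists_shear_polar hs.ne' r ξ hξ
  rw [e3]
  constructor
  · rintro ⟨h1, h2⟩
    have p1 := Real.sin_pos_of_pos_of_lt_pi h1 (h2.trans hπ)
    have p2 := Real.sin_pos_of_pos_of_lt_pi (sub_pos.2 h2) (by linarith)
    refine ⟨by rw [e1]; positivity, ?_⟩
    have : 0 < r * Real.sin θ := by rw [e2]; positivity
    exact pos_of_mul_pos_left this hs.le
  · rintro ⟨h1, h2⟩
    rw [e1] at h1
    have h3 : 0 < Real.sin α := pos_of_mul_pos_right h1 hρ.le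
    have h4 : 0 < ρ * Real.sin (θ - α) := by rw [← e2]; positivity
    have h5 : 0 < Real.sin (θ - α) := pos_of_mul_pos_right h4 hρ.le
    have hα' : α < Real.pi := by
      by_contra! h
      have := Real.sin_nonpos_of_nonpos_of_neg_pi_le (x := α - 2 * Real.pi) (by linarith)
        (by linarith)
      rw [Real.sin_sub_two_pi] at this
      linarith
    refine ⟨hα0.lt_of_ne ?_, ?_⟩
    · rintro rfl
      simp at h3
    · by_contra! h
      have := Real.sin_nonpos_of_nonpos_of_neg_pi_le (x := θ - α) (by linarith) (by linarith)
      linarith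

theorem mem_sector_iff_of_pi_lt (hπ : Real.pi < θ) (h2 : θ < 2 * Real.pi) (r ξ : ℝ)
    (hξ : ξ ≠ 0) (hr : r ≠ 0) :
    (r + Real.cos θ / Real.sin θ * ξ, ξ) ∈ sector θ ↔ ¬ (ξ < 0 ∧ 0 < r) := by
  have hneg : ∀ β, Real.pi < β → β < 2 * Real.pi → Real.sin β < 0 := by
    intro β h1 h2
    have := Real.sin_neg_of_neg_of_neg_pi_lt (x := β - 2 * Real.pi) (by linarith) (by linarith)
    rwa [Real.sin_sub_two_pi] at this
  have hs := hneg θ hπ h2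
  have hpi := Real.pi_pos
  obtain ⟨ρ, α, hρ, hα0, hα, e1, e2, e3⟩ := exists_shear_polar hs.ne r ξ hξ
  rw [e3, not_iff_not.symm, not_not]
  constructor
  · intro h
    have hα1 : 0 < α := hα0.lt_of_ne (by
      rintro rfl
      simp at e1
      exact hξ e1)
    have hα2 : θ < α := by
      refine (not_lt.1 fun h' => h ⟨hα1, h'⟩).lt_of_ne ?_
      rintro rfl
      simp only [sub_self, Real.sin_zero, mul_zero, mul_eq_zero] at e2
      exact e2.elim hr hs.ne
    have p1 := hneg α (by linarith) hα
    have p2 := Real.sin_neg_of_neg_of_neg_pi_lt (x := θ - α) (by linarith) (by linarith)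
    refine ⟨by rw [e1]; exact mul_neg_of_pos_of_neg hρ p1, ?_⟩
    have : r * Real.sin θ < 0 := by rw [e2]; exact mul_neg_of_pos_of_neg hρ p2
    exact pos_of_mul_neg_left this hs.le
  · rintro ⟨h1, h3⟩ ⟨h4, h5⟩
    have p1 : Real.sin α < 0 := by
      rw [e1] at h1
      exact neg_of_mul_neg_right h1 hρ.le
    have p2 : Real.sin (θ - α) < 0 := by
      have : ρ * Real.sin (θ - α) < 0 := by rw [← e2]; exact mul_neg_of_pos_of_neg h3 hs
      exact neg_of_mul_neg_right this hρ.le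
    have p3 : Real.pi < α := by
      by_contra! h
      linarith [Real.sin_nonneg_of_nonneg_of_le_pi hα0 h]
    linarith [Real.sin_nonneg_of_nonneg_of_le_pi (x := θ - α) (by linarith) (by linarith)]

theorem measurableSet_sector (θ : ℝ) : MeasurableSet (sector θ) := by
  have h1 : Measurable arg2pi :=
    Measurable.ite (measurableSet_le measurable_const measurable_arg) measurable_arg
      (measurable_arg.add_const _)
  have h2 : Measurable fun p : ℝ × ℝ => arg2pi (p.1 + p.2 * I) := h1.comp (by fun_prop)
  exact (measurableSet_lt measurable_const h2).inter (measurableSet_lt h2 measurable_const)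

end Sector

/-- If `a`, sheared by `κ`, agrees with `c g` on `r < 0` and with `1_{ξ > 0} g` on `r > 0`, then its
partial Fourier transform is a unimodular multiple of the half-line integrals of `g`. -/
theorem integral_mul_osc_of_shear {a g : ℝ × ℝ → ℂ} {c : ℂ} {κ R ξ : ℝ} (hg : Continuous g)
    (hR : 0 ≤ R) (hgr : ∀ r, R ≤ |r| → g (r, ξ) = 0)
    (hneg : ∀ r, r < 0 → a (r + κ * ξ, ξ) = c * g (r, ξ))
    (hpos : ∀ r, 0 < r → a (r + κ * ξ, ξ) = if 0 < ξ then g (r, ξ) else 0) (t : ℝ) :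
    ∫ p : ℝ, a (p, ξ) * osc (p * t) = osc (κ * ξ * t) *
      (c * oscInt g (-R) 0 ξ t + if 0 < ξ then oscInt g 0 R ξ t else 0) := by
  have hsplit : ∀ r, osc ((r + κ * ξ) * t) = osc (κ * ξ * t) * osc (r * t) := fun r => by
    rw [← osc_add]
    congr 1
    ring
  set d : ℂ := if 0 < ξ then 1 else 0 with hd
  have hpos' : ∀ r, 0 < r → a (r + κ * ξ, ξ) = d * g (r, ξ) := fun r hr => by
    rw [hpos r hr, hd, ite_mul, one_mul, zero_mul]
  set F : ℝ → ℂ := fun r => (if r < 0 then c else d) * (g (r, ξ) * osc (r * t)) with hF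
  have h1 : ∫ p : ℝ, a (p, ξ) * osc (p * t) = osc (κ * ξ * t) * ∫ r, F r := by
    rw [← integral_add_right_eq_self _ (κ * ξ), ← integral_const_mul]
    refine integral_congr_ae ?_
    have : ∀ᵐ r : ℝ, r ≠ 0 := by simp [ae_iff, measure_singleton]
    filter_upwards [this] with r hr
    rw [hsplit, hF]
    dsimp only
    rcases lt_or_gt_of_ne hr with h | h
    · rw [hneg r h, if_pos h]
      ring
    · rw [hpos' r h, if_neg h.le.not_gt]
      ring
  have hsupp : Function.support F ⊆ Set.Ioc (-R) R := by
    intro r hr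
    have : |r| < R := by
      by_contra! h
      exact hr (by simp [hF, hgr r h])
    rw [abs_lt] at this
    exact ⟨this.1, this.2.le⟩
  have hcont : Continuous fun r => g (r, ξ) * osc (r * t) := by fun_prop
  have hm : ∀ᵐ r : ℝ, r ∈ Set.uIoc (-R) 0 → c * (g (r, ξ) * osc (r * t)) = F r := by
    have : ∀ᵐ r : ℝ, r ≠ 0 := by simp [ae_iff, measure_singleton]
    filter_upwards [this] with r hr hr'
    rw [Set.uIoc_of_le (by linarith)] at hr'
    rw [hF]
    dsimp only
    rw [if_pos (lt_of_le_of_ne hr'.2 hr)]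
  have hp : ∀ᵐ r : ℝ, r ∈ Set.uIoc 0 R → d * (g (r, ξ) * osc (r * t)) = F r :=
    Eventually.of_forall fun r hr' => by
      rw [Set.uIoc_of_le hR] at hr'
      rw [hF]
      dsimp only
      rw [if_neg hr'.1.le.not_gt]
  rw [h1, ← intervalIntegral.integral_eq_integral_of_support_subset hsupp,
    ← intervalIntegral.integral_add_adjacent_intervals (b := 0)
      (((hcont.const_mul c).intervalIntegrable _ _).congr_ae <|
        (ae_restrict_iff' measurableSet_uIoc).2 hm)
      (((hcont.const_mul d).intervalIntegrable _ _).congr_ae <|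
        (ae_restrict_iff' measurableSet_uIoc).2 hp),
    ← intervalIntegral.integral_congr_ae hm, ← intervalIntegral.integral_congr_ae hp,
    intervalIntegral.integral_const_mul, intervalIntegral.integral_const_mul]
  congr 2
  rw [hd, ite_mul, one_mul, zero_mul]
  rfl

theorem integrable_symbAOm_sector (θ : ℝ) {φ : ℝ × ℝ → ℝ} (hφ : Continuous φ) {R : ℝ}
    (hR : ∀ p, R ≤ ‖p‖ → φ p = 0) :
    Integrable fun z : ℝ × ℝ => symbAOm (sector θ) φ (z.2, Real.pi * z.1) := by
  have hc : Continuous fun z : ℝ × ℝ => (φ (z.2, Real.pi * z.1) : ℂ) := by fun_prop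
  have hs : HasCompactSupport fun z : ℝ × ℝ => (φ (z.2, Real.pi * z.1) : ℂ) := by
    refine HasCompactSupport.intro (isCompact_closedBall 0 R) fun z hz => ?_
    rw [mem_closedBall_zero_iff, not_le] at hz
    rw [hR _ (hz.le.trans ?_), ofReal_zero]
    rw [Prod.norm_def, Prod.norm_def]
    refine max_le (le_max_of_le_right ?_) (le_max_left _ _)
    rw [norm_mul, Real.norm_eq_abs Real.pi, abs_of_pos Real.pi_pos]
    nlinarith [Real.two_le_pi, norm_nonneg z.1]
  have hm : Measurable fun z : ℝ × ℝ => (z.2, Real.pi * z.1) := by fun_prop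
  exact (hc.integrable_of_hasCompactSupport hs).indicator (hm (measurableSet_sector θ))

theorem exists_symbAOm_sector_shear {θ : ℝ}
    (hθ : θ ∈ Set.Ioo 0 Real.pi ∨ θ ∈ Set.Ioo Real.pi (2 * Real.pi)) (φ : ℝ × ℝ → ℝ) :
    ∃ c : ℂ, ‖c‖ ≤ 1 ∧ ∀ ξ, ξ ≠ 0 →
      (∀ r, r < 0 → symbAOm (sector θ) φ (r + Real.cos θ / Real.sin θ * ξ, ξ) =
        c * φ (r + Real.cos θ / Real.sin θ * ξ, ξ)) ∧
      (∀ r, 0 < r → symbAOm (sector θ) φ (r + Real.cos θ / Real.sin θ * ξ, ξ) =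
        if 0 < ξ then (φ (r + Real.cos θ / Real.sin θ * ξ, ξ) : ℂ) else 0) := by
  classical
  rcases hθ with ⟨h1, h2⟩ | ⟨h1, h2⟩
  · refine ⟨0, by simp, fun ξ hξ => ⟨fun r hr => ?_, fun r hr => ?_⟩⟩ <;>
      rw [symbAOm, Set.indicator_apply] <;> simp only [mem_sector_iff_of_lt_pi h1 h2 r ξ hξ]
    · rw [if_neg fun h => h.2.not_gt hr, zero_mul]
    · simp only [hr, and_true]
  · refine ⟨1, by simp, fun ξ hξ => ⟨fun r hr => ?_, fun r hr => ?_⟩⟩ <;>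
      rw [symbAOm, Set.indicator_apply] <;>
      simp only [mem_sector_iff_of_pi_lt h1 h2 r ξ hξ (ne_iff_lt_or_gt.2 (by tauto))]
    · rw [if_pos fun h => h.2.not_gt hr, one_mul]
    · simp only [hr, and_true, not_lt, hξ.symm.le_iff_lt]

open scoped FourierTransform in
/-- The quadratic form of the sector operator on the Fourier side is given by a jump kernel, up to
a unimodular factor. -/
theorem exists_isJumpKernel_of_isWeylOp {θ : ℝ}
    (hθ : θ ∈ Set.Ioo 0 Real.pi ∨ θ ∈ Set.Ioo Real.pi (2 * Real.pi))
    {φ : ℝ × ℝ → ℝ} (hφ_smooth : ContDiff ℝ (⊤ : ℕ∞) φ) (hφ_supp : HasCompactSupport φ)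
    (hφ0 : φ (0, 0) = 0) {T : L2R →L[ℂ] L2R} (hT : IsWeylOp (symbAOm (sector θ) φ) T) :
    ∃ (k : ℝ → ℝ → ℂ) (C R : ℝ) (ph : ℝ → ℂ) (hk : IsJumpKernel k C R) (hph : Continuous ph)
      (hph1 : ∀ x, ‖ph x‖ = 1), ∀ f : L2R,
        ⟪f, T f⟫_ℂ = ⟪tensor (𝓕 f) (star (𝓕 f)), (hk.memLp hph hph1).toLp⟫_ℂ := by
  obtain ⟨R₀, hR₀, hφR⟩ := hφ_supp.exists_pos_le_norm
  obtain ⟨c, hc, hca⟩ := exists_symbAOm_sector_shear hθ φ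
  set κ := Real.cos θ / Real.sin θ
  set g : ℝ × ℝ → ℂ := fun p => (φ (p.1 + κ * p.2, p.2) : ℂ) with hgdef
  set R := (1 + |κ|) * R₀
  have hR : 0 ≤ R := by positivity
  have hR₀R : R₀ ≤ R := by
    have : 0 ≤ |κ| * R₀ := by positivity
    linarith
  have hg0 : ∀ p : ℝ × ℝ, R ≤ ‖p‖ → g p = 0 := by
    intro p hp
    rw [hgdef]
    dsimp only
    rw [hφR, ofReal_zero]
    by_contra! h
    rw [Prod.norm_def, max_lt_iff, Real.norm_eq_abs, Real.norm_eq_abs] at h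
    have h1 : |p.1| < R := by
      have e1 := abs_sub_abs_le_abs_sub p.1 (-(κ * p.2))
      rw [abs_neg, abs_mul, sub_neg_eq_add] at e1
      have e2 : |κ| * |p.2| ≤ |κ| * R₀ := by gcongr; exact h.2.le
      linarith [h.1]
    have h2 : |p.2| < R := h.2.trans_le hR₀R
    exact absurd hp (not_le.2 (max_lt h1 h2))
  have hg_smooth : ContDiff ℝ (⊤ : ℕ∞) g := by
    refine ofRealCLM.contDiff.comp (hφ_smooth.comp ?_)
    fun_prop
  have hg_supp : HasCompactSupport g :=
    HasCompactSupport.intro (isCompact_closedBall 0 R) fun z hz => by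
      rw [mem_closedBall_zero_iff, not_le] at hz
      exact hg0 z hz.le
  have hgr : ∀ r ξ, R ≤ |r| → g (r, ξ) = 0 := fun r ξ h => hg0 _ (le_max_of_le_left h)
  obtain ⟨C, hK⟩ := exists_isJumpKernel hg_smooth hg_supp (by simp [hgdef, hφ0]) hc hR
    (hgr R 0 (le_abs_self R)) (fun r ξ h => hg0 _ (le_max_of_le_right h.le))
  have hph : Continuous fun x : ℝ => osc (κ * Real.pi * x ^ 2) := by fun_prop
  refine ⟨_, C, R, _, hK, hph, fun x => norm_osc _, inner_eq_inner_tensor_of_kernel hT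
    (integrable_symbAOm_sector θ hφ_smooth.continuous hφR) _ _ (MemLp.coeFn_toLp _)
    fun ζ η hne => ?_⟩
  have hξ : Real.pi * (ζ + η) ≠ 0 := mul_ne_zero Real.pi_ne_zero hne
  rw [integral_mul_osc_of_shear (g := g) hg_smooth.continuous hR (fun r => hgr r _)
    (hca _ hξ).1 (hca _ hξ).2, conj_osc]
  dsimp only
  rw [← mul_assoc (osc _) (osc _), ← osc_add, jumpKernel]
  simp only [mul_pos_iff_of_pos_left Real.pi_pos]
  congr 2
  ring

theorem exists_eigPlus_le_div {k : ℝ → ℝ → ℂ} {C R : ℝ} {ph : ℝ → ℂ} (hk : IsJumpKernel k C R)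
    (hph : Continuous ph) (hph1 : ∀ x, ‖ph x‖ = 1) {T : L2R →L[ℂ] L2R}
    (hT : ∀ f : L2R, ⟪f, T f⟫_ℂ = ⟪tensor (FourierTransform.fourier f)
      (star (FourierTransform.fourier f)), (hk.memLp hph hph1).toLp⟫_ℂ) :
    ∃ C : ℝ, ∀ k : ℕ, eigPlus T k ≤ C / (k + 1) ∧ eigMinus T k ≤ C / (k + 1) := by
  obtain ⟨D, hD, happrox⟩ := hk.exists_finite_rank_approx hph hph1
  have h : ∀ n, 1 ≤ n → ∃ V : Submodule ℂ L2R, Module.rank ℂ V ≤ ((16 * n : ℕ) : Cardinal) ∧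
      ∀ m (v : Fin m → L2R), Orthonormal ℂ v → (∀ i, v i ∈ Vᗮ) →
        ∑ i, ‖⟪T (v i), v i⟫_ℂ‖ ^ 2 ≤ D / n := by
    intro n hn
    obtain ⟨f, g, hfg⟩ := happrox n hn
    exact exists_submodule_sum_sq_le_of_kernel T _ hT _ _ (IsJumpKernel.card_cells_le n) f g _ hfg
  refine ⟨2 * ((16 : ℕ) + 1) * (√(D + 1) + ‖T‖), fun k => ⟨eigPlus_le_div T 16 D hD h k, ?_⟩⟩
  have := eigPlus_le_div (-T) 16 D hD (fun n hn => ?_) k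
  · rwa [norm_neg] at this
  · simpa only [neg_apply, inner_neg_left, norm_neg] using h n hn

/-- **Theorem.** For a sector `Ω = Ω_θ`, `θ ∈ (0,π) ∪ (π,2π)`, and real-valued
`φ ∈ C_0^∞(ℝ²)` with `φ(0,0) = 0`, the eigenvalues of `A_Ω[φ]` satisfy
`λ_k^{(±)}(A_Ω[φ]) = O(k^{-1})`. -/
theorem sector_eigenvalue_bound_of_vanishing
    (θ : ℝ) (hθ : θ ∈ Set.Ioo 0 Real.pi ∨ θ ∈ Set.Ioo Real.pi (2 * Real.pi))
    (φ : ℝ × ℝ → ℝ) (hφ_smooth : ContDiff ℝ (⊤ : ℕ∞) φ) (hφ_supp : HasCompactSupport φ)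
    (hφ0 : φ (0, 0) = 0)
    (T : L2R →L[ℂ] L2R) (hT : IsWeylOp (symbAOm (sector θ) φ) T) :
    ∃ C : ℝ, ∀ k : ℕ,
      eigPlus T k ≤ C / (k + 1) ∧ eigMinus T k ≤ C / (k + 1) := by
  obtain ⟨_, _, _, _, hk, hph, hph1, h⟩ :=
    exists_isJumpKernel_of_isWeylOp hθ hφ_smooth hφ_supp hφ0 hT
  exact exists_eigPlus_le_div hk hph hph1 h

end
end

section
/- Let Ω ⊂ ℝ² be a polygon (not necessarily convex), and let φ ∈ C_0^∞(ℝ²) be real-valued. Then the positive and negative eigenvalues of A_Ω[φ] satisfy λ_k^{(±)}(A_Ω[φ]) = O(k^{−1} log k) as k → ∞. -/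
open MeasureTheory Filter Complex
open scoped ENNReal InnerProductSpace RealInnerProductSpace

noncomputable section

/-- `Ω ⊂ ℝ²` is a polygon (not necessarily convex): a bounded open set whose boundary is
a finite union of line segments. -/
def IsPolygon (Ω : Set (ℝ × ℝ)) : Prop :=
  IsOpen Ω ∧ Bornology.IsBounded Ω ∧
    ∃ (n : ℕ) (P Q : Fin n → ℝ × ℝ), frontier Ω = ⋃ i, segment ℝ (P i) (Q i)

/-- `conj (f x) * K (x, y) * u y`: the integrand of the sesquilinear form with kernel `K`. -/
def formIntegrand (K : ℝ × ℝ → ℂ) (f u : L2R) (p : ℝ × ℝ) : ℂ :=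
  starRingEnd ℂ (f p.1) * K p * u p.2

theorem ENNReal.mul_le_sq_add_sq (a b : ℝ≥0∞) : a * b ≤ a ^ 2 + b ^ 2 := by
  rcases le_total a b with h | h
  · calc a * b ≤ b * b := by gcongr
      _ ≤ a ^ 2 + b ^ 2 := by rw [sq b]; exact le_add_self
  · calc a * b ≤ a * a := by gcongr
      _ ≤ a ^ 2 + b ^ 2 := by rw [sq a]; exact le_self_add

theorem lintegral_enorm_sq (f : L2R) : ∫⁻ x, ‖f x‖ₑ ^ 2 = ENNReal.ofReal (‖f‖ ^ 2) := by
  have h : ‖f‖ₑ ^ 2 = ∫⁻ x, ‖f x‖ₑ ^ 2 := by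
    rw [Lp.enorm_def, eLpNorm_eq_lintegral_rpow_enorm_toReal (by norm_num) (by norm_num)]
    simp only [ENNReal.toReal_ofNat, ENNReal.rpow_ofNat]
    rw [← ENNReal.rpow_natCast, ← ENNReal.rpow_mul]
    norm_num
  rw [← h, ← ofReal_norm, ENNReal.ofReal_pow (norm_nonneg _)]

theorem measurable_formIntegrand {K : ℝ × ℝ → ℂ} (hK : Measurable K) (f u : L2R) :
    Measurable (formIntegrand K f u) := by
  have hf : Measurable f := (Lp.stronglyMeasurable f).measurable
  have hu : Measurable u := (Lp.stronglyMeasurable u).measurable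
  unfold formIntegrand
  exact ((RCLike.continuous_conj.measurable.comp (hf.comp measurable_fst)).mul hK).mul
    (hu.comp measurable_snd)

/-- The Schur test. -/
theorem schur_lintegral_le {K : ℝ × ℝ → ℂ} (hK : Measurable K) {B : ℝ≥0∞}
    (hrow : ∀ x, ∫⁻ y, ‖K (x, y)‖ₑ ≤ B) (hcol : ∀ y, ∫⁻ x, ‖K (x, y)‖ₑ ≤ B) (f u : L2R) :
    ∫⁻ p, ‖formIntegrand K f u p‖ₑ ≤ B * ENNReal.ofReal (‖f‖ ^ 2 + ‖u‖ ^ 2) := by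
  have hf : Measurable f := (Lp.stronglyMeasurable f).measurable
  have hu : Measurable u := (Lp.stronglyMeasurable u).measurable
  have hKe : Measurable fun p => ‖K p‖ₑ := hK.enorm
  have hf2 : Measurable fun p : ℝ × ℝ => ‖f p.1‖ₑ ^ 2 * ‖K p‖ₑ :=
    ((hf.comp measurable_fst).enorm.pow_const 2).mul hKe
  have hu2 : Measurable fun p : ℝ × ℝ => ‖u p.2‖ₑ ^ 2 * ‖K p‖ₑ :=
    ((hu.comp measurable_snd).enorm.pow_const 2).mul hKe
  calc ∫⁻ p, ‖formIntegrand K f u p‖ₑ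
      ≤ ∫⁻ p : ℝ × ℝ, (‖f p.1‖ₑ ^ 2 * ‖K p‖ₑ + ‖u p.2‖ₑ ^ 2 * ‖K p‖ₑ) := by
        refine lintegral_mono fun p => ?_
        simp only [formIntegrand, enorm_mul]
        have hc : ‖(starRingEnd ℂ) (f p.1)‖ₑ = ‖f p.1‖ₑ := by
          rw [← ofReal_norm, RCLike.norm_conj, ofReal_norm]
        rw [hc, mul_right_comm, ← add_mul]
        gcongr
        exact ENNReal.mul_le_sq_add_sq _ _
    _ = (∫⁻ p : ℝ × ℝ, ‖f p.1‖ₑ ^ 2 * ‖K p‖ₑ) + ∫⁻ p : ℝ × ℝ, ‖u p.2‖ₑ ^ 2 * ‖K p‖ₑ :=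
        lintegral_add_left hf2 _
    _ = (∫⁻ x, ‖f x‖ₑ ^ 2 * ∫⁻ y, ‖K (x, y)‖ₑ) + ∫⁻ y, ‖u y‖ₑ ^ 2 * ∫⁻ x, ‖K (x, y)‖ₑ := by
        rw [Measure.volume_eq_prod, lintegral_prod _ hf2.aemeasurable,
          lintegral_prod_symm _ hu2.aemeasurable]
        congr 1
        · refine lintegral_congr fun x => ?_
          exact lintegral_const_mul (f := fun y => ‖K (x, y)‖ₑ) (‖f x‖ₑ ^ 2)
            (hKe.comp measurable_prodMk_left)
        · refine lintegral_congr fun y => ?_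
          exact lintegral_const_mul (f := fun x => ‖K (x, y)‖ₑ) (‖u y‖ₑ ^ 2)
            (hKe.comp measurable_prodMk_right)
    _ ≤ (∫⁻ x, ‖f x‖ₑ ^ 2 * B) + ∫⁻ y, ‖u y‖ₑ ^ 2 * B := by
        gcongr with x y
        · exact hrow x
        · exact hcol y
    _ = B * ENNReal.ofReal (‖f‖ ^ 2 + ‖u‖ ^ 2) := by
        rw [lintegral_mul_const _ (hf.enorm.pow_const 2),
          lintegral_mul_const _ (hu.enorm.pow_const 2), lintegral_enorm_sq, lintegral_enorm_sq,
          ENNReal.ofReal_add (by positivity) (by positivity)]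
        ring

theorem schur_integrable {K : ℝ × ℝ → ℂ} (hK : Measurable K) {B : ℝ}
    (hrow : ∀ x, ∫⁻ y, ‖K (x, y)‖ₑ ≤ ENNReal.ofReal B)
    (hcol : ∀ y, ∫⁻ x, ‖K (x, y)‖ₑ ≤ ENNReal.ofReal B) (f u : L2R) :
    Integrable (formIntegrand K f u) :=
  ⟨(measurable_formIntegrand hK f u).aestronglyMeasurable,
    (schur_lintegral_le hK hrow hcol f u).trans_lt
      (ENNReal.mul_lt_top ENNReal.ofReal_lt_top ENNReal.ofReal_lt_top)⟩

theorem schur_norm_le {K : ℝ × ℝ → ℂ} (hK : Measurable K) {B : ℝ} (hB : 0 ≤ B)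
    (hrow : ∀ x, ∫⁻ y, ‖K (x, y)‖ₑ ≤ ENNReal.ofReal B)
    (hcol : ∀ y, ∫⁻ x, ‖K (x, y)‖ₑ ≤ ENNReal.ofReal B) (f u : L2R) :
    ‖∫ p, formIntegrand K f u p‖ ≤ B * (‖f‖ ^ 2 + ‖u‖ ^ 2) := by
  have h := (enorm_integral_le_lintegral_enorm (formIntegrand K f u)).trans
    (schur_lintegral_le hK hrow hcol f u)
  rw [← ENNReal.ofReal_mul hB, ← ofReal_norm] at h
  exact (ENNReal.ofReal_le_ofReal_iff (by positivity)).1 h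

/-- The sesquilinear form with kernel `K` is, for every `M ≥ 1`, bounded by `O(1 / M)` once its
first argument is orthogonal to a suitable subspace of dimension `O(M log M)`. -/
def IsLogApprox (K : ℝ × ℝ → ℂ) : Prop :=
  (∀ f u : L2R, Integrable (formIntegrand K f u)) ∧
  ∃ C : ℝ, 0 ≤ C ∧ ∀ M : ℕ, 1 ≤ M → ∃ (V : Submodule ℂ L2R) (n : ℕ),
    Module.rank ℂ V ≤ n ∧ (n : ℝ) ≤ C * (M * Real.log (M + 2)) ∧
    ∀ f ∈ Vᗮ, ∀ u : L2R, ‖∫ p, formIntegrand K f u p‖ ≤ C / M * (‖f‖ ^ 2 + ‖u‖ ^ 2)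

theorem mul_log_add_two_nonneg (M : ℕ) : (0 : ℝ) ≤ M * Real.log (M + 2) := by
  have : 0 ≤ Real.log ((M : ℝ) + 2) := Real.log_nonneg (by linarith [M.cast_nonneg (α := ℝ)])
  positivity

theorem IsLogApprox.zero : IsLogApprox 0 := by
  have h : ∀ f u : L2R, formIntegrand 0 f u = 0 := fun f u => by
    ext p; simp [formIntegrand]
  refine ⟨fun f u => by rw [h]; exact integrable_zero _ _ _, 0, le_rfl, fun M _ =>
    ⟨⊥, 0, by simp, by simp, fun f _ u => by simp [h]⟩⟩

theorem IsLogApprox.add {K L : ℝ × ℝ → ℂ} (hK : IsLogApprox K) (hL : IsLogApprox L) :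
    IsLogApprox (K + L) := by
  obtain ⟨iK, C, hC, hK⟩ := hK
  obtain ⟨iL, D, hD, hL⟩ := hL
  have h : ∀ f u : L2R, formIntegrand (K + L) f u = formIntegrand K f u + formIntegrand L f u :=
    fun f u => by ext p; simp [formIntegrand]; ring
  refine ⟨fun f u => by rw [h]; exact (iK f u).add (iL f u), C + D, by positivity, fun M hM => ?_⟩
  obtain ⟨V, n, hV, hn, hVK⟩ := hK M hM
  obtain ⟨W, m, hW, hm, hWL⟩ := hL M hM
  refine ⟨V ⊔ W, n + m, ?_, ?_, fun f hf u => ?_⟩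
  · push_cast
    exact (Submodule.rank_add_le_rank_add_rank V W).trans (add_le_add hV hW)
  · push_cast; linarith
  · rw [h]
    simp only [Pi.add_apply]
    rw [integral_add (iK f u) (iL f u)]
    have h1 := hVK f (Submodule.orthogonal_le le_sup_left hf) u
    have h2 := hWL f (Submodule.orthogonal_le le_sup_right hf) u
    calc _ ≤ _ := norm_add_le _ _
      _ ≤ _ := add_le_add h1 h2
      _ = _ := by ring

theorem IsLogApprox.smul {K : ℝ × ℝ → ℂ} (c : ℂ) (hK : IsLogApprox K) :
    IsLogApprox (c • K) := by
  obtain ⟨iK, C, hC, hK⟩ := hK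
  have h : ∀ f u : L2R, formIntegrand (c • K) f u = c • formIntegrand K f u :=
    fun f u => by ext p; simp [formIntegrand]; ring
  refine ⟨fun f u => by rw [h]; exact (iK f u).smul c, (1 + ‖c‖) * C, by positivity,
    fun M hM => ?_⟩
  obtain ⟨V, n, hV, hn, hVK⟩ := hK M hM
  have hM' := mul_log_add_two_nonneg M
  refine ⟨V, n, hV, ?_, fun f hf u => ?_⟩
  · nlinarith [mul_nonneg (mul_nonneg (norm_nonneg c) hC) hM']
  · rw [h]
    simp only [Pi.smul_apply]
    rw [integral_smul, norm_smul]
    have h1 := hVK f hf u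
    calc _ ≤ ‖c‖ * (C / M * (‖f‖ ^ 2 + ‖u‖ ^ 2)) := by gcongr
      _ ≤ (1 + ‖c‖) * (C / M * (‖f‖ ^ 2 + ‖u‖ ^ 2)) := by gcongr; linarith
      _ = _ := by ring

/-- The index of the cell containing `x` in the grid with nodes `sinh (j / M)`. -/
def gridIndex (M : ℕ) (x : ℝ) : ℤ := ⌊M * Real.arsinh x⌋

/-- The left endpoint of the cell of the `sinh`-grid containing `x`. -/
def gridPoint (M : ℕ) (j : ℤ) : ℝ := Real.sinh (j / M)

theorem measurable_gridIndex (M : ℕ) : Measurable (gridIndex M) :=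
  Int.measurable_floor.comp (Real.continuous_arsinh.measurable.const_mul _)

theorem measurable_gridPoint (M : ℕ) : Measurable (gridPoint M) := measurable_from_top

theorem abs_sinh_sub_sinh_le {t d : ℝ} (hd : 0 ≤ d) (hd1 : d ≤ 1) :
    |Real.sinh t - Real.sinh (t - d)| ≤ 3 * d * Real.cosh t := by
  have h1 : Real.sinh (t - d) ≤ Real.sinh t := Real.sinh_le_sinh.2 (by linarith)
  rw [abs_of_nonneg (by linarith), Real.sinh_eq, Real.sinh_eq, Real.cosh_eq]
  have e1 : Real.exp (t - d) = Real.exp t * Real.exp (-d) := by rw [← Real.exp_add]; ring_nf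
  have e2 : Real.exp (-(t - d)) = Real.exp (-t) * Real.exp d := by rw [← Real.exp_add]; ring_nf
  have h2 : 1 - d ≤ Real.exp (-d) := by linarith [Real.add_one_le_exp (-d)]
  have h3 : Real.exp d ≤ 1 + 3 * d := by
    have h4 : Real.exp d * Real.exp (-d) = 1 := by rw [← Real.exp_add]; simp
    have h5 : Real.exp d ≤ 3 :=
      (Real.exp_le_exp.2 hd1).trans (by linarith [Real.exp_one_lt_d9])
    nlinarith [Real.exp_pos d]
  rw [e1, e2]
  nlinarith [mul_le_mul_of_nonneg_left h2 (Real.exp_pos t).le,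
    mul_le_mul_of_nonneg_left h3 (Real.exp_pos (-t)).le, mul_nonneg hd (Real.exp_pos t).le]

theorem abs_sub_gridPoint_le {M : ℕ} (hM : 1 ≤ M) (x : ℝ) :
    |x - gridPoint M (gridIndex M x)| ≤ 3 * (1 + |x|) / M := by
  have hM' : (1 : ℝ) ≤ M := by exact_mod_cast hM
  have hM0 : (0 : ℝ) < M := by linarith
  set t := Real.arsinh x with ht
  set d := t - (gridIndex M x : ℝ) / M with hd
  have hfl : (gridIndex M x : ℝ) ≤ M * t := Int.floor_le _
  have hfl2 : M * t < (gridIndex M x : ℝ) + 1 := Int.lt_floor_add_one _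
  have hdM : d * M = M * t - gridIndex M x := by rw [hd]; field_simp
  have hd0 : 0 ≤ d := by
    by_contra! h
    nlinarith
  have hd1 : d ≤ 1 / M := by
    rw [le_div_iff₀ hM0]; linarith
  have hd2 : d ≤ 1 := hd1.trans ((div_le_one hM0).2 hM')
  have hg : gridPoint M (gridIndex M x) = Real.sinh (t - d) := by
    rw [gridPoint, hd]; ring_nf
  have hx : x = Real.sinh t := (Real.sinh_arsinh x).symm
  have h := abs_sinh_sub_sinh_le (t := t) hd0 hd2
  rw [← hx, ← hg, ht, Real.cosh_arsinh] at h
  have hs : √(1 + x ^ 2) ≤ 1 + |x| := by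
    rw [Real.sqrt_le_left (by positivity)]
    nlinarith [sq_abs x, abs_nonneg x]
  calc _ ≤ 3 * d * √(1 + x ^ 2) := h
    _ ≤ 3 * (1 / M) * (1 + |x|) := by gcongr
    _ = _ := by ring

/-- The cells meeting `[-M, M]` have indices bounded by this number. -/
def gridRadius (M : ℕ) : ℕ := ⌈M * Real.arsinh M⌉₊

theorem gridIndex_mem_Icc {M : ℕ} {x : ℝ} (hx : |x| ≤ M) :
    gridIndex M x ∈ Finset.Icc (-(gridRadius M : ℤ)) (gridRadius M) := by
  have h := abs_le.1 hx
  have hc : (M : ℝ) * Real.arsinh M ≤ gridRadius M := Nat.le_ceil _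
  have h1 : Real.arsinh x ≤ Real.arsinh M := Real.arsinh_le_arsinh.2 h.2
  have h2 : -Real.arsinh M ≤ Real.arsinh x := by
    rw [← Real.arsinh_neg]; exact Real.arsinh_le_arsinh.2 h.1
  have hM0 : (0 : ℝ) ≤ M := M.cast_nonneg
  rw [Finset.mem_Icc, gridIndex, Int.le_floor]
  constructor
  · push_cast
    nlinarith
  · have : (⌊(M : ℝ) * Real.arsinh x⌋ : ℝ) ≤ gridRadius M := by
      refine (Int.floor_le _).trans ?_
      nlinarith
    exact_mod_cast this

theorem two_mul_gridRadius_add_one_le {M : ℕ} (hM : 1 ≤ M) :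
    ((2 * gridRadius M + 1 : ℕ) : ℝ) ≤ 7 * (M * Real.log (M + 2)) := by
  have hM' : (1 : ℝ) ≤ M := by exact_mod_cast hM
  have h0 : 0 ≤ Real.arsinh M := Real.arsinh_nonneg_iff.2 (by linarith)
  have h1 : (gridRadius M : ℝ) < M * Real.arsinh M + 1 := Nat.ceil_lt_add_one (by positivity)
  have h2 : Real.arsinh M ≤ 2 * Real.log (M + 2) := by
    rw [← Real.exp_le_exp, Real.exp_arsinh, two_mul, Real.exp_add, Real.exp_log (by linarith)]
    have hs : √(1 + (M : ℝ) ^ 2) ≤ 1 + M := by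
      rw [Real.sqrt_le_left (by positivity)]
      nlinarith
    nlinarith
  have h3 : 1 ≤ Real.log (M + 2) := by
    rw [← Real.exp_le_exp, Real.exp_log (by linarith)]
    linarith [Real.exp_one_lt_d9]
  push_cast
  nlinarith

theorem lintegral_enorm_le_of_jump {g : ℝ → ℂ} {a c p q R ρ : ℝ} (hp : 0 ≤ p) (hq : 0 ≤ q)
    (hR : 0 ≤ R) (hρ : 0 ≤ ρ)
    (hg : ∀ y, g y = 0 ∨ (|a + y| ≤ R ∧ ‖g y‖ ≤ p) ∨ (|a + y - c| ≤ ρ ∧ ‖g y‖ ≤ q)) :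
    ∫⁻ y, ‖g y‖ₑ ≤ ENNReal.ofReal (p * (2 * R) + q * (2 * ρ)) := by
  calc ∫⁻ y, ‖g y‖ₑ
      ≤ ∫⁻ y, ((Metric.closedBall (-a) R).indicator (fun _ => ENNReal.ofReal p) y +
          (Metric.closedBall (c - a) ρ).indicator (fun _ => ENNReal.ofReal q) y) := by
        refine lintegral_mono fun y => ?_
        rcases hg y with h | ⟨h, h'⟩ | ⟨h, h'⟩
        · simp [h]
        · have hy : y ∈ Metric.closedBall (-a) R := by
            rw [Metric.mem_closedBall, Real.dist_eq]; convert h using 2; ring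
          rw [Set.indicator_of_mem hy, ← ofReal_norm]
          exact (ENNReal.ofReal_le_ofReal h').trans le_self_add
        · have hy : y ∈ Metric.closedBall (c - a) ρ := by
            rw [Metric.mem_closedBall, Real.dist_eq]; convert h using 2; ring
          rw [Set.indicator_of_mem hy (fun _ => ENNReal.ofReal q), ← ofReal_norm]
          exact (ENNReal.ofReal_le_ofReal h').trans le_add_self
    _ = _ := by
        rw [lintegral_add_left
            (measurable_const.indicator Metric.isClosed_closedBall.measurableSet),
          lintegral_indicator_const Metric.isClosed_closedBall.measurableSet,
          lintegral_indicator_const Metric.isClosed_closedBall.measurableSet,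
          Real.volume_closedBall, Real.volume_closedBall, ← ENNReal.ofReal_mul hp,
          ← ENNReal.ofReal_mul hq, ENNReal.ofReal_add (by positivity) (by positivity)]

/-- The restriction of `m` to the part of the `j`-th grid cell inside `[-M, M]`. -/
def gridCell (m : ℝ → ℂ) (M : ℕ) (j : ℤ) : ℝ → ℂ :=
  {x : ℝ | |x| ≤ M ∧ gridIndex M x = j}.indicator m

theorem measurableSet_gridCell (M : ℕ) (j : ℤ) :
    MeasurableSet {x : ℝ | |x| ≤ M ∧ gridIndex M x = j} :=
  (measurableSet_le measurable_id.abs measurable_const).inter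
    (measurable_gridIndex M (measurableSet_singleton j))

theorem memLp_gridCell {m : ℝ → ℂ} (hm : Measurable m) (hm1 : ∀ x, ‖m x‖ ≤ 1) (M : ℕ) (j : ℤ) :
    MemLp (gridCell m M j) 2 (volume : Measure ℝ) := by
  have hS := measurableSet_gridCell M j
  have hfin : volume {x : ℝ | |x| ≤ M ∧ gridIndex M x = j} ≠ ⊤ := by
    refine ne_top_of_le_ne_top (b := volume (Metric.closedBall (0 : ℝ) M)) ?_
      (measure_mono fun x hx => by simpa using hx.1)
    rw [Real.volume_closedBall]; exact ENNReal.ofReal_ne_top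
  refine (memLp_indicator_const 2 hS (1 : ℂ) (Or.inr hfin)).mono
    (hm.indicator hS).aestronglyMeasurable (Eventually.of_forall fun x => ?_)
  rw [gridCell, Set.indicator_apply, Set.indicator_apply]
  split_ifs <;> simp [hm1]

theorem integral_formIntegrand_grid_eq_zero {m : ℝ → ℂ} (hm : Measurable m)
    (hm1 : ∀ x, ‖m x‖ ≤ 1) {M : ℕ} (G : ℤ → ℝ → ℂ) {F : ℝ × ℝ → ℂ}
    (hF : ∀ x y, F (x, y) = if |x| ≤ M then m x * G (gridIndex M x) y else 0) {f u : L2R}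
    (hf : ∀ j, ⟪(memLp_gridCell hm hm1 M j).toLp, f⟫_ℂ = 0)
    (hint : Integrable (formIntegrand F f u)) : ∫ p, formIntegrand F f u p = 0 := by
  set s := Finset.Icc (-(gridRadius M : ℤ)) (gridRadius M)
  let A : ℤ → ℝ × ℝ → ℂ := fun j p =>
    (starRingEnd ℂ (f p.1) * gridCell m M j p.1) * (G j p.2 * u p.2)
  have hA : ∀ j, A j = {p : ℝ × ℝ | gridIndex M p.1 = j}.indicator (formIntegrand F f u) := by
    intro j
    ext ⟨x, y⟩
    by_cases hj : gridIndex M x = j <;> by_cases hx : |x| ≤ M <;>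
      simp [A, gridCell, formIntegrand, hF, hj, hx]
    ring
  have hAint : ∀ j ∈ s, Integrable (A j) := fun j _ => by
    rw [hA]
    exact hint.indicator ((measurable_gridIndex M).comp measurable_fst (measurableSet_singleton j))
  have hsum : formIntegrand F f u = fun p => ∑ j ∈ s, A j p := by
    ext ⟨x, y⟩
    simp only [hA, Set.indicator_apply, Set.mem_ofPred_eq, Finset.sum_ite_eq]
    by_cases hx : |x| ≤ M
    · rw [if_pos (gridIndex_mem_Icc hx)]
    · simp [formIntegrand, hF, hx]
  rw [hsum, integral_finsetSum s hAint]
  refine Finset.sum_eq_zero fun j _ => ?_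
  have h0 : ∫ x, starRingEnd ℂ (f x) * gridCell m M j x = 0 := by
    have h := congrArg (starRingEnd ℂ) (hf j)
    rw [inner_conj_symm, L2.inner_def, map_zero] at h
    rw [← h]
    refine integral_congr_ae ?_
    filter_upwards [(memLp_gridCell hm hm1 M j).coeFn_toLp] with x hx
    rw [hx, RCLike.inner_apply]
    ring
  have h := integral_prod_mul (μ := (volume : Measure ℝ)) (ν := (volume : Measure ℝ))
    (fun x => starRingEnd ℂ (f x) * gridCell m M j x) (fun y => G j y * u y)
  rw [h0, zero_mul] at h
  exact h

/-- A kernel that decays like `1 / (1 + |x|)` in a strip around the antidiagonal and is Lipschitz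
in `x`, at the same scale, off a jump along the line `x + y = c`. -/
theorem isLogApprox_of_jump {H : ℝ × ℝ → ℂ} (hH : Measurable H) {m n : ℝ → ℂ}
    (hm : Measurable m) (hn : Measurable n) (hm1 : ∀ x, ‖m x‖ ≤ 1) (hn1 : ∀ y, ‖n y‖ ≤ 1)
    {R C c : ℝ} (hR : 0 ≤ R) (hC : 0 ≤ C) (hsupp : ∀ x y, R < |x + y| → H (x, y) = 0)
    (hdecay : ∀ x y, ‖H (x, y)‖ * (1 + |x|) ≤ C)
    (hlip : ∀ x x' y, |x - x'| ≤ 6 → (x + y < c ↔ x' + y < c) →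
      ‖H (x, y) - H (x', y)‖ * (1 + |x|) ≤ C * |x - x'|) :
    IsLogApprox fun p => m p.1 * n p.2 * H p := by
  have hmul : ∀ x y (z : ℂ), ‖m x * n y * z‖ ≤ ‖z‖ := fun x y z => by
    rw [norm_mul, norm_mul]
    have : ‖m x‖ * ‖n y‖ ≤ 1 := mul_le_one₀ (hm1 x) (norm_nonneg _) (hn1 y)
    exact mul_le_of_le_one_left (norm_nonneg _) this
  have hW : ∀ x : ℝ, 0 < 1 + |x| := fun x => by positivity
  have hKm : Measurable fun p : ℝ × ℝ => m p.1 * n p.2 * H p :=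
    ((hm.comp measurable_fst).mul (hn.comp measurable_snd)).mul hH
  have hbound : ∀ x y, ‖m x * n y * H (x, y)‖ ≤ C := fun x y =>
    (hmul x y _).trans (le_trans (le_mul_of_one_le_right (norm_nonneg _)
      (by linarith [abs_nonneg x])) (hdecay x y))
  have hKrow : ∀ x, ∫⁻ y, ‖m x * n y * H (x, y)‖ₑ ≤ ENNReal.ofReal (C * (2 * R) + 0 * (2 * 0)) :=
    fun x => lintegral_enorm_le_of_jump (a := x) (c := 0) hC le_rfl hR le_rfl fun y => by
      rcases lt_or_ge R |x + y| with h | h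
      · left; simp [hsupp x y h]
      · right; left; exact ⟨h, hbound x y⟩
  have hKcol : ∀ y, ∫⁻ x, ‖m x * n y * H (x, y)‖ₑ ≤ ENNReal.ofReal (C * (2 * R) + 0 * (2 * 0)) :=
    fun y => lintegral_enorm_le_of_jump (a := y) (c := 0) hC le_rfl hR le_rfl fun x => by
      rcases lt_or_ge R |x + y| with h | h
      · left; simp [hsupp x y h]
      · right; left; exact ⟨by rwa [add_comm y x], hbound x y⟩
  have hKint : ∀ f u : L2R, Integrable (formIntegrand (fun p => m p.1 * n p.2 * H p) f u) :=
    schur_integrable hKm hKrow hKcol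
  set A := 1 + (R + 6) with hA
  have hA0 : 0 < A := by positivity
  set B := 3 * C * (2 * (R + 6)) + 8 * C * A * (2 * (3 * A)) with hB
  have hB0 : 0 ≤ B := by positivity
  refine ⟨hKint, 7 + B, by positivity, fun M hM => ?_⟩
  have hM' : (1 : ℝ) ≤ M := by exact_mod_cast hM
  have hM0 : (0 : ℝ) < M := by linarith
  let g : ℤ → L2R := fun j => (memLp_gridCell hm hm1 M j).toLp
  set s := Finset.Icc (-(gridRadius M : ℤ)) (gridRadius M) with hs
  classical
  refine ⟨Submodule.span ℂ ((s.image g : Finset L2R) : Set L2R), 2 * gridRadius M + 1, ?_, ?_,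
    fun f hf u => ?_⟩
  · refine (rank_span_finset_le _).trans ?_
    have h1 : s.card = 2 * gridRadius M + 1 := by
      rw [hs, Int.card_Icc]; omega
    exact_mod_cast (Finset.card_image_le.trans h1.le)
  · refine (two_mul_gridRadius_add_one_le hM).trans ?_
    gcongr
    · exact mul_log_add_two_nonneg M
    · linarith
  let r : ℝ → ℝ := fun x => gridPoint M (gridIndex M x)
  have hr : Measurable r := (measurable_gridPoint M).comp (measurable_gridIndex M)
  let F : ℝ × ℝ → ℂ := fun p => if |p.1| ≤ M then m p.1 * n p.2 * H (r p.1, p.2) else 0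
  have hFm : Measurable F := by
    refine Measurable.ite (measurableSet_le measurable_fst.abs measurable_const) ?_
      measurable_const
    exact ((hm.comp measurable_fst).mul (hn.comp measurable_snd)).mul
      (hH.comp ((hr.comp measurable_fst).prodMk measurable_snd))
  let D : ℝ × ℝ → ℂ := fun p => m p.1 * n p.2 * H p - F p
  have hDm : Measurable D := hKm.sub hFm
  have hD : ∀ x y, D (x, y) = 0 ∨ (|x + y| ≤ R + 6 ∧ ‖D (x, y)‖ ≤ 3 * C / M) ∨
      (|x + y| ≤ R + 6 ∧ |x + y - c| ≤ 3 * (1 + |x|) / M ∧ ‖D (x, y)‖ ≤ 8 * C / (1 + |x|)) := by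
    intro x y
    by_cases hx : |x| ≤ M
    · have hd := abs_sub_gridPoint_le hM x
      change |x - r x| ≤ _ at hd
      have hd6 : |x - r x| ≤ 6 := hd.trans (by rw [div_le_iff₀ hM0]; linarith)
      have hDeq : D (x, y) = m x * n y * (H (x, y) - H (r x, y)) := by
        simp only [D, F, if_pos hx]; ring
      rw [hDeq]
      rcases lt_or_ge (R + 6) |x + y| with h | h
      · left
        have h' : R < |r x + y| := by
          have := abs_sub_abs_le_abs_sub (x + y) (r x + y)
          rw [add_sub_add_right_eq_sub] at this
          linarith
        rw [hsupp x y (by linarith), hsupp _ y h']; simp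
      · right
        by_cases hj : x + y < c ↔ r x + y < c
        · left
          refine ⟨h, (hmul x y _).trans ?_⟩
          have h1 := (hlip x (r x) y hd6 hj).trans (mul_le_mul_of_nonneg_left hd hC)
          have h2 : C * (3 * (1 + |x|) / M) = 3 * C / M * (1 + |x|) := by ring
          rw [h2] at h1
          exact le_of_mul_le_mul_right h1 (hW x)
        · right
          refine ⟨h, ?_, (hmul x y _).trans ?_⟩
          · refine le_trans ?_ hd
            rw [abs_le]
            have := le_abs_self (x - r x)
            have := neg_abs_le (x - r x)
            constructor <;> by_contra! h' <;> apply hj <;> constructor <;> intro h'' <;> linarith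
          · have h1 := hdecay x y
            have h2 := hdecay (r x) y
            have h3 : |x| ≤ |r x| + 6 := by
              have := abs_sub_abs_le_abs_sub x (r x); linarith
            rw [le_div_iff₀ (hW x)]
            have h4 : ‖H (x, y) - H (r x, y)‖ ≤ ‖H (x, y)‖ + ‖H (r x, y)‖ := norm_sub_le _ _
            have h5 : ‖H (r x, y)‖ * (1 + |x|) ≤ 7 * C := by
              nlinarith [norm_nonneg (H (r x, y)), abs_nonneg (r x),
                mul_nonneg (norm_nonneg (H (r x, y))) (abs_nonneg (r x))]
            nlinarith [hW x]
    · have hDeq : D (x, y) = m x * n y * H (x, y) := by simp only [D, F, if_neg hx]; ring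
      rw [hDeq]
      rcases lt_or_ge R |x + y| with h | h
      · left; simp [hsupp x y h]
      · right; left
        refine ⟨by linarith, (hmul x y _).trans ?_⟩
        rw [le_div_iff₀ hM0]
        nlinarith [hdecay x y, norm_nonneg (H (x, y))]
  have hcomp : ∀ x y : ℝ, |x + y| ≤ R + 6 → 1 + |x| ≤ A * (1 + |y|) := by
    intro x y h
    have h1 : |x| ≤ |x + y| + |y| := by
      have := abs_sub (x + y) y; rwa [add_sub_cancel_right] at this
    nlinarith [abs_nonneg y]
  have hq : ∀ x : ℝ, 3 * C / M * (2 * (R + 6)) +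
      8 * C * A / (1 + |x|) * (2 * (3 * A * (1 + |x|) / M)) = B / M := by
    intro x
    have := (hW x).ne'
    rw [hB]; field_simp
  have hA1 : 1 ≤ A := by linarith
  have hDrow : ∀ x, ∫⁻ y, ‖D (x, y)‖ₑ ≤ ENNReal.ofReal (B / M) := fun x => by
    rw [← hq x]
    refine lintegral_enorm_le_of_jump (a := x) (c := c) (by positivity) (by positivity)
      (by positivity) (by positivity) fun y => ?_
    rcases hD x y with h | h | ⟨h, h', h''⟩
    · exact Or.inl h
    · exact Or.inr (Or.inl h)
    · refine Or.inr (Or.inr ⟨h'.trans ?_, h''.trans ?_⟩)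
      · gcongr; linarith
      · exact div_le_div_of_nonneg_right (le_mul_of_one_le_right (by positivity) hA1) (hW x).le
  have hDcol : ∀ y, ∫⁻ x, ‖D (x, y)‖ₑ ≤ ENNReal.ofReal (B / M) := fun y => by
    rw [← hq y]
    refine lintegral_enorm_le_of_jump (a := y) (c := c) (by positivity) (by positivity)
      (by positivity) (by positivity) fun x => ?_
    rw [add_comm y x]
    rcases hD x y with h | h | ⟨h, h', h''⟩
    · exact Or.inl h
    · exact Or.inr (Or.inl h)
    · refine Or.inr (Or.inr ⟨h'.trans ?_, h''.trans ?_⟩)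
      · refine div_le_div_of_nonneg_right ?_ hM0.le
        have := hcomp x y h
        linarith
      · rw [div_le_div_iff₀ (hW x) (hW y)]
        have := mul_le_mul_of_nonneg_left (hcomp y x (by rwa [add_comm]))
          (by positivity : 0 ≤ 8 * C)
        linarith
  have hDint : Integrable (formIntegrand D f u) := schur_integrable hDm hDrow hDcol f u
  have hsplit : formIntegrand F f u =
      formIntegrand (fun p => m p.1 * n p.2 * H p) f u - formIntegrand D f u := by
    ext p; simp [formIntegrand, D]; ring
  have hFint : Integrable (formIntegrand F f u) := by
    rw [hsplit]; exact (hKint f u).sub hDint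
  have hF0 : ∫ p, formIntegrand F f u p = 0 := by
    refine integral_formIntegrand_grid_eq_zero (M := M) hm hm1
      (fun j y => n y * H (gridPoint M j, y)) (fun x y => ?_) (fun j => ?_) hFint
    · simp only [F, r]; split_ifs <;> ring
    · by_cases hj : j ∈ s
      · exact Submodule.inner_right_of_mem_orthogonal
          (Submodule.subset_span (by exact_mod_cast Finset.mem_image_of_mem g hj)) hf
      · have h0 : gridCell m M j = 0 := by
          ext x
          refine Set.indicator_of_notMem (fun hx => hj ?_) _
          rw [← hx.2]
          exact gridIndex_mem_Icc hx.1
        have : (memLp_gridCell hm hm1 M j).toLp = 0 := by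
          refine (Lp.eq_zero_iff_ae_eq_zero).2 ((MemLp.coeFn_toLp _).trans ?_)
          rw [h0]
        rw [this, inner_zero_left]
  have hKD : ∫ p, formIntegrand (fun p => m p.1 * n p.2 * H p) f u p =
      ∫ p, formIntegrand D f u p := by
    rw [hsplit] at hF0
    simp only [Pi.sub_apply] at hF0
    rw [integral_sub (hKint f u) hDint] at hF0
    exact sub_eq_zero.1 hF0
  rw [hKD]
  refine (schur_norm_le hDm (by positivity) hDrow hDcol f u).trans ?_
  gcongr
  linarith

theorem norm_exp_I_mul_ofReal_eq_one (t : ℝ) : ‖Complex.exp (Complex.I * t)‖ = 1 := by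
  rw [mul_comm, Complex.norm_exp_ofReal_mul_I]

theorem hasDerivAt_exp_I_mul (t η : ℝ) :
    HasDerivAt (fun η : ℝ => Complex.exp (Complex.I * (t * η : ℝ)))
      (Complex.I * t * Complex.exp (Complex.I * (t * η : ℝ))) η := by
  have h : HasDerivAt (fun η : ℝ => Complex.I * (t * η : ℝ)) (Complex.I * t) η := by
    have := ((hasDerivAt_id η).const_mul t).ofReal_comp.const_mul Complex.I
    simpa using this
  simpa [mul_comm] using h.cexp

/-- An oscillatory integral over a half-line is `O(1 / (1 + |t|))`. -/
theorem norm_oscillatory_integral_le {χ χ' : ℝ → ℂ} (hd : ∀ η, HasDerivAt χ (χ' η) η)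
    (hc : Continuous χ') {L B : ℝ} (hL : 0 ≤ L) (hB : ∀ η, ‖χ η‖ ≤ B) (hB' : ∀ η, ‖χ' η‖ ≤ B)
    (h0 : ∀ η ≤ -L, χ η = 0) (t : ℝ) :
    ‖∫ η in Set.Iio (0 : ℝ), Complex.exp (Complex.I * (t * η : ℝ)) * χ η‖ * (1 + |t|) ≤
      (1 + 2 * L) * B := by
  set e : ℝ → ℂ := fun η => Complex.exp (Complex.I * (t * η : ℝ)) with he
  have hec : Continuous e := by fun_prop
  have hχc : Continuous χ := continuous_iff_continuousAt.2 fun η => (hd η).continuousAt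
  have he1 : ∀ η, ‖e η‖ = 1 := fun η => norm_exp_I_mul_ofReal_eq_one _
  have hint : ∫ η in Set.Iio (0 : ℝ), e η * χ η = ∫ η in (-L)..0, e η * χ η := by
    rw [← integral_Iic_eq_integral_Iio, intervalIntegral.integral_of_le (by linarith)]
    refine setIntegral_eq_of_subset_of_forall_sdiff_eq_zero measurableSet_Iic
      Set.Ioc_subset_Iic_self fun η hη => ?_
    rw [h0 η (by by_contra! h; exact hη.2 ⟨h, hη.1⟩), mul_zero]
  have h1 : ‖∫ η in (-L)..0, e η * χ η‖ ≤ B * L := by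
    have := intervalIntegral.norm_integral_le_of_norm_le_const (a := -L) (b := 0) (C := B)
      (f := fun η => e η * χ η) fun η _ => by rw [norm_mul, he1, one_mul]; exact hB η
    simpa [abs_of_nonneg hL] using this
  have h2 : ‖∫ η in (-L)..0, e η * χ' η‖ ≤ B * L := by
    have := intervalIntegral.norm_integral_le_of_norm_le_const (a := -L) (b := 0) (C := B)
      (f := fun η => e η * χ' η) fun η _ => by rw [norm_mul, he1, one_mul]; exact hB' η
    simpa [abs_of_nonneg hL] using this
  have h3 : Complex.I * t * (∫ η in (-L)..0, e η * χ η) =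
      χ 0 - ∫ η in (-L)..0, e η * χ' η := by
    have hFTC : ∫ η in (-L)..0, (Complex.I * t * e η * χ η + e η * χ' η) =
        e 0 * χ 0 - e (-L) * χ (-L) := by
      refine intervalIntegral.integral_eq_sub_of_hasDerivAt (f := fun η => e η * χ η)
        (fun η _ => (hasDerivAt_exp_I_mul t η).mul (hd η)) ?_
      exact Continuous.intervalIntegrable (by fun_prop) _ _
    rw [intervalIntegral.integral_add (Continuous.intervalIntegrable (by fun_prop) _ _)
      (Continuous.intervalIntegrable (by fun_prop) _ _), h0 (-L) le_rfl] at hFTC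
    simp only [mul_assoc, intervalIntegral.integral_const_mul] at hFTC ⊢
    have : e 0 = 1 := by simp [he]
    rw [this] at hFTC
    linear_combination hFTC
  have h4 : |t| * ‖∫ η in (-L)..0, e η * χ η‖ ≤ B + B * L := by
    have : |t| * ‖∫ η in (-L)..0, e η * χ η‖ = ‖Complex.I * t * (∫ η in (-L)..0, e η * χ η)‖ := by
      simp
    rw [this, h3]
    exact (norm_sub_le _ _).trans (add_le_add (hB 0) h2)
  rw [hint]
  linarith

/-- Uniform bounds for a test function and its derivative in the second variable. -/
structure TestBounds (ψ ψ' : ℝ × ℝ → ℝ) (R b : ℝ) : Prop where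
  radius_nonneg : 0 ≤ R
  bound_nonneg : 0 ≤ b
  continuous : Continuous ψ
  continuous_deriv : Continuous ψ'
  hasDerivAt : ∀ s η, HasDerivAt (fun η => ψ (s, η)) (ψ' (s, η)) η
  abs_le : ∀ p, |ψ p| ≤ b
  abs_deriv_le : ∀ p, |ψ' p| ≤ b
  lipschitz : ∀ s s' η, |ψ (s, η) - ψ (s', η)| ≤ b * |s - s'|
  lipschitz_deriv : ∀ s s' η, |ψ' (s, η) - ψ' (s', η)| ≤ b * |s - s'|
  eq_zero : ∀ s η, R < |s| ∨ R < |η| → ψ (s, η) = 0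
  deriv_eq_zero : ∀ s η, R < |s| ∨ R < |η| → ψ' (s, η) = 0

theorem exists_bound_lipschitz {ψ : ℝ × ℝ → ℝ} (hψ : ContDiff ℝ (⊤ : ℕ∞) ψ)
    (hs : HasCompactSupport ψ) : ∃ b, 0 ≤ b ∧ (∀ p, |ψ p| ≤ b) ∧
      ∀ s s' η, |ψ (s, η) - ψ (s', η)| ≤ b * |s - s'| := by
  obtain ⟨C, hC⟩ := hψ.continuous.bounded_above_of_compact_support hs
  obtain ⟨K, hK⟩ : ∃ K, LipschitzWith K ψ :=
    hψ.lipschitzWith_of_hasCompactSupport hs (by simp)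
  refine ⟨|C| + K, by positivity, fun p => (hC p).trans ?_, fun s s' η => ?_⟩
  · linarith [le_abs_self C, K.coe_nonneg]
  · have h := hK.dist_le_mul (s, η) (s', η)
    rw [Real.dist_eq, Prod.dist_eq, dist_self, max_eq_left dist_nonneg, Real.dist_eq] at h
    nlinarith [abs_nonneg C, abs_nonneg (s - s')]

theorem exists_testBounds {ψ : ℝ × ℝ → ℝ} (hψ : ContDiff ℝ (⊤ : ℕ∞) ψ)
    (hs : HasCompactSupport ψ) : ∃ ψ' R b, TestBounds ψ ψ' R b := by
  have hψ' : ContDiff ℝ (⊤ : ℕ∞) fun p => fderiv ℝ ψ p (0, 1) :=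
    (hψ.fderiv_right (by simp)).clm_apply contDiff_const
  have hs' : HasCompactSupport fun p => fderiv ℝ ψ p (0, 1) := hs.fderiv_apply ℝ (0, 1)
  obtain ⟨b, hb, h1, h2⟩ := exists_bound_lipschitz hψ hs
  obtain ⟨b', hb', h1', h2'⟩ := exists_bound_lipschitz hψ' hs'
  obtain ⟨R, hR⟩ := (hs.isCompact.isBounded).subset_closedBall (0 : ℝ × ℝ)
  have hout : ∀ s η, |R| < |s| ∨ |R| < |η| → (s, η) ∉ tsupport ψ := fun s η h hmem => by
    have := hR hmem
    rw [mem_closedBall_zero_iff, Prod.norm_def] at this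
    have h3 := (le_max_left |s| |η|).trans (this.trans (le_abs_self R))
    have h4 := (le_max_right |s| |η|).trans (this.trans (le_abs_self R))
    rcases h with h | h <;> linarith
  refine ⟨_, |R|, b + b', abs_nonneg R, by positivity, hψ.continuous, hψ'.continuous, fun s η => ?_,
    fun p => (h1 p).trans (by linarith), fun p => (h1' p).trans (by linarith),
    fun s s' η => (h2 s s' η).trans (by gcongr; linarith),
    fun s s' η => (h2' s s' η).trans (by gcongr; linarith),
    fun s η h => image_eq_zero_of_notMem_tsupport (hout s η h), fun s η h => ?_⟩
  · have hf := (hψ.differentiable (by simp) (s, η)).hasFDerivAt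
    exact hf.comp_hasDerivAt η ((hasDerivAt_const η s).prodMk (hasDerivAt_id η))
  · have : fderiv ℝ ψ (s, η) = 0 :=
      fderiv_of_notMem_tsupport (𝕜 := ℝ) (hout s η h)
    simp [this]

/-- The Weyl kernel of the symbol `ψ` restricted to a quarter-plane. -/
def halfKernel (ψ : ℝ × ℝ → ℝ) (c : ℝ) (p : ℝ × ℝ) : ℂ :=
  if p.1 + p.2 < c then (2 * Real.pi : ℝ)⁻¹ * ∫ η in Set.Iio (0 : ℝ),
    Complex.exp (Complex.I * ((p.1 - p.2) * η : ℝ)) * ψ ((p.1 + p.2) / 2, η) else 0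

theorem measurable_halfKernel {ψ : ℝ × ℝ → ℝ} (hψ : Continuous ψ) (c : ℝ) :
    Measurable (halfKernel ψ c) := by
  refine Measurable.ite (measurableSet_lt (by fun_prop) measurable_const) ?_ measurable_const
  refine Measurable.const_mul ?_ _
  have : StronglyMeasurable fun q : (ℝ × ℝ) × ℝ =>
      Complex.exp (Complex.I * ((q.1.1 - q.1.2) * q.2 : ℝ)) * (ψ ((q.1.1 + q.1.2) / 2, q.2) : ℂ) :=
    Continuous.stronglyMeasurable (by fun_prop)
  exact (this.integral_prod_right' (ν := volume.restrict (Set.Iio 0))).measurable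

theorem norm_two_pi_inv_mul_le (z : ℂ) : ‖(((2 * Real.pi)⁻¹ : ℝ) : ℂ) * z‖ ≤ ‖z‖ := by
  rw [norm_mul, Complex.norm_real, Real.norm_eq_abs,
    abs_of_pos (by positivity : (0 : ℝ) < (2 * Real.pi)⁻¹)]
  refine mul_le_of_le_one_left (norm_nonneg _) (inv_le_one_of_one_le₀ ?_)
  linarith [Real.pi_gt_three]

theorem norm_exp_I_mul_ofReal_sub_one_le (t : ℝ) : ‖Complex.exp (Complex.I * t) - 1‖ ≤ |t| :=
  Real.norm_exp_I_mul_ofReal_sub_one_le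

namespace TestBounds

variable {ψ ψ' : ℝ × ℝ → ℝ} {R b : ℝ}

theorem integrable (h : TestBounds ψ ψ' R b) (t s : ℝ) :
    Integrable fun η : ℝ => Complex.exp (Complex.I * (t * η : ℝ)) * (ψ (s, η) : ℂ) := by
  have hc := h.continuous
  refine Continuous.integrable_of_hasCompactSupport (by fun_prop) ?_
  refine HasCompactSupport.intro (isCompact_closedBall (0 : ℝ) R) fun η hη => ?_
  rw [mem_closedBall_zero_iff, Real.norm_eq_abs, not_le] at hη
  simp [h.eq_zero s η (Or.inr hη)]

theorem norm_halfLine_le (h : TestBounds ψ ψ' R b) (t s : ℝ) :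
    ‖∫ η in Set.Iio (0 : ℝ), Complex.exp (Complex.I * (t * η : ℝ)) * (ψ (s, η) : ℂ)‖ * (1 + |t|) ≤
      (1 + 2 * (R + 1)) * b := by
  have hR := h.radius_nonneg
  have hc := h.continuous_deriv
  refine norm_oscillatory_integral_le (χ := fun η => (ψ (s, η) : ℂ))
    (χ' := fun η => (ψ' (s, η) : ℂ)) (fun η => (h.hasDerivAt s η).ofReal_comp) (by fun_prop)
    (by positivity) (fun η => ?_) (fun η => ?_) (fun η hη => ?_) t
  · simpa using h.abs_le (s, η)
  · simpa using h.abs_deriv_le (s, η)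
  · rw [h.eq_zero s η (Or.inr ?_), Complex.ofReal_zero]
    rw [abs_of_nonpos (by linarith)]
    linarith

theorem norm_halfLine_sub_le (h : TestBounds ψ ψ' R b) (t t' s s' : ℝ)
    (hs : |s - s'| ≤ |t - t'|) :
    ‖(∫ η in Set.Iio (0 : ℝ), Complex.exp (Complex.I * (t * η : ℝ)) * (ψ (s, η) : ℂ)) -
      ∫ η in Set.Iio (0 : ℝ), Complex.exp (Complex.I * (t' * η : ℝ)) * (ψ (s', η) : ℂ)‖ *
        (1 + |t|) ≤ (1 + 2 * (R + 1)) * ((2 + R) * b * |t - t'|) := by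
  have hR := h.radius_nonneg
  have hb := h.bound_nonneg
  have hc := h.continuous
  have hc' := h.continuous_deriv
  set δ := t' - t with hδ
  have habs : |t - t'| = |δ| := abs_sub_comm _ _
  rw [habs] at hs ⊢
  rw [← integral_sub (h.integrable t s).integrableOn (h.integrable t' s').integrableOn]
  have heq : ∀ η : ℝ, Complex.exp (Complex.I * (t * η : ℝ)) * (ψ (s, η) : ℂ) -
      Complex.exp (Complex.I * (t' * η : ℝ)) * (ψ (s', η) : ℂ) =
      Complex.exp (Complex.I * (t * η : ℝ)) *
        (ψ (s, η) - Complex.exp (Complex.I * (δ * η : ℝ)) * ψ (s', η)) := fun η => by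
    rw [mul_sub, ← mul_assoc, ← Complex.exp_add, hδ]
    congr 4
    push_cast
    ring
  simp only [heq]
  have hexp : ∀ (η : ℝ) (z : ℝ), (R < |η| → z = 0) → |z| ≤ b →
      ‖(Complex.exp (Complex.I * (δ * η : ℝ)) - 1) * z‖ ≤ R * b * |δ| := fun η z hz hzb => by
    rcases lt_or_ge R |η| with hη | hη
    · rw [hz hη]
      simp only [Complex.ofReal_zero, mul_zero, norm_zero]
      positivity
    · rw [norm_mul, Complex.norm_real, Real.norm_eq_abs]
      have h1 : ‖Complex.exp (Complex.I * (δ * η : ℝ)) - 1‖ ≤ |δ| * R :=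
        (norm_exp_I_mul_ofReal_sub_one_le _).trans (by rw [abs_mul]; gcongr)
      calc _ ≤ |δ| * R * b := by gcongr
        _ = R * b * |δ| := by ring
  have hdiff : ∀ (η z w : ℝ), |z - w| ≤ b * |s - s'| → (R < |η| → w = 0) → |w| ≤ b →
      ‖(z : ℂ) - Complex.exp (Complex.I * (δ * η : ℝ)) * w‖ ≤ (1 + R) * b * |δ| :=
    fun η z w hzw hw hwb => by
    have : (z : ℂ) - Complex.exp (Complex.I * (δ * η : ℝ)) * w =
        ((z - w : ℝ) : ℂ) - (Complex.exp (Complex.I * (δ * η : ℝ)) - 1) * w := by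
      push_cast; ring
    rw [this]
    refine (norm_sub_le _ _).trans ?_
    have h1 : ‖((z - w : ℝ) : ℂ)‖ ≤ b * |δ| := by
      rw [Complex.norm_real, Real.norm_eq_abs]
      exact hzw.trans (by gcongr)
    linarith [hexp η w hw hwb]
  refine norm_oscillatory_integral_le
    (χ' := fun η => (ψ' (s, η) : ℂ) - (Complex.I * δ * Complex.exp (Complex.I * (δ * η : ℝ)) *
      ψ (s', η) + Complex.exp (Complex.I * (δ * η : ℝ)) * ψ' (s', η)))
    (fun η => (h.hasDerivAt s η).ofReal_comp.sub
      ((hasDerivAt_exp_I_mul δ η).mul (h.hasDerivAt s' η).ofReal_comp)) (by fun_prop)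
    (by positivity) (fun η => ?_) (fun η => ?_) (fun η hη => ?_) t
  · refine (hdiff η _ _ (h.lipschitz s s' η) (fun hη => h.eq_zero s' η (Or.inr hη))
      (h.abs_le _)).trans ?_
    gcongr
    norm_num
  · have h1 := hdiff η _ _ (h.lipschitz_deriv s s' η) (fun hη => h.deriv_eq_zero s' η (Or.inr hη))
      (h.abs_deriv_le _)
    have h2 : ‖Complex.I * δ * Complex.exp (Complex.I * (δ * η : ℝ)) * (ψ (s', η) : ℂ)‖ ≤
        b * |δ| := by
      rw [norm_mul, norm_mul, norm_mul, norm_exp_I_mul_ofReal_eq_one, Complex.norm_I,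
        Complex.norm_real, Complex.norm_real, Real.norm_eq_abs, Real.norm_eq_abs, one_mul, mul_one,
        mul_comm]
      have := h.abs_le (s', η)
      gcongr
    rw [add_comm (Complex.I * δ * _ * _), ← sub_sub]
    refine (norm_sub_le _ _).trans ?_
    linarith
  · have hη' : R < |η| := by
      rw [abs_of_nonpos (by linarith)]
      linarith
    simp [h.eq_zero s η (Or.inr hη'), h.eq_zero s' η (Or.inr hη')]

theorem halfKernel_eq_zero (h : TestBounds ψ ψ' R b) (c : ℝ) {x y : ℝ} (hxy : 2 * R < |x + y|) :
    halfKernel ψ c (x, y) = 0 := by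
  have : R < |(x + y) / 2| := by
    rw [abs_div, abs_two]
    linarith
  simp [halfKernel, h.eq_zero ((x + y) / 2) _ (Or.inl this)]

theorem norm_halfKernel_sub_le (h : TestBounds ψ ψ' R b) (c : ℝ) {x x' y : ℝ}
    (hc : x + y < c ↔ x' + y < c) :
    ‖halfKernel ψ c (x, y) - halfKernel ψ c (x', y)‖ * (1 + |x - y|) ≤
      (1 + 2 * (R + 1)) * ((2 + R) * b * |x - x'|) := by
  have hR := h.radius_nonneg
  have hb := h.bound_nonneg
  by_cases hx : x + y < c
  · simp only [halfKernel, hx, hc.1 hx, if_true, ← mul_sub]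
    have := h.norm_halfLine_sub_le (x - y) (x' - y) ((x + y) / 2) ((x' + y) / 2) (by
      rw [show (x + y) / 2 - (x' + y) / 2 = (x - x') / 2 by ring, sub_sub_sub_cancel_right, abs_div,
        abs_two]
      linarith [abs_nonneg (x - x')])
    rw [sub_sub_sub_cancel_right] at this
    refine le_trans ?_ this
    gcongr
    exact norm_two_pi_inv_mul_le _
  · simp only [halfKernel, hx, mt hc.2 hx, if_false, sub_self, norm_zero, zero_mul]
    positivity

theorem norm_halfKernel_le (h : TestBounds ψ ψ' R b) (c x y : ℝ) :
    ‖halfKernel ψ c (x, y)‖ * (1 + |x - y|) ≤ (1 + 2 * (R + 1)) * b := by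
  have hR := h.radius_nonneg
  have hb := h.bound_nonneg
  by_cases hx : x + y < c
  · simp only [halfKernel, hx, if_true]
    refine le_trans ?_ (h.norm_halfLine_le (x - y) ((x + y) / 2))
    gcongr
    exact norm_two_pi_inv_mul_le _
  · simp only [halfKernel, hx, if_false, norm_zero, zero_mul]
    positivity

theorem one_add_abs_le_mul {r x y : ℝ} (hxy : |x + y| ≤ r) : 1 + |x| ≤ (1 + r) * (1 + |x - y|) := by
  have h1 : 2 * |x| ≤ |x + y| + |x - y| := by
    have := abs_add_le (x + y) (x - y)
    rwa [show x + y + (x - y) = 2 * x by ring, abs_mul, abs_two] at this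
  nlinarith [abs_nonneg (x - y), abs_nonneg (x + y)]

/-- Multiplying by phases keeps the kernel of a quarter-plane symbol well approximable. -/
theorem isLogApprox (h : TestBounds ψ ψ' R b) (c : ℝ) {m n : ℝ → ℂ} (hm : Measurable m)
    (hn : Measurable n) (hm1 : ∀ x, ‖m x‖ ≤ 1) (hn1 : ∀ y, ‖n y‖ ≤ 1) :
    IsLogApprox fun p => m p.1 * n p.2 * halfKernel ψ c p := by
  have hR := h.radius_nonneg
  have hb := h.bound_nonneg
  have hB : (1 + 2 * (R + 1)) * b ≤ (1 + 2 * (R + 1)) * ((2 + R) * b) := by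
    gcongr
    nlinarith
  refine isLogApprox_of_jump (measurable_halfKernel h.continuous c) hm hn hm1 hn1
    (R := 2 * R) (C := (1 + (2 * R + 6)) * ((1 + 2 * (R + 1)) * ((2 + R) * b))) (c := c)
    (by positivity) (by positivity) (fun x y => h.halfKernel_eq_zero c) (fun x y => ?_)
    fun x x' y hx hc => ?_
  · by_cases hxy : 2 * R < |x + y|
    · rw [h.halfKernel_eq_zero c hxy, norm_zero, zero_mul]
      positivity
    · calc ‖halfKernel ψ c (x, y)‖ * (1 + |x|)
          ≤ ‖halfKernel ψ c (x, y)‖ * ((1 + (2 * R + 6)) * (1 + |x - y|)) := by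
            gcongr; exact one_add_abs_le_mul (by linarith)
        _ = (1 + (2 * R + 6)) * (‖halfKernel ψ c (x, y)‖ * (1 + |x - y|)) := by ring
        _ ≤ _ := by
            exact mul_le_mul_of_nonneg_left ((h.norm_halfKernel_le c x y).trans hB) (by positivity)
  · by_cases hxy : 2 * R + 6 < |x + y|
    · have hxy' : 2 * R < |x' + y| := by
        have := abs_add_le (x' + y) (x - x')
        rw [show x' + y + (x - x') = x + y by ring] at this
        linarith
      rw [h.halfKernel_eq_zero c hxy', h.halfKernel_eq_zero c (by linarith), sub_zero, norm_zero,
        zero_mul]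
      positivity
    · calc ‖halfKernel ψ c (x, y) - halfKernel ψ c (x', y)‖ * (1 + |x|)
          ≤ ‖halfKernel ψ c (x, y) - halfKernel ψ c (x', y)‖ *
            ((1 + (2 * R + 6)) * (1 + |x - y|)) := by
            gcongr; exact one_add_abs_le_mul (by linarith)
        _ = (1 + (2 * R + 6)) *
            (‖halfKernel ψ c (x, y) - halfKernel ψ c (x', y)‖ * (1 + |x - y|)) := by ring
        _ ≤ (1 + (2 * R + 6)) * ((1 + 2 * (R + 1)) * ((2 + R) * b * |x - x'|)) := by
            exact mul_le_mul_of_nonneg_left (h.norm_halfKernel_sub_le c hc) (by positivity)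
        _ = _ := by ring

end TestBounds

/-- The integral kernel of the Weyl operator with symbol `a`. -/
def weylKernel (a : ℝ × ℝ → ℂ) (p : ℝ × ℝ) : ℂ :=
  (2 * Real.pi : ℝ)⁻¹ * ∫ ξ : ℝ,
    Complex.exp (Complex.I * ((p.1 - p.2) * ξ : ℝ)) * a ((p.1 + p.2) / 2, ξ)

/-- Indicator function of `{(s, ξ) | s < c, ξ < α s + β}`. -/
def wedge (c α β : ℝ) (p : ℝ × ℝ) : ℂ := if p.1 < c ∧ p.2 < α * p.1 + β then 1 else 0

theorem weylKernel_wedge_mul (φ : ℝ × ℝ → ℝ) (c α β : ℝ) :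
    weylKernel (fun p => wedge c α β p * φ p) =
      fun p => Complex.exp (Complex.I * (α * p.1 ^ 2 / 2 + β * p.1 : ℝ)) *
        Complex.exp (Complex.I * (-(α * p.2 ^ 2 / 2 + β * p.2) : ℝ)) *
        halfKernel (fun q => φ (q.1, q.2 + (α * q.1 + β))) (2 * c) p := by
  funext ⟨x, y⟩
  by_cases h : x + y < 2 * c
  · have hc : (x + y) / 2 < c := by linarith
    simp only [weylKernel, halfKernel, h, wedge, hc, true_and, if_true]
    rw [← integral_add_right_eq_self _ (α * ((x + y) / 2) + β), mul_left_comm,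
      ← integral_indicator measurableSet_Iio]
    simp only [← integral_const_mul]
    congr 1
    funext η
    congr 1
    simp only [Set.indicator_apply, Set.mem_Iio]
    by_cases hη : η < 0
    · rw [if_pos (by linarith), if_pos hη, one_mul, ← mul_assoc, ← Complex.exp_add,
        ← Complex.exp_add]
      congr 2
      push_cast
      ring
    · rw [if_neg (by linarith), if_neg hη, zero_mul, mul_zero, mul_zero]
  · have hc : ¬ (x + y) / 2 < c := by linarith
    simp [weylKernel, halfKernel, h, wedge, hc]

theorem hasCompactSupport_shear {φ : ℝ × ℝ → ℝ} (hφ : HasCompactSupport φ) (α β : ℝ) :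
    HasCompactSupport fun q : ℝ × ℝ => φ (q.1, q.2 + (α * q.1 + β)) := by
  let e : ℝ × ℝ ≃ₜ ℝ × ℝ :=
    { toFun := fun q => (q.1, q.2 + (α * q.1 + β))
      invFun := fun q => (q.1, q.2 - (α * q.1 + β))
      left_inv := fun q => by simp
      right_inv := fun q => by simp
      continuous_toFun := by fun_prop
      continuous_invFun := by fun_prop }
  exact hφ.comp_homeomorph e

theorem isLogApprox_wedge {φ : ℝ × ℝ → ℝ} (hφ : ContDiff ℝ (⊤ : ℕ∞) φ) (hs : HasCompactSupport φ)
    (c α β : ℝ) : IsLogApprox (weylKernel fun p => wedge c α β p * φ p) := by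
  rw [weylKernel_wedge_mul]
  have hsm : ContDiff ℝ (⊤ : ℕ∞) fun q : ℝ × ℝ => φ (q.1, q.2 + (α * q.1 + β)) :=
    hφ.comp (by fun_prop)
  obtain ⟨ψ', R, b, hb⟩ := exists_testBounds hsm (hasCompactSupport_shear hs α β)
  refine hb.isLogApprox (2 * c)
    (m := fun x => Complex.exp (Complex.I * (α * x ^ 2 / 2 + β * x : ℝ)))
    (n := fun y => Complex.exp (Complex.I * (-(α * y ^ 2 / 2 + β * y) : ℝ))) ?_ ?_ ?_ ?_
  · exact Continuous.measurable (by fun_prop)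
  · exact Continuous.measurable (by fun_prop)
  · exact fun x => (norm_exp_I_mul_ofReal_eq_one _).le
  · exact fun x => (norm_exp_I_mul_ofReal_eq_one _).le

theorem HasCompactSupport.integrable_slice {φ : ℝ × ℝ → ℝ} (hφ : Continuous φ)
    (hs : HasCompactSupport φ) (s : ℝ) : Integrable fun ξ => φ (s, ξ) := by
  refine Continuous.integrable_of_hasCompactSupport (by fun_prop) ?_
  refine HasCompactSupport.intro (hs.isCompact.image continuous_snd) fun ξ hξ => ?_
  exact image_eq_zero_of_notMem_tsupport fun h => hξ ⟨_, h, rfl⟩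

/-- The span of the indicator functions of the sets `{(s, ξ) | s < c, ξ < α s + β}`. -/
def wedgeSpan : Submodule ℂ (ℝ × ℝ → ℂ) :=
  Submodule.span ℂ {w | ∃ c α β, w = wedge c α β}

theorem wedge_mem_wedgeSpan (c α β : ℝ) : wedge c α β ∈ wedgeSpan :=
  Submodule.subset_span ⟨c, α, β, rfl⟩

theorem measurable_wedge (c α β : ℝ) : Measurable (wedge c α β) := by
  refine Measurable.ite ?_ measurable_const measurable_const
  exact (measurableSet_lt measurable_fst measurable_const).inter
    (measurableSet_lt measurable_snd (by fun_prop))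

theorem integrable_weylKernel_slice {φ : ℝ × ℝ → ℝ} (hφ : Continuous φ) (hs : HasCompactSupport φ)
    {χ : ℝ × ℝ → ℂ} (hχ : Measurable χ) {B : ℝ} (hB : ∀ p, ‖χ p‖ ≤ B) (t s : ℝ) :
    Integrable fun ξ : ℝ => Complex.exp (Complex.I * (t * ξ : ℝ)) * (χ (s, ξ) * φ (s, ξ)) := by
  have h := (hs.integrable_slice hφ s).ofReal (𝕜 := ℂ)
  refine (h.bdd_mul (f := fun ξ => Complex.exp (Complex.I * (t * ξ : ℝ)) * χ (s, ξ)) (c := B)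
    ?_ (ae_of_all _ fun ξ => ?_)).congr (ae_of_all _ fun ξ => ?_)
  · exact ((Continuous.measurable (by fun_prop)).mul
      (hχ.comp measurable_prodMk_left)).aestronglyMeasurable
  · rw [norm_mul, norm_exp_I_mul_ofReal_eq_one, one_mul]
    exact hB _
  · simp only [mul_assoc]
    rfl

/-- Bounded measurable multipliers of `φ` whose Weyl kernel is well approximable. -/
structure IsLogMultiplier (φ : ℝ × ℝ → ℝ) (χ : ℝ × ℝ → ℂ) : Prop where
  measurable : Measurable χ
  bounded : ∃ B, ∀ p, ‖χ p‖ ≤ B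
  isLogApprox : IsLogApprox (weylKernel fun p => χ p * φ p)

theorem isLogMultiplier_of_mem_wedgeSpan {φ : ℝ × ℝ → ℝ} (hφ : ContDiff ℝ (⊤ : ℕ∞) φ)
    (hs : HasCompactSupport φ) {χ : ℝ × ℝ → ℂ} (hχ : χ ∈ wedgeSpan) : IsLogMultiplier φ χ := by
  induction hχ using Submodule.span_induction with
  | mem χ h =>
    obtain ⟨c, α, β, rfl⟩ := h
    refine ⟨measurable_wedge c α β, ⟨1, fun p => ?_⟩, isLogApprox_wedge hφ hs c α β⟩
    unfold wedge
    split_ifs <;> simp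
  | zero =>
    refine ⟨measurable_const, ⟨0, fun p => by simp⟩, ?_⟩
    have : weylKernel (fun p => (0 : ℝ × ℝ → ℂ) p * φ p) = 0 := by
      funext p
      simp [weylKernel]
    rw [this]
    exact IsLogApprox.zero
  | add χ₁ χ₂ _ _ h₁ h₂ =>
    obtain ⟨B₁, hB₁⟩ := h₁.bounded
    obtain ⟨B₂, hB₂⟩ := h₂.bounded
    refine ⟨h₁.measurable.add h₂.measurable,
      ⟨B₁ + B₂, fun p => (norm_add_le _ _).trans (add_le_add (hB₁ p) (hB₂ p))⟩, ?_⟩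
    have : weylKernel (fun p => (χ₁ + χ₂) p * φ p) =
        weylKernel (fun p => χ₁ p * φ p) + weylKernel fun p => χ₂ p * φ p := by
      funext p
      simp only [weylKernel, Pi.add_apply, add_mul, mul_add]
      rw [integral_add (integrable_weylKernel_slice hφ.continuous hs h₁.measurable hB₁ _ _)
        (integrable_weylKernel_slice hφ.continuous hs h₂.measurable hB₂ _ _), mul_add]
    rw [this]
    exact h₁.isLogApprox.add h₂.isLogApprox
  | smul a χ _ h =>
    obtain ⟨B, hB⟩ := h.bounded
    refine ⟨h.measurable.const_smul a, ⟨‖a‖ * B, fun p => ?_⟩, ?_⟩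
    · rw [Pi.smul_apply, norm_smul]
      exact mul_le_mul_of_nonneg_left (hB p) (norm_nonneg a)
    have : weylKernel (fun p => (a • χ) p * φ p) = a • weylKernel fun p => χ p * φ p := by
      funext p
      simp only [weylKernel, Pi.smul_apply, smul_eq_mul]
      rw [mul_left_comm a, ← integral_const_mul a]
      simp only [mul_left_comm, mul_assoc]
    rw [this]
    exact h.isLogApprox.smul a

/-- Half-planes of the form `{s < c}` or `{ξ < α s + β}`. -/
def IsHalfPlane (E : Set (ℝ × ℝ)) : Prop :=
  (∃ c, E = {p | p.1 < c}) ∨ ∃ α β, E = {p | p.2 < α * p.1 + β}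

theorem wedge_mul_wedge_mem {α α' : ℝ} (h : α < α') (c β β' : ℝ) :
    wedge c α β * wedge c α' β' ∈ wedgeSpan := by
  set s₀ := (β - β') / (α' - α) with hs₀
  have : wedge c α β * wedge c α' β' =
      wedge (min c s₀) α' β' + (wedge c α β - wedge (min c s₀) α β) := by
    funext ⟨s, ξ⟩
    have hs : s < s₀ ↔ α' * s + β' < α * s + β := by
      rw [hs₀, lt_div_iff₀ (by linarith)]
      constructor <;> intro <;> linarith
    simp only [wedge, Pi.mul_apply, Pi.add_apply, Pi.sub_apply, lt_min_iff, hs]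
    split_ifs <;> first | (simp; done) | (exfalso; grind)
  rw [this]
  exact add_mem (wedge_mem_wedgeSpan _ _ _)
    (sub_mem (wedge_mem_wedgeSpan _ _ _) (wedge_mem_wedgeSpan _ _ _))

theorem IsHalfPlane.indicator_mul_mem {E : Set (ℝ × ℝ)} (hE : IsHalfPlane E) {w : ℝ × ℝ → ℂ}
    (hw : w ∈ wedgeSpan) : E.indicator w ∈ wedgeSpan := by
  induction hw using Submodule.span_induction with
  | mem w h =>
    obtain ⟨c, α, β, rfl⟩ := h
    rcases hE with ⟨c', rfl⟩ | ⟨α', β', rfl⟩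
    · convert wedge_mem_wedgeSpan (min c c') α β using 1
      funext p
      simp only [Set.indicator_apply, Set.mem_ofPred_eq, wedge, lt_min_iff]
      split_ifs <;> first | rfl | (exfalso; grind)
    · rcases lt_trichotomy α α' with h | rfl | h
      · convert wedge_mul_wedge_mem h c β β' using 1
        funext p
        simp only [Set.indicator_apply, Set.mem_ofPred_eq, wedge, Pi.mul_apply]
        split_ifs <;> first | (simp; done) | (exfalso; grind)
      · convert wedge_mem_wedgeSpan c α (min β β') using 1
        funext p
        simp only [Set.indicator_apply, Set.mem_ofPred_eq, wedge, ← min_add_add_left, lt_min_iff]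
        split_ifs <;> first | rfl | (exfalso; grind)
      · convert wedge_mul_wedge_mem h c β' β using 1
        funext p
        simp only [Set.indicator_apply, Set.mem_ofPred_eq, wedge, Pi.mul_apply]
        split_ifs <;> first | (simp; done) | (exfalso; grind)
  | zero => simp
  | add w₁ w₂ _ _ h₁ h₂ => rw [Set.indicator_add']; exact add_mem h₁ h₂
  | smul a w _ h => exact (Set.indicator_const_smul E a w).symm ▸ Submodule.smul_mem _ a h

theorem mul_pattern_mem_wedgeSpan {n : ℕ} {E : Fin n → Set (ℝ × ℝ)} (hE : ∀ i, IsHalfPlane (E i))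
    (F : (Fin n → Prop) → ℂ) {w : ℝ × ℝ → ℂ} (hw : w ∈ wedgeSpan) :
    (fun p => w p * F fun i => p ∈ E i) ∈ wedgeSpan := by
  induction n generalizing w with
  | zero =>
    convert Submodule.smul_mem _ (F Fin.elim0) hw using 1
    funext p
    rw [Pi.smul_apply, smul_eq_mul, mul_comm, Subsingleton.elim Fin.elim0]
  | succ n ih =>
    have h₁ := (hE 0).indicator_mul_mem hw
    convert add_mem (ih (fun i => hE i.succ) (fun S => F (Fin.cons True S)) h₁)
      (ih (fun i => hE i.succ) (fun S => F (Fin.cons False S)) (sub_mem hw h₁)) using 1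
    funext p
    have hcons : (fun i => p ∈ E i) = Fin.cons (p ∈ E 0) fun i : Fin n => p ∈ E i.succ := by
      funext i
      refine Fin.cases rfl (fun i => rfl) i
    by_cases h : p ∈ E 0 <;> simp [hcons, h]

/-- Points outside the line `L` on the same side of it span a segment missing the line, where `E`
is one of the two sides. -/
structure IsLineSide (L E : Set (ℝ × ℝ)) : Prop where
  isHalfPlane : IsHalfPlane E
  disjoint_segment : ∀ p q, p ∉ L → q ∉ L → (p ∈ E ↔ q ∈ E) → Disjoint (segment ℝ p q) L
  finite_slices : ∃ Z : Set ℝ, Z.Finite ∧ ∀ s ∉ Z, {ξ | (s, ξ) ∈ L}.Finite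

theorem disjoint_segment_of_affine {a b d : ℝ} {p q : ℝ × ℝ} (hp : a * p.1 + b * p.2 + d ≠ 0)
    (hq : a * q.1 + b * q.2 + d ≠ 0)
    (h : a * p.1 + b * p.2 + d < 0 ↔ a * q.1 + b * q.2 + d < 0) {r : ℝ × ℝ}
    (hr : r ∈ segment ℝ p q) : a * r.1 + b * r.2 + d ≠ 0 := by
  obtain ⟨u, v, hu, hv, huv, rfl⟩ := hr
  have heq : a * (u • p + v • q).1 + b * (u • p + v • q).2 + d =
      u * (a * p.1 + b * p.2 + d) + v * (a * q.1 + b * q.2 + d) := by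
    simp only [Prod.fst_add, Prod.snd_add, Prod.smul_fst, Prod.smul_snd, smul_eq_mul]
    linear_combination (-d) * huv
  rw [heq]
  have huv' : 0 < u ∨ 0 < v := by
    by_contra! hn
    linarith
  rcases lt_or_gt_of_ne hp with hp' | hp'
  · have hq' := h.1 hp'
    refine ne_of_lt ?_
    rcases huv' with h0 | h0 <;> nlinarith
  · have hq' := lt_of_le_of_ne (not_lt.1 (mt h.2 hp'.not_gt)) hq.symm
    refine ne_of_gt ?_
    rcases huv' with h0 | h0 <;> nlinarith

theorem exists_isLineSide (P Q : ℝ × ℝ) : ∃ L E, IsLineSide L E ∧ segment ℝ P Q ⊆ L := by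
  by_cases h : P.1 = Q.1
  · refine ⟨{p | p.1 = P.1}, {p | p.1 < P.1}, ⟨Or.inl ⟨_, rfl⟩, fun p q hp hq hpq => ?_,
      {P.1}, Set.finite_singleton _, fun s hs => ?_⟩, ?_⟩
    · rw [Set.disjoint_left]
      intro r hr hrL
      simp only [Set.mem_ofPred_eq] at hp hq hpq hrL
      refine disjoint_segment_of_affine (a := 1) (b := 0) (d := -P.1) (fun h => hp (by linarith))
        (fun h => hq (by linarith)) ?_ hr (by linarith)
      constructor <;> intro h'
      · linarith [hpq.1 (by linarith)]
      · linarith [hpq.2 (by linarith)]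
    · convert Set.finite_empty
      ext ξ
      simpa using hs
    · rintro r ⟨u, v, -, -, huv, rfl⟩
      simp only [Set.mem_ofPred_eq, Prod.fst_add, Prod.smul_fst, smul_eq_mul]
      rw [← h, ← add_mul, huv, one_mul]
  · have h' : Q.1 - P.1 ≠ 0 := fun h0 => h (by linarith)
    obtain ⟨α, hα⟩ : ∃ α, Q.2 - P.2 = α * (Q.1 - P.1) := ⟨_, (div_mul_cancel₀ _ h').symm⟩
    set β := P.2 - α * P.1 with hβ
    refine ⟨{p | p.2 = α * p.1 + β}, {p | p.2 < α * p.1 + β}, ⟨Or.inr ⟨_, _, rfl⟩,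
      fun p q hp hq hpq => ?_, ∅, Set.finite_empty, fun s _ => ?_⟩, ?_⟩
    · rw [Set.disjoint_left]
      intro r hr hrL
      simp only [Set.mem_ofPred_eq] at hp hq hpq hrL
      refine disjoint_segment_of_affine (a := -α) (b := 1) (d := -β) (fun h => hp (by linarith))
        (fun h => hq (by linarith)) ?_ hr (by linarith)
      constructor <;> intro h'
      · linarith [hpq.1 (by linarith)]
      · linarith [hpq.2 (by linarith)]
    · simp
    · rintro r ⟨u, v, -, -, huv, rfl⟩
      simp only [Set.mem_ofPred_eq, Prod.fst_add, Prod.smul_fst, smul_eq_mul, Prod.snd_add,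
        Prod.smul_snd]
      obtain rfl : u = 1 - v := by linarith
      linear_combination v * hα - hβ

theorem mem_of_disjoint_segment_frontier {E : Type*} [NormedAddCommGroup E] [NormedSpace ℝ E]
    {Ω : Set E} {p q : E} (hp : p ∈ Ω) (h : Disjoint (segment ℝ p q) (frontier Ω)) : q ∈ Ω := by
  by_contra hq
  have hint : ∀ {A : Set E} {x : E}, x ∈ A → x ∉ frontier A → x ∈ interior A := fun hx hxA => by
    by_contra hxi
    exact hxA ⟨subset_closure hx, hxi⟩
  have hcov : ∀ x ∈ segment ℝ p q, x ∉ frontier Ω ∧ x ∉ frontier Ωᶜ := fun x hx => by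
    rw [frontier_compl, and_self]
    exact Set.disjoint_left.1 h hx
  obtain ⟨r, -, hr, hr'⟩ := (convex_segment p q).isPreconnected (interior Ω) (interior Ωᶜ)
    isOpen_interior isOpen_interior
    (fun x hx => (em (x ∈ Ω)).imp (fun h => hint h (hcov x hx).1) fun h => hint h (hcov x hx).2)
    ⟨p, left_mem_segment ℝ p q, hint hp (hcov p (left_mem_segment ℝ p q)).1⟩
    ⟨q, right_mem_segment ℝ p q, hint hq (hcov q (right_mem_segment ℝ p q)).2⟩
  exact interior_subset hr' (interior_subset hr)

/-- Off the lines carrying the sides, the symbol of a polygon is a combination of wedges. -/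
theorem IsPolygon.exists_wedgeSpan {Ω : Set (ℝ × ℝ)} (hΩ : IsPolygon Ω) {φ : ℝ × ℝ → ℝ}
    (hs : HasCompactSupport φ) : ∃ χ ∈ wedgeSpan, ∃ Z : Set ℝ, Z.Finite ∧ ∀ s ∉ Z,
      {ξ | symbAOm Ω φ (s, ξ) ≠ χ (s, ξ) * φ (s, ξ)}.Finite := by
  classical
  obtain ⟨-, -, n, P, Q, hfr⟩ := hΩ
  choose L E hLE hseg using fun i => exists_isLineSide (P i) (Q i)
  choose Z hZ hZL using fun i => (hLE i).finite_slices
  obtain ⟨R, hR⟩ := hs.isCompact.isBounded.subset_closedBall (0 : ℝ × ℝ)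
  let F : (Fin n → Prop) → ℂ := fun S =>
    if ∃ q ∈ Ω, (∀ i, q ∉ L i) ∧ ∀ i, q ∈ E i ↔ S i then 1 else 0
  have hF : ∀ p : ℝ × ℝ, (∀ i, p ∉ L i) → F (fun i => p ∈ E i) = Ω.indicator 1 p := by
    intro p hp
    rw [Set.indicator_apply, Pi.one_apply]
    refine if_congr ⟨?_, fun h => ⟨p, h, hp, fun i => Iff.rfl⟩⟩ rfl rfl
    rintro ⟨q, hq, hqL, hqE⟩
    refine mem_of_disjoint_segment_frontier hq ?_
    rw [hfr, Set.disjoint_iUnion_right]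
    exact fun i => ((hLE i).disjoint_segment q p (hqL i) (hp i) (hqE i)).mono_right (hseg i)
  refine ⟨_, mul_pattern_mem_wedgeSpan (fun i => (hLE i).isHalfPlane) F
    (wedge_mem_wedgeSpan (R + 1) 0 (R + 1)), ⋃ i, Z i, Set.finite_iUnion hZ, fun s hsZ => ?_⟩
  simp only [Set.mem_iUnion, not_exists] at hsZ
  refine (Set.finite_iUnion fun i => hZL i s (hsZ i)).subset fun ξ hξ => ?_
  by_contra hL
  simp only [Set.mem_iUnion, not_exists] at hL
  refine hξ ?_
  rw [hF (s, ξ) hL]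
  by_cases hφ : (s, ξ) ∈ tsupport φ
  · have := hR hφ
    rw [mem_closedBall_zero_iff, Prod.norm_def, max_le_iff] at this
    have h1 := (le_abs_self s).trans this.1
    have h2 := (le_abs_self ξ).trans this.2
    have hw : wedge (R + 1) 0 (R + 1) (s, ξ) = 1 :=
      if_pos ⟨by linarith, by linarith⟩
    rw [hw, one_mul, symbAOm, Set.indicator_apply, Set.indicator_apply]
    split_ifs <;> simp
  · simp [symbAOm, image_eq_zero_of_notMem_tsupport hφ, Set.indicator_apply]

theorem norm_symbAOm_le (Ω : Set (ℝ × ℝ)) (φ : ℝ × ℝ → ℝ) (p : ℝ × ℝ) :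
    ‖symbAOm Ω φ p‖ ≤ ‖φ p‖ := by
  by_cases h : p ∈ Ω <;> simp [symbAOm, h]

/-- On Schwartz functions, Weyl quantization is an integral operator. -/
theorem weylIntegral_symbAOm {Ω : Set (ℝ × ℝ)} (hΩ : IsOpen Ω) {φ : ℝ × ℝ → ℝ} (hφ : Continuous φ)
    (hs : HasCompactSupport φ) (u : SchwartzMap ℝ ℂ) (x : ℝ) :
    weylIntegral (symbAOm Ω φ) u x = ∫ y, weylKernel (symbAOm Ω φ) (x, y) * u y := by
  obtain ⟨B, hB⟩ := hφ.bounded_above_of_compact_support hs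
  obtain ⟨R, hR⟩ := hs.isCompact.isBounded.subset_closedBall (0 : ℝ × ℝ)
  have hu : Integrable u := u.integrable
  have hmeas : Measurable (symbAOm Ω φ) :=
    Measurable.indicator (Continuous.measurable (by fun_prop)) hΩ.measurableSet
  let g : ℝ → ℝ := (Metric.closedBall (0 : ℝ) R).indicator fun _ => B
  have hg : Integrable g :=
    (integrable_indicator_iff measurableSet_closedBall).2
      (integrableOn_const (isCompact_closedBall _ _).measure_lt_top.ne)
  have hbound : ∀ s ξ, ‖symbAOm Ω φ (s, ξ)‖ ≤ g ξ := fun s ξ => by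
    refine (norm_symbAOm_le Ω φ _).trans ?_
    by_cases h : (s, ξ) ∈ tsupport φ
    · have := hR h
      rw [mem_closedBall_zero_iff, Prod.norm_def, max_le_iff] at this
      rw [show g ξ = B from Set.indicator_of_mem (mem_closedBall_zero_iff.2 this.2) _]
      exact hB _
    · rw [image_eq_zero_of_notMem_tsupport h, norm_zero]
      exact Set.indicator_nonneg (fun _ _ => (norm_nonneg _).trans (hB 0)) _
  have hint : Integrable (Function.uncurry fun ξ y : ℝ =>
      Complex.exp (Complex.I * ((x - y) * ξ : ℝ)) * symbAOm Ω φ ((x + y) / 2, ξ) * u y)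
      (volume.prod volume) := by
    refine (hg.mul_prod hu.norm).mono' ?_ (ae_of_all _ fun p => ?_)
    · refine Measurable.aestronglyMeasurable ?_
      exact ((Continuous.measurable (by fun_prop)).mul (hmeas.comp (by fun_prop))).mul
        (u.continuous.measurable.comp measurable_snd)
    · simp only [Function.uncurry, norm_mul, norm_exp_I_mul_ofReal_eq_one, one_mul]
      gcongr
      exact hbound _ _
  rw [weylIntegral, integral_integral_swap hint, ← integral_const_mul]
  congr 1
  funext y
  rw [weylKernel, integral_mul_const, mul_assoc]

theorem weylKernel_ae_eq {a b : ℝ × ℝ → ℂ} {Z : Set ℝ} (hZ : Z.Finite)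
    (h : ∀ s ∉ Z, {ξ | a (s, ξ) ≠ b (s, ξ)}.Finite) (x : ℝ) :
    ∀ᵐ y, weylKernel a (x, y) = weylKernel b (x, y) := by
  have hfin : ((fun y : ℝ => (x + y) / 2) ⁻¹' Z).Finite := by
    refine hZ.preimage fun y _ z _ hyz => ?_
    have hyz : (x + y) / 2 = (x + z) / 2 := hyz
    linarith
  filter_upwards [hfin.measure_zero volume |> measure_eq_zero_iff_ae_notMem.1] with y hy
  unfold weylKernel
  congr 1
  refine integral_congr_ae ?_
  filter_upwards [(h _ hy).measure_zero volume |> measure_eq_zero_iff_ae_notMem.1] with ξ hξ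
  rw [not_not.1 hξ]

/-- The form of `A_Ω[φ]` on Schwartz functions is given by a well approximable kernel. -/
theorem IsPolygon.exists_isLogApprox_kernel {Ω : Set (ℝ × ℝ)} (hΩ : IsPolygon Ω)
    {φ : ℝ × ℝ → ℝ} (hφ : ContDiff ℝ (⊤ : ℕ∞) φ) (hs : HasCompactSupport φ)
    {T : L2R →L[ℂ] L2R} (hT : IsWeylOp (symbAOm Ω φ) T) :
    ∃ K, IsLogApprox K ∧ ∀ (f : L2R) (u : SchwartzMap ℝ ℂ),
      ⟪f, T (u.toLp 2)⟫_ℂ = ∫ p, formIntegrand K f (u.toLp 2) p := by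
  obtain ⟨χ, hχ, Z, hZ, hZχ⟩ := hΩ.exists_wedgeSpan hs
  have hK := (isLogMultiplier_of_mem_wedgeSpan hφ hs hχ).isLogApprox
  refine ⟨_, hK, fun f u => ?_⟩
  have hu : u.toLp 2 =ᵐ[volume] u := u.coeFn_toLp 2
  rw [L2.inner_def, Measure.volume_eq_prod, integral_prod _ (hK.1 f _)]
  refine integral_congr_ae ?_
  filter_upwards [hT u _ hu] with x hx
  rw [hx, weylIntegral_symbAOm hΩ.1 hφ.continuous hs, RCLike.inner_apply, mul_comm,
    ← integral_const_mul]
  refine integral_congr_ae ?_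
  filter_upwards [weylKernel_ae_eq (b := fun p => χ p * φ p) hZ hZχ x, hu] with y hy hyu
  rw [formIntegrand, hyu, hy, mul_assoc]

theorem IsPolygon.exists_form_bound {Ω : Set (ℝ × ℝ)} (hΩ : IsPolygon Ω)
    {φ : ℝ × ℝ → ℝ} (hφ : ContDiff ℝ (⊤ : ℕ∞) φ) (hs : HasCompactSupport φ)
    {T : L2R →L[ℂ] L2R} (hT : IsWeylOp (symbAOm Ω φ) T) :
    ∃ C, 0 ≤ C ∧ ∀ M : ℕ, 1 ≤ M → ∃ (V : Submodule ℂ L2R) (n : ℕ), Module.rank ℂ V ≤ n ∧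
      (n : ℝ) ≤ C * (M * Real.log (M + 2)) ∧
      ∀ f ∈ Vᗮ, ‖f‖ = 1 → ‖⟪f, T f⟫_ℂ‖ ≤ 2 * C / M := by
  obtain ⟨K, ⟨-, C, hC, hK⟩, hTK⟩ := hΩ.exists_isLogApprox_kernel hφ hs hT
  refine ⟨C, hC, fun M hM => ?_⟩
  obtain ⟨V, n, hV, hn, hVK⟩ := hK M hM
  refine ⟨V, n, hV, hn, fun f hf hf1 => ?_⟩
  have hclosed : IsClosed {g : L2R | ‖⟪f, T g⟫_ℂ‖ ≤ C / M * (‖f‖ ^ 2 + ‖g‖ ^ 2)} :=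
    isClosed_le (by fun_prop) (by fun_prop)
  have hdense := SchwartzMap.denseRange_toLpCLM (E := ℝ) (F := ℂ) (p := 2) (μ := volume) (by simp)
  have := hdense.induction_on (p := fun g : L2R => ‖⟪f, T g⟫_ℂ‖ ≤ C / M * (‖f‖ ^ 2 + ‖g‖ ^ 2)) f
    hclosed fun u => by
      rw [SchwartzMap.toLpCLM_apply, hTK]
      exact hVK f hf _
  rw [hf1] at this
  refine this.trans (le_of_eq ?_)
  ring

section

variable {H : Type*} [NormedAddCommGroup H] [InnerProductSpace ℂ H] (A : H →L[ℂ] H)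

theorem re_inner_apply_le_norm_inner (u : H) : (⟪A u, u⟫_ℂ).re ≤ ‖⟪u, A u⟫_ℂ‖ := by
  rw [norm_inner_symm]
  exact Complex.re_le_norm _

theorem norm_inner_apply_le {u : H} (hu : ‖u‖ = 1) : ‖⟪u, A u⟫_ℂ‖ ≤ ‖A‖ := by
  refine (norm_inner_le_norm _ _).trans ?_
  rw [hu, one_mul]
  have := A.le_opNorm u
  rwa [hu, mul_one] at this

/-- Bounding the form on the orthogonal complement of a `k`-dimensional space bounds `eigPlus`. -/
theorem eigPlus_le_s2 {V : Submodule ℂ H} {k : ℕ} (hV : Module.rank ℂ V ≤ (k : Cardinal)) {B : ℝ}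
    (hB : 0 ≤ B) (h : ∀ f ∈ Vᗮ, ‖f‖ = 1 → ‖⟪f, A f⟫_ℂ‖ ≤ B) : eigPlus A k ≤ B := by
  refine ciInf_le_of_le ⟨-‖A‖, ?_⟩ ⟨V, hV⟩
    (Real.iSup_le (fun u => (re_inner_apply_le_norm_inner A _).trans (h _ u.2.1 u.2.2)) hB)
  rintro _ ⟨W, rfl⟩
  dsimp only
  rcases isEmpty_or_nonempty {u : H // u ∈ (W : Submodule ℂ H)ᗮ ∧ ‖u‖ = 1} with hW | ⟨⟨u⟩⟩
  · rw [Real.iSup_of_isEmpty]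
    exact neg_nonpos.2 (norm_nonneg A)
  · refine le_ciSup_of_le ⟨‖A‖, ?_⟩ u ?_
    · rintro _ ⟨v, rfl⟩
      exact (re_inner_apply_le_norm_inner A _).trans (norm_inner_apply_le A v.2.2)
    · have h1 := norm_inner_apply_le A u.2.2
      rw [norm_inner_symm] at h1
      linarith [neg_abs_le (⟪A u.1, u.1⟫_ℂ).re, Complex.abs_re_le_norm ⟪A u.1, u.1⟫_ℂ]

theorem eigPlus_le_and_eigMinus_le {V : Submodule ℂ H} {k : ℕ}
    (hV : Module.rank ℂ V ≤ (k : Cardinal)) {B : ℝ} (hB : 0 ≤ B)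
    (h : ∀ f ∈ Vᗮ, ‖f‖ = 1 → ‖⟪f, A f⟫_ℂ‖ ≤ B) : eigPlus A k ≤ B ∧ eigMinus A k ≤ B :=
  ⟨eigPlus_le_s2 A hV hB h, eigPlus_le_s2 (-A) hV hB fun f hf hf1 => by simpa using h f hf hf1⟩

end

/-- The number of steps fitting into `k` dimensions, up to a logarithm. -/
theorem exists_steps {C : ℝ} (hC : 0 ≤ C) (k : ℕ) :
    (k + 1 : ℝ) ≤ (4 * C + 4) * Real.log (k + 2) ∨
      ∃ M : ℕ, 1 ≤ M ∧ C * (M * Real.log (M + 2)) ≤ k ∧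
        1 / (M : ℝ) ≤ 2 * (4 * C + 4) * Real.log (k + 2) / (k + 1) := by
  have hlog : Real.log 2 ≤ Real.log (k + 2) := Real.log_le_log two_pos (by simp)
  have hlog2 := Real.log_two_gt_d9
  have hL : 0 ≤ Real.log (k + 2) := by linarith
  set L := Real.log (k + 2)
  set D := (4 * C + 4) * L with hD
  have hD2 : 2 ≤ D := by nlinarith
  rcases le_or_gt (k + 1 : ℝ) D with hk | hk
  · exact Or.inl hk
  right
  have hx : 1 ≤ (k + 1 : ℝ) / D := (one_le_div₀ (by linarith)).2 hk.le
  have hM1 : 1 ≤ ⌊(k + 1 : ℝ) / D⌋₊ := Nat.one_le_floor_iff _ |>.2 hx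
  have hMle := Nat.floor_le (a := (k + 1 : ℝ) / D) (by positivity)
  have hMlt := Nat.lt_floor_add_one ((k + 1 : ℝ) / D)
  have hM1' : (1 : ℝ) ≤ (⌊(k + 1 : ℝ) / D⌋₊ : ℝ) := by exact_mod_cast hM1
  refine ⟨_, hM1, ?_, ?_⟩
  · set M : ℝ := (⌊(k + 1 : ℝ) / D⌋₊ : ℝ)
    have hMD : M * D ≤ k + 1 := (le_div_iff₀ (by linarith)).1 hMle
    have hMk : M ≤ k + 1 := by nlinarith
    have hlogM : Real.log (M + 2) ≤ 2 * L := by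
      rw [← Real.log_rpow (by positivity) 2]
      refine Real.log_le_log (by linarith) ?_
      rw [Real.rpow_two]
      nlinarith [(k.cast_nonneg : (0 : ℝ) ≤ k)]
    have hCL : C * (M * Real.log (M + 2)) ≤ C * (M * (2 * L)) := by gcongr
    have : 0 ≤ M * L := by positivity
    have : 2 * (C * (M * (2 * L))) ≤ M * D := by rw [hD]; nlinarith
    linarith
  · rw [mul_assoc, ← hD, div_le_div_iff₀ (by linarith) (by positivity)]
    have := (div_lt_iff₀ (by linarith)).1 hMlt
    nlinarith

/-- **Corollary.** For a polygon `Ω ⊂ ℝ²` and real-valued `φ ∈ C_0^∞(ℝ²)`, the eigenvalues of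
`A_Ω[φ]` satisfy `λ_k^{(±)}(A_Ω[φ]) = O(k^{-1} log k)`. -/
theorem polygon_eigenvalue_bound
    (Ω : Set (ℝ × ℝ)) (hΩ : IsPolygon Ω)
    (φ : ℝ × ℝ → ℝ) (hφ_smooth : ContDiff ℝ (⊤ : ℕ∞) φ) (hφ_supp : HasCompactSupport φ)
    (T : L2R →L[ℂ] L2R) (hT : IsWeylOp (symbAOm Ω φ) T) :
    ∃ C : ℝ, ∀ k : ℕ,
      eigPlus T k ≤ C * Real.log (k + 2) / (k + 1) ∧
      eigMinus T k ≤ C * Real.log (k + 2) / (k + 1) := by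
  obtain ⟨C, hC, hform⟩ := hΩ.exists_form_bound hφ_smooth hφ_supp hT
  refine ⟨4 * C * (4 * C + 4) + ‖T‖ * (4 * C + 4), fun k => ?_⟩
  have hlog : 0 ≤ Real.log (k + 2) := Real.log_nonneg (by linarith [(k.cast_nonneg : (0 : ℝ) ≤ k)])
  have hbound : ∃ B, 0 ≤ B ∧ B ≤ (4 * C * (4 * C + 4) + ‖T‖ * (4 * C + 4)) *
      Real.log (k + 2) / (k + 1) ∧ ∃ V : Submodule ℂ L2R, Module.rank ℂ V ≤ (k : Cardinal) ∧
        ∀ f ∈ Vᗮ, ‖f‖ = 1 → ‖⟪f, T f⟫_ℂ‖ ≤ B := by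
    rcases exists_steps hC k with hk | ⟨M, hM, hMk, hMinv⟩
    · refine ⟨‖T‖, norm_nonneg T, ?_, ⊥, by simp, fun f _ hf => norm_inner_apply_le T hf⟩
      rw [le_div_iff₀ (by positivity), add_mul, mul_assoc ‖T‖]
      have := mul_le_mul_of_nonneg_left hk (norm_nonneg T)
      have : 0 ≤ 4 * C * (4 * C + 4) * Real.log (k + 2) := by positivity
      linarith
    · obtain ⟨V, n, hV, hn, hVT⟩ := hform M hM
      refine ⟨2 * C / M, by positivity, ?_, V, hV.trans ?_, hVT⟩
      · calc 2 * C / M = 2 * C * (1 / M) := by ring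
          _ ≤ 2 * C * (2 * (4 * C + 4) * Real.log (k + 2) / (k + 1)) := by gcongr
          _ = 4 * C * (4 * C + 4) * Real.log (k + 2) / (k + 1) := by ring
          _ ≤ _ := by
            gcongr
            exact le_add_of_nonneg_right (by positivity)
      · exact_mod_cast hn.trans hMk
  obtain ⟨B, hB, hBle, V, hV, hVT⟩ := hbound
  obtain ⟨h₁, h₂⟩ := eigPlus_le_and_eigMinus_le T hV hB hVT
  exact ⟨h₁.trans hBle, h₂.trans hBle⟩

end
end
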